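/- Let λ ∈ (0,1), c_λ > 0, f: ℝ → ℝ Lipschitz continuous, T > 0 and u₀ ∈ L¹(ℝ) ∩ BV(ℝ). Then there exists a BV entropy solution u of ∂_t u + ∂_x f(u) = g_λ[u] with initial datum u₀, and it is unique: if u and v are two BV entropy solutions with the same initial datum u₀, then u(·,t) = v(·,t) in L¹(ℝ) for every t ∈ [0,T]. -/

import Mathlib

open MeasureTheory Set Filter
open scoped ENNReal NNReal

/-- The fractional Laplacian `g_λ = -(-∂_x²)^{λ/2}` acting on `φ : ℝ → ℝ`,
defined through the singular integral `c_λ ∫ (φ(x+z) - φ(x)) / |z|^{1+λ} dz`. -/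
noncomputable def fracLap (lam clam : ℝ) (φ : ℝ → ℝ) (x : ℝ) : ℝ :=
  clam * ∫ z : ℝ, (φ (x + z) - φ x) / |z| ^ (1 + lam)

/-- The Kruzkov-type entropy functional
`Λ[v, ψ, k] = ∫_{Q_T} (η_k(v) ∂_t ψ + q_k(v) ∂_x ψ + η'_k(v) g_λ[v] ψ)
  + ∫ η_k(u₀) ψ(·,0) − ∫ η_k(v(·,T)) ψ(·,T)`,
where `η_k(u) = |u − k|`, `η'_k(u) = sgn(u − k)` and `q_k(u) = η'_k(u)(f(u) − f(k))`.
Here `v t x` is the value at time `t` and point `x`, and `ψ x t` is a test function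
(space first). -/
noncomputable def entropyFunctional (lam clam T : ℝ) (f u₀ : ℝ → ℝ) (v : ℝ → ℝ → ℝ)
    (ψ : ℝ → ℝ → ℝ) (k : ℝ) : ℝ :=
  (∫ t in Set.Ioo (0 : ℝ) T, ∫ x : ℝ,
      (|v t x - k| * deriv (fun τ => ψ x τ) t
        + Real.sign (v t x - k) * (f (v t x) - f k) * deriv (fun y => ψ y t) x
        + Real.sign (v t x - k) * fracLap lam clam (v t) x * ψ x t))
  + (∫ x : ℝ, |u₀ x - k| * ψ x 0) - ∫ x : ℝ, |v T x - k| * ψ x T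

/-- `u` is a BV entropy solution of `∂_t u + ∂_x f(u) = g_λ[u]` on `ℝ × (0,T)` with
initial datum `u₀`: it is bounded, lies in `C([0,T]; L¹(ℝ)) ∩ L^∞(0,T; BV(ℝ))`, and
satisfies the entropy inequality `Λ[u, ψ, k] ≥ 0` for every `k ∈ ℝ` and every
nonnegative test function `ψ ∈ C_c^∞(ℝ × [0,T])`. -/
def IsBVEntropySol (lam clam T : ℝ) (f u₀ : ℝ → ℝ) (u : ℝ → ℝ → ℝ) : Prop :=
  (∃ M : ℝ, ∀ t ∈ Set.Icc (0 : ℝ) T, ∀ x : ℝ, |u t x| ≤ M) ∧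
  (∀ t ∈ Set.Icc (0 : ℝ) T, MeasureTheory.Integrable (u t)) ∧
  (∀ t ∈ Set.Icc (0 : ℝ) T, ∀ ε > (0 : ℝ), ∃ δ > (0 : ℝ), ∀ s ∈ Set.Icc (0 : ℝ) T,
      |s - t| < δ → (∫ x : ℝ, |u s x - u t x|) < ε) ∧
  (∃ B : ℝ, ∀ t ∈ Set.Icc (0 : ℝ) T, eVariationOn (u t) Set.univ ≤ ENNReal.ofReal B) ∧
  (∀ k : ℝ, ∀ ψ : ℝ → ℝ → ℝ, ContDiff ℝ (⊤ : ℕ∞) (fun q : ℝ × ℝ => ψ q.1 q.2) →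
      HasCompactSupport (fun q : ℝ × ℝ => ψ q.1 q.2) → (∀ x t, 0 ≤ ψ x t) →
      0 ≤ entropyFunctional lam clam T f u₀ u ψ k)

open scoped Topology

/-- A function of total variation at most `B` has increments dominated by those of a monotone
function with values in `[0, B]`. -/
theorem exists_monotone_dominating {w : ℝ → ℝ} {B : ℝ} (hB : 0 ≤ B)
    (h : eVariationOn w univ ≤ ENNReal.ofReal B) :
    ∃ V : ℝ → ℝ, Monotone V ∧ (∀ x, 0 ≤ V x ∧ V x ≤ B) ∧
      ∀ x y, x ≤ y → |w y - w x| ≤ V y - V x := by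
  have hfin : ∀ s : Set ℝ, eVariationOn w s ≠ ∞ := fun s =>
    ne_top_of_le_ne_top ENNReal.ofReal_ne_top ((eVariationOn.mono w (subset_univ s)).trans h)
  have hle : ∀ x y, x ≤ y → |w y - w x| ≤
      (eVariationOn w (Iic y)).toReal - (eVariationOn w (Iic x)).toReal := by
    intro x y hxy
    have h1 := eVariationOn.union w (s := Iic x) (t := Icc x y) isGreatest_Iic (isLeast_Icc hxy)
    rw [Iic_union_Icc_eq_Iic hxy] at h1
    have h2 : edist (w y) (w x) ≤ eVariationOn w (Icc x y) :=
      eVariationOn.edist_le w (right_mem_Icc.2 hxy) (left_mem_Icc.2 hxy)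
    rw [h1, ENNReal.toReal_add (hfin _) (hfin _), add_sub_cancel_left, ← Real.dist_eq,
      dist_edist]
    exact ENNReal.toReal_mono (hfin _) h2
  refine ⟨fun x => (eVariationOn w (Iic x)).toReal, ?_, ?_, hle⟩
  · intro x y hxy
    have := (abs_nonneg _).trans (hle x y hxy)
    simpa using this
  · exact fun x => ⟨ENNReal.toReal_nonneg, ENNReal.toReal_le_of_le_ofReal hB
      ((eVariationOn.mono w (subset_univ _)).trans h)⟩

theorem measurable_of_monotone_dominating {w V : ℝ → ℝ} (hV : Monotone V)
    (h : ∀ x y, x ≤ y → |w y - w x| ≤ V y - V x) : Measurable w := by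
  have h1 : Monotone (fun x => V x + w x) := by
    intro x y hxy
    have := neg_le_of_abs_le (h x y hxy)
    simp only; linarith
  have h2 : w = (fun x => V x + w x) - V := by ext x; simp
  rw [h2]
  exact h1.measurable.sub hV.measurable

/-- Translation estimate for bounded monotone functions. -/
theorem integrable_monotone_translate_sub {V : ℝ → ℝ} {B : ℝ} (hV : Monotone V)
    (hb : ∀ x, 0 ≤ V x ∧ V x ≤ B) {h : ℝ} (hh : 0 ≤ h) :
    Integrable (fun x => V (x + h) - V x) ∧ ∫ x, (V (x + h) - V x) ≤ B * h := by
  have hi : ∀ a b, IntervalIntegrable V volume a b := fun a b => hV.intervalIntegrable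
  have hi' : ∀ a b, IntervalIntegrable (fun x => V (x + h)) volume a b := fun a b =>
    (hV.comp (fun x y hxy => by simpa using hxy : Monotone (fun x : ℝ => x + h))).intervalIntegrable
  have hnn : ∀ x, 0 ≤ V (x + h) - V x := fun x => sub_nonneg.2 (hV (by linarith))
  have key : ∀ n : ℕ, ∫ x in (-(n : ℝ))..n, (V (x + h) - V x) ≤ B * h := by
    intro n
    rw [intervalIntegral.integral_sub (hi' _ _) (hi _ _),
      intervalIntegral.integral_comp_add_right (fun x => V x)]
    rw [intervalIntegral.integral_interval_sub_interval_comm (hi _ _) (hi _ _) (hi _ _)]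
    have e1 : 0 ≤ ∫ x in (-(n : ℝ))..(-n + h), V x :=
      intervalIntegral.integral_nonneg (by linarith) (fun x _ => (hb x).1)
    have e2 : ∫ x in (n : ℝ)..(n + h), V x ≤ ∫ x in (n : ℝ)..(n + h), B :=
      intervalIntegral.integral_mono_on (by linarith) (hi _ _) (by simp) (fun x _ => (hb x).2)
    simp only [intervalIntegral.integral_const, add_sub_cancel_left, smul_eq_mul] at e2
    rw [intervalIntegral.integral_symm (-(n : ℝ)) (-n + h),
      intervalIntegral.integral_symm (n : ℝ) (n + h)]
    linarith
  have hint : Integrable (fun x => V (x + h) - V x) := by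
    refine integrable_of_intervalIntegral_norm_bounded (l := atTop) (a := fun n : ℕ => -(n : ℝ))
      (b := fun n : ℕ => (n : ℝ)) (B * h) (fun i => ?_) ?_ tendsto_natCast_atTop_atTop ?_
    · exact (((hi' _ _).sub (hi (-(i:ℝ)) i)).1)
    · exact tendsto_neg_atTop_atBot.comp tendsto_natCast_atTop_atTop
    · refine Eventually.of_forall fun n => ?_
      simpa only [Real.norm_of_nonneg (hnn _)] using key n
  refine ⟨hint, ?_⟩
  refine _root_.le_of_tendsto (intervalIntegral_tendsto_integral hint
    (tendsto_neg_atTop_atBot.comp tendsto_natCast_atTop_atTop) tendsto_natCast_atTop_atTop)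
    (Eventually.of_forall key)

/-- Translation estimate for functions of bounded variation. -/
theorem integral_abs_translate_sub_le {w : ℝ → ℝ} {B : ℝ} (hB : 0 ≤ B)
    (h : eVariationOn w univ ≤ ENNReal.ofReal B) (z : ℝ) :
    Integrable (fun x => w (x + z) - w x) ∧ ∫ x, |w (x + z) - w x| ≤ B * |z| := by
  obtain ⟨V, hV, hb, hd⟩ := exists_monotone_dominating hB h
  have hw := measurable_of_monotone_dominating hV hd
  have main : ∀ z : ℝ, 0 ≤ z → Integrable (fun x => w (x + z) - w x) ∧
      ∫ x, |w (x + z) - w x| ≤ B * |z| := by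
    intro z hz
    obtain ⟨h1, h2⟩ := integrable_monotone_translate_sub hV hb hz
    have h3 : Integrable (fun x => w (x + z) - w x) :=
      h1.mono' (by fun_prop) (Eventually.of_forall fun x => hd _ _ (by linarith))
    refine ⟨h3, ?_⟩
    rw [abs_of_nonneg hz]
    exact (integral_mono h3.abs h1 fun x => hd _ _ (by linarith)).trans h2
  rcases le_total 0 z with hz | hz
  · exact main z hz
  · obtain ⟨h1, h2⟩ := main (-z) (by linarith)
    have h3 := (h1.comp_add_right z).neg
    have e : (-fun x => w (x + z + -z) - w (x + z)) = fun x => w (x + z) - w x := by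
      ext x; simp
    refine ⟨e ▸ h3, ?_⟩
    rw [← abs_neg z]
    refine le_of_eq_of_le ?_ h2
    rw [← integral_add_right_eq_self (fun x => |w (x + -z) - w x|) z]
    refine integral_congr_ae (Eventually.of_forall fun x => ?_)
    simp [abs_sub_comm]

/-- The integral operator `w ↦ ∫ (w(· + z) - w) dν(z)` of pure jump type. -/
noncomputable def nonlocal (ν : Measure ℝ) (w : ℝ → ℝ) (x : ℝ) : ℝ :=
  ∫ z, (w (x + z) - w x) ∂ν

/-- Bounded integrable functions with an `L¹` translation estimate. -/
structure RegL1 (M N B : ℝ) (w : ℝ → ℝ) : Prop where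
  meas : Measurable w
  bdd : ∀ x, |w x| ≤ M
  int : Integrable w
  norm : ∫ x, |w x| ≤ N
  trans : ∀ z, ∫ x, |w (x + z) - w x| ≤ B * |z|

namespace RegL1

variable {M N B M' N' B' : ℝ} {w w' : ℝ → ℝ}

theorem nonneg_M (h : RegL1 M N B w) : 0 ≤ M := (abs_nonneg _).trans (h.bdd 0)

theorem nonneg_N (h : RegL1 M N B w) : 0 ≤ N :=
  (integral_nonneg fun _ => abs_nonneg _).trans h.norm

theorem nonneg_B (h : RegL1 M N B w) : 0 ≤ B := by
  simpa using (integral_nonneg fun _ => abs_nonneg _).trans (h.trans 1)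

theorem sub (h : RegL1 M N B w) (h' : RegL1 M' N' B' w') :
    RegL1 (M + M') (N + N') (B + B') (fun x => w x - w' x) where
  meas := h.meas.sub h'.meas
  bdd x := (abs_sub _ _).trans (add_le_add (h.bdd x) (h'.bdd x))
  int := h.int.sub h'.int
  norm := by
    refine (integral_mono (h.int.sub h'.int).abs (h.int.abs.add h'.int.abs)
      (fun x => abs_sub _ _)).trans ?_
    simp only [Pi.add_apply]
    rw [integral_add h.int.abs h'.int.abs]
    exact add_le_add h.norm h'.norm
  trans z := by
    have i1 : Integrable (fun x => w (x + z) - w x) := (h.int.comp_add_right z).sub h.int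
    have i2 : Integrable (fun x => w' (x + z) - w' x) := (h'.int.comp_add_right z).sub h'.int
    have : ∀ x, |w (x + z) - w' (x + z) - (w x - w' x)| ≤
        |w (x + z) - w x| + |w' (x + z) - w' x| := fun x => by
      rw [show w (x + z) - w' (x + z) - (w x - w' x) =
        (w (x + z) - w x) - (w' (x + z) - w' x) by ring]
      exact abs_sub _ _
    refine (integral_mono_of_nonneg (Eventually.of_forall fun x => abs_nonneg _)
      (i1.abs.add i2.abs) (Eventually.of_forall this)).trans ?_
    simp only [Pi.add_apply]
    rw [integral_add i1.abs i2.abs]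
    linarith [h.trans z, h'.trans z]

theorem incr_int (h : RegL1 M N B w) (z : ℝ) : Integrable (fun x => w (x + z) - w x) :=
  (h.int.comp_add_right z).sub h.int

theorem incr_le (h : RegL1 M N B w) (z : ℝ) :
    ∫ x, |w (x + z) - w x| ≤ (B + 2 * N) * min 1 |z| := by
  have hB := h.nonneg_B
  have hN := h.nonneg_N
  have h1 : ∫ x, |w (x + z) - w x| ≤ 2 * N := by
    have i1 := h.int.comp_add_right z
    refine (integral_mono (h.incr_int z).abs (i1.abs.add h.int.abs) fun x => abs_sub _ _).trans ?_
    simp only [Pi.add_apply]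
    rw [integral_add i1.abs h.int.abs, integral_add_right_eq_self (fun x => |w x|)]
    linarith [h.norm]
  rcases le_total 1 |z| with hz | hz
  · rw [min_eq_left hz]; linarith
  · rw [min_eq_right hz]
    have := h.trans z
    nlinarith [abs_nonneg z]

variable {ν : Measure ℝ} [SFinite ν]

theorem incr_int_prod (h : RegL1 M N B w) (hν : Integrable (fun z : ℝ => min 1 |z|) ν)
    {s : ℝ → ℝ} {C : ℝ} (hs : Measurable s) (hC : ∀ x, |s x| ≤ C) :
    Integrable (fun p : ℝ × ℝ => s p.1 * (w (p.1 + p.2) - w p.1)) (volume.prod ν) := by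
  have hw := h.meas
  have hm : Measurable (fun p : ℝ × ℝ => s p.1 * (w (p.1 + p.2) - w p.1)) := by fun_prop
  rw [integrable_prod_iff' hm.aestronglyMeasurable]
  have hi : ∀ z, Integrable (fun x => s x * (w (x + z) - w x)) := fun z =>
    (h.incr_int z).bdd_mul hs.aestronglyMeasurable (Eventually.of_forall hC)
  refine ⟨Eventually.of_forall hi, ?_⟩
  have hC0 : 0 ≤ C := (abs_nonneg _).trans (hC 0)
  refine (hν.const_mul (C * (B + 2 * N))).mono' ?_ (Eventually.of_forall fun z => ?_)
  · exact (hm.norm.stronglyMeasurable.integral_prod_left' (μ := volume)).aestronglyMeasurable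
  · rw [Real.norm_of_nonneg (integral_nonneg fun _ => norm_nonneg _), mul_assoc]
    refine (integral_mono (hi z).norm ((h.incr_int z).abs.const_mul C) fun x => ?_).trans ?_
    · simp only [norm_mul, Real.norm_eq_abs]
      exact mul_le_mul_of_nonneg_right (hC x) (abs_nonneg _)
    · rw [integral_const_mul]
      exact mul_le_mul_of_nonneg_left (h.incr_le z) hC0

theorem incr_int_ae (h : RegL1 M N B w) (hν : Integrable (fun z : ℝ => min 1 |z|) ν) :
    ∀ᵐ x, Integrable (fun z => w (x + z) - w x) ν := by
  have := (h.incr_int_prod hν (s := fun _ => 1) (C := 1) measurable_const (by simp)).prod_right_ae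
  simpa using this

end RegL1

section
variable {M N B : ℝ} {w : ℝ → ℝ} {ν : Measure ℝ} [SFinite ν]

theorem measurable_nonlocal (hw : Measurable w) : Measurable (nonlocal ν w) := by
  have hm : Measurable (fun p : ℝ × ℝ => w (p.1 + p.2) - w p.1) := by fun_prop
  exact (hm.stronglyMeasurable.integral_prod_right' (ν := ν)).measurable

theorem RegL1.mul_nonlocal (h : RegL1 M N B w) (hν : Integrable (fun z : ℝ => min 1 |z|) ν)
    {s : ℝ → ℝ} {C : ℝ} (hs : Measurable s) (hC : ∀ x, |s x| ≤ C) :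
    Integrable (fun x => s x * nonlocal ν w x) ∧
    ∫ x, |s x * nonlocal ν w x| ≤ ∫ z, (∫ x, |s x| * |w (x + z) - w x|) ∂ν := by
  have hp := h.incr_int_prod hν hs hC
  have e : ∀ x, ∫ z, s x * (w (x + z) - w x) ∂ν = s x * nonlocal ν w x := fun x =>
    integral_const_mul _ _
  have h1 : Integrable (fun x => s x * nonlocal ν w x) := by
    have := hp.integral_prod_left
    simpa only [e] using this
  refine ⟨h1, ?_⟩
  have h2 : ∀ x, |s x * nonlocal ν w x| ≤ ∫ z, |s x| * |w (x + z) - w x| ∂ν := fun x => by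
    rw [← e x]
    simpa [abs_mul]
      using abs_integral_le_integral_abs (f := fun z => s x * (w (x + z) - w x)) (μ := ν)
  have h3 : Integrable (fun p : ℝ × ℝ => |s p.1| * |w (p.1 + p.2) - w p.1|) (volume.prod ν) := by
    simpa [abs_mul] using hp.abs
  refine (integral_mono h1.abs h3.integral_prod_left h2).trans_eq ?_
  exact integral_integral_swap h3

theorem RegL1.nonlocal_int (h : RegL1 M N B w) (hν : Integrable (fun z : ℝ => min 1 |z|) ν) :
    Integrable (nonlocal ν w) := by
  simpa using (h.mul_nonlocal hν (s := fun _ => 1) (C := 1) measurable_const (by simp)).1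

theorem RegL1.nonlocal_norm (h : RegL1 M N B w) (hν : Integrable (fun z : ℝ => min 1 |z|) ν) :
    ∫ x, |nonlocal ν w x| ≤ (B + 2 * N) * ∫ z, min 1 |z| ∂ν := by
  have := (h.mul_nonlocal hν (s := fun _ => 1) (C := 1) measurable_const (by simp)).2
  simp only [one_mul, abs_one] at this
  refine this.trans ?_
  rw [← integral_const_mul]
  have h3 := (h.incr_int_prod hν (s := fun _ => 1) (C := 1) measurable_const
    (by simp)).abs.integral_prod_right
  simp only [one_mul] at h3
  exact integral_mono h3 (hν.const_mul _) h.incr_le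

theorem RegL1.nonlocal_sub {M' N' B' : ℝ} {w' : ℝ → ℝ} (h : RegL1 M N B w)
    (h' : RegL1 M' N' B' w') (hν : Integrable (fun z : ℝ => min 1 |z|) ν) :
    ∀ᵐ x, nonlocal ν (fun x => w x - w' x) x = nonlocal ν w x - nonlocal ν w' x := by
  filter_upwards [h.incr_int_ae hν, h'.incr_int_ae hν] with x hx hx'
  simp only [nonlocal]
  rw [← integral_sub hx hx']
  congr 1; ext z; ring

theorem RegL1.nonlocal_split (h : RegL1 M N B w) (hν : Integrable (fun z : ℝ => min 1 |z|) ν)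
    {A : Set ℝ} (hA : MeasurableSet A) :
    ∀ᵐ x, nonlocal ν w x = nonlocal (ν.restrict A) w x + nonlocal (ν.restrict Aᶜ) w x := by
  filter_upwards [h.incr_int_ae hν] with x hx
  exact (integral_add_compl hA hx).symm

end

section
variable {ν : Measure ℝ}

theorem measurableSet_jump (r : ℝ) : MeasurableSet {z : ℝ | r < |z|} :=
  measurableSet_lt measurable_const measurable_norm

theorem measure_jump_lt_top (hν : Integrable (fun z : ℝ => min 1 |z|) ν) {r : ℝ} (hr : 0 < r) :
    ν {z : ℝ | r < |z|} < ∞ := by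
  refine lt_of_le_of_lt (measure_mono fun z hz => ?_)
    (hν.measure_norm_ge_lt_top (ε := min 1 r) (lt_min one_pos hr))
  simp only [mem_ofPred_eq] at hz ⊢
  rw [Real.norm_of_nonneg (le_min zero_le_one (abs_nonneg _))]
  exact min_le_min_left _ hz.le

theorem tendsto_small_jumps (hν : Integrable (fun z : ℝ => min 1 |z|) ν) :
    Tendsto (fun r : ℝ => ∫ z, {z : ℝ | |z| ≤ r}.indicator (fun z => min 1 |z|) z ∂ν) (𝓝[>] 0)
      (𝓝 0) := by
  have h0 : (0 : ℝ) = ∫ z : ℝ, (0 : ℝ) ∂ν := by simp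
  conv => rhs; rw [h0]
  refine tendsto_integral_filter_of_dominated_convergence (fun z => min 1 |z|)
    (Eventually.of_forall fun r => ?_) (Eventually.of_forall fun r =>
      Eventually.of_forall fun z => ?_) hν (Eventually.of_forall fun z => ?_)
  · exact hν.1.indicator (measurableSet_le measurable_norm measurable_const)
  · refine (norm_indicator_le_norm_self _ _).trans ?_
    rw [Real.norm_of_nonneg (le_min zero_le_one (abs_nonneg _))]
  · rcases eq_or_ne z 0 with rfl | hz
    · simp [indicator]
    · refine tendsto_const_nhds.congr' ?_
      have : ∀ᶠ r : ℝ in 𝓝[>] 0, r < |z| :=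
        nhdsWithin_le_nhds (eventually_lt_nhds (abs_pos.2 hz))
      filter_upwards [this] with r hr
      rw [indicator_of_notMem]; simpa using hr

theorem exists_small_jumps (hν : Integrable (fun z : ℝ => min 1 |z|) ν) {ε : ℝ} (hε : 0 < ε) :
    ∃ r > 0, ∫ z, {z : ℝ | |z| ≤ r}.indicator (fun z => min 1 |z|) z ∂ν < ε :=
  (((tendsto_small_jumps hν).eventually (gt_mem_nhds hε)).and self_mem_nhdsWithin).exists.imp
    fun _ h => ⟨h.2, h.1⟩

theorem exists_large_jumps (hν : Integrable (fun z : ℝ => min 1 |z|) ν) {ε : ℝ} (hε : 0 < ε) :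
    ∃ Z > 0, ν.real {z : ℝ | Z < |z|} < ε := by
  have h := tendsto_measure_iInter_atTop (μ := ν) (s := fun n : ℕ => {z : ℝ | (n : ℝ) + 1 < |z|})
    (fun n => (measurableSet_jump _).nullMeasurableSet)
    (fun m n hmn z hz => by
      simp only [mem_ofPred_eq] at hz ⊢
      have : (m : ℝ) ≤ n := by exact_mod_cast hmn
      linarith)
    ⟨0, (measure_jump_lt_top hν (by positivity)).ne⟩
  have he : (⋂ n : ℕ, {z : ℝ | (n : ℝ) + 1 < |z|}) = ∅ := by
    ext z
    simp only [mem_iInter, mem_ofPred_eq, mem_empty_iff_false, iff_false, not_forall, not_lt]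
    obtain ⟨n, hn⟩ := exists_nat_ge |z|
    exact ⟨n, by linarith⟩
  rw [he, measure_empty] at h
  obtain ⟨n, hn⟩ := (h.eventually (gt_mem_nhds (ENNReal.ofReal_pos.2 hε))).exists
  refine ⟨n + 1, by positivity, ?_⟩
  exact (ENNReal.lt_ofReal_iff_toReal_lt (measure_jump_lt_top hν (by positivity)).ne).1 hn

end

section
variable {M N B : ℝ} {ν : Measure ℝ} [SFinite ν]

/-- Local `L¹` modulus of continuity of the nonlocal operator on bounded sets of `RegL1`. -/
theorem exists_nonlocal_modulus (hν : Integrable (fun z : ℝ => min 1 |z|) ν) (M N B R : ℝ)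
    {ε : ℝ} (hε : 0 < ε) : ∃ K ≥ 0, ∃ R', ∀ d, RegL1 M N B d →
      ∫ x in Icc (-R) R, |nonlocal ν d x| ≤ ε + K * ∫ x in Icc (-R') R', |d x| := by
  by_cases hne : ∃ d, RegL1 M N B d
  swap
  · exact ⟨0, le_rfl, 0, fun d hd => (hne ⟨d, hd⟩).elim⟩
  obtain ⟨d₀, hd₀⟩ := hne
  have hM := hd₀.nonneg_M
  have hN := hd₀.nonneg_N
  have hB := hd₀.nonneg_B
  set C := B + 2 * N with hC
  have hC0 : 0 ≤ C := by positivity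
  obtain ⟨r, hr, hr'⟩ := exists_small_jumps hν (show 0 < ε / 2 / (C + 1) by positivity)
  obtain ⟨Z, hZ, hZ'⟩ := exists_large_jumps hν (show 0 < ε / 2 / (4 * M * |R| + 1) by positivity)
  have hfr := (measure_jump_lt_top hν hr).ne
  have hfZ := (measure_jump_lt_top hν hZ).ne
  have hmr : MeasurableSet {z : ℝ | |z| ≤ r} := measurableSet_le measurable_norm measurable_const
  refine ⟨2 * ν.real {z : ℝ | r < |z|}, by positivity, |R| + Z, fun d hd => ?_⟩
  set s : ℝ → ℝ := (Icc (-R) R).indicator 1 with hs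
  have hsm : Measurable s := measurable_one.indicator measurableSet_Icc
  have hs0 : ∀ x, 0 ≤ s x := fun x => indicator_nonneg (fun _ _ => zero_le_one) x
  have hs1 : ∀ x, s x ≤ 1 := fun x => indicator_le_self' (fun _ _ => zero_le_one) x
  have hsa : ∀ x, |s x| ≤ 1 := fun x => by rw [abs_of_nonneg (hs0 x)]; exact hs1 x
  have hset : ∀ g : ℝ → ℝ, ∫ x, |s x| * g x = ∫ x in Icc (-R) R, g x := fun g => by
    rw [← integral_indicator measurableSet_Icc]
    congr 1; ext x
    by_cases hx : x ∈ Icc (-R) R <;> simp [hs, hx]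
  obtain ⟨-, h2⟩ := hd.mul_nonlocal hν hsm hsa
  simp only [abs_mul, hset] at h2
  refine h2.trans ?_
  set I := ∫ x in Icc (-(|R| + Z)) (|R| + Z), |d x| with hI
  have hI0 : 0 ≤ I := integral_nonneg fun _ => abs_nonneg _
  have ib1 : Integrable (fun z => C * {z : ℝ | |z| ≤ r}.indicator (fun z => min 1 |z|) z) ν :=
    (hν.indicator hmr).const_mul _
  have ib2 : Integrable (fun z => {z : ℝ | r < |z|}.indicator (fun _ => 2 * I) z) ν :=
    (integrable_indicator_iff (measurableSet_jump r)).2 (integrableOn_const hfr)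
  have ib3 : Integrable (fun z => {z : ℝ | Z < |z|}.indicator (fun _ => 4 * M * |R|) z) ν :=
    (integrable_indicator_iff (measurableSet_jump Z)).2 (integrableOn_const hfZ)
  have hbound : ∀ z, ∫ x in Icc (-R) R, |d (x + z) - d x| ≤
      C * {z : ℝ | |z| ≤ r}.indicator (fun z => min 1 |z|) z
      + {z : ℝ | r < |z|}.indicator (fun _ => 2 * I) z
      + {z : ℝ | Z < |z|}.indicator (fun _ => 4 * M * |R|) z := by
    intro z
    have p1 : 0 ≤ C * {z : ℝ | |z| ≤ r}.indicator (fun z => min 1 |z|) z :=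
      mul_nonneg hC0 (indicator_nonneg (fun _ _ => le_min zero_le_one (abs_nonneg _)) _)
    have p2 : 0 ≤ {z : ℝ | r < |z|}.indicator (fun _ => 2 * I) z :=
      indicator_nonneg (fun _ _ => by positivity) _
    have p3 : 0 ≤ {z : ℝ | Z < |z|}.indicator (fun _ => 4 * M * |R|) z :=
      indicator_nonneg (fun _ _ => by positivity) _
    rcases le_or_gt |z| r with hz | hz
    · have : ∫ x in Icc (-R) R, |d (x + z) - d x| ≤ C * min 1 |z| :=
        (setIntegral_le_integral (hd.incr_int z).abs
          (Eventually.of_forall fun _ => abs_nonneg _)).trans (hd.incr_le z)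
      rw [indicator_of_mem (show z ∈ {z : ℝ | |z| ≤ r} from hz)]
      linarith
    rcases le_or_gt |z| Z with hz' | hz'
    · have i1 : IntegrableOn (fun x => |d (x + z)|) (Icc (-R) R) :=
        (hd.int.comp_add_right z).abs.integrableOn
      have i2 : IntegrableOn (fun x => |d x|) (Icc (-R) R) := hd.int.abs.integrableOn
      have j1 : ∫ x in Icc (-R) R, |d x| ≤ I :=
        setIntegral_mono_set hd.int.abs.integrableOn (Eventually.of_forall fun _ => abs_nonneg _)
          (LE.le.eventuallyLE fun x hx => by
            have := le_abs_self R
            exact ⟨by linarith [hx.1], by linarith [hx.2]⟩)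
      have j2 : ∫ x in Icc (-R) R, |d (x + z)| ≤ I := by
        rw [hI, ← integral_indicator measurableSet_Icc, ← integral_indicator measurableSet_Icc,
          ← integral_add_right_eq_self (fun x => (Icc (-(|R| + Z)) (|R| + Z)).indicator
            (fun x => |d x|) x) z]
        refine integral_mono ((integrable_indicator_iff measurableSet_Icc).2 i1)
          ((hd.int.abs.indicator measurableSet_Icc).comp_add_right z) fun x => ?_
        by_cases hx : x ∈ Icc (-R) R
        · have hx' : x + z ∈ Icc (-(|R| + Z)) (|R| + Z) := by
            have := le_abs_self R
            have := abs_le.1 hz'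
            exact ⟨by linarith [hx.1], by linarith [hx.2]⟩
          rw [indicator_of_mem hx]
          show _ ≤ (Icc (-(|R| + Z)) (|R| + Z)).indicator (fun x => |d x|) (x + z)
          rw [indicator_of_mem hx']
        · simp only [indicator_of_notMem hx]
          exact indicator_nonneg (fun _ _ => abs_nonneg _) _
      have : ∫ x in Icc (-R) R, |d (x + z) - d x| ≤ I + I := by
        refine (integral_mono (hd.incr_int z).abs.integrableOn (i1.add i2)
          fun x => abs_sub _ _).trans ?_
        simp only [Pi.add_apply]
        rw [integral_add i1 i2]
        exact add_le_add j2 j1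
      rw [indicator_of_mem (show z ∈ {z : ℝ | r < |z|} from hz)]
      linarith
    · have : ∫ x in Icc (-R) R, |d (x + z) - d x| ≤ 4 * M * |R| := by
        have := norm_setIntegral_le_of_norm_le_const (μ := volume) (s := Icc (-R) R)
          (f := fun x => |d (x + z) - d x|) (C := 2 * M) (by simp) (fun x _ => by
            have h1 := abs_le.1 (hd.bdd x)
            have h2 := abs_le.1 (hd.bdd (x + z))
            rw [Real.norm_eq_abs, abs_abs, abs_le]; constructor <;> linarith)
        refine (le_abs_self _).trans (this.trans ?_)
        rw [Real.volume_real_Icc]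
        have : max (R - -R) 0 ≤ 2 * |R| :=
          max_le (by linarith [le_abs_self R]) (by positivity)
        nlinarith
      rw [indicator_of_mem (show z ∈ {z : ℝ | Z < |z|} from hz')]
      linarith
  have hint : Integrable (fun z => ∫ x in Icc (-R) R, |d (x + z) - d x|) ν := by
    have := (hd.incr_int_prod hν hsm hsa).abs.integral_prod_right
    simpa only [abs_mul, hset] using this
  refine (integral_mono hint ((ib1.add ib2).add ib3) hbound).trans ?_
  simp only [Pi.add_apply]
  rw [integral_add (f := fun z => C * {z : ℝ | |z| ≤ r}.indicator (fun z => min 1 |z|) z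
      + {z : ℝ | r < |z|}.indicator (fun _ => 2 * I) z) (ib1.add ib2) ib3,
    integral_add ib1 ib2, integral_const_mul, integral_indicator (measurableSet_jump r),
    integral_indicator (measurableSet_jump Z)]
  simp only [setIntegral_const, smul_eq_mul]
  have e1 : C * ∫ z, {z : ℝ | |z| ≤ r}.indicator (fun z => min 1 |z|) z ∂ν ≤ ε / 2 := by
    have : C * (ε / 2 / (C + 1)) ≤ ε / 2 := by
      rw [mul_div_assoc', div_le_iff₀ (by positivity)]; nlinarith
    exact (mul_le_mul_of_nonneg_left hr'.le hC0).trans this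
  have e2 : ν.real {z : ℝ | Z < |z|} * (4 * M * |R|) ≤ ε / 2 := by
    have h0 : 0 ≤ 4 * M * |R| := by positivity
    have : (ε / 2 / (4 * M * |R| + 1)) * (4 * M * |R|) ≤ ε / 2 := by
      rw [div_mul_eq_mul_div, div_le_iff₀ (by positivity)]; nlinarith
    exact (mul_le_mul_of_nonneg_right hZ'.le h0).trans this
  linarith

/-- Uniform integrability of the nonlocal operator on bounded sets of `RegL1`. -/
theorem exists_mul_nonlocal_modulus (hν : Integrable (fun z : ℝ => min 1 |z|) ν) (M N B : ℝ)
    {C₀ : ℝ} (hC₀ : 0 ≤ C₀) {ε : ℝ} (hε : 0 < ε) :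
    ∃ K ≥ 0, ∀ w, RegL1 M N B w → ∀ s : ℝ → ℝ, Measurable s → (∀ x, |s x| ≤ C₀) → Integrable s →
      ∫ x, |s x * nonlocal ν w x| ≤ ε + K * ∫ x, |s x| := by
  by_cases hne : ∃ d, RegL1 M N B d
  swap
  · exact ⟨0, le_rfl, fun d hd => (hne ⟨d, hd⟩).elim⟩
  obtain ⟨d₀, hd₀⟩ := hne
  have hM := hd₀.nonneg_M
  have hN := hd₀.nonneg_N
  have hB := hd₀.nonneg_B
  set C := C₀ * (B + 2 * N) with hC
  have hC0 : 0 ≤ C := by positivity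
  obtain ⟨r, hr, hr'⟩ := exists_small_jumps hν (show 0 < ε / (C + 1) by positivity)
  have hfr := (measure_jump_lt_top hν hr).ne
  have hmr : MeasurableSet {z : ℝ | |z| ≤ r} := measurableSet_le measurable_norm measurable_const
  refine ⟨2 * M * ν.real {z : ℝ | r < |z|}, by positivity, fun w hw s hsm hsC hsi => ?_⟩
  obtain ⟨-, h2⟩ := hw.mul_nonlocal hν hsm hsC
  refine h2.trans ?_
  set I := ∫ x, |s x| with hI
  have hI0 : 0 ≤ I := integral_nonneg fun _ => abs_nonneg _
  have ib1 : Integrable (fun z => C * {z : ℝ | |z| ≤ r}.indicator (fun z => min 1 |z|) z) ν :=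
    (hν.indicator hmr).const_mul _
  have ib2 : Integrable (fun z => {z : ℝ | r < |z|}.indicator (fun _ => 2 * M * I) z) ν :=
    (integrable_indicator_iff (measurableSet_jump r)).2 (integrableOn_const hfr)
  have hbound : ∀ z, ∫ x, |s x| * |w (x + z) - w x| ≤
      C * {z : ℝ | |z| ≤ r}.indicator (fun z => min 1 |z|) z
      + {z : ℝ | r < |z|}.indicator (fun _ => 2 * M * I) z := by
    intro z
    have p1 : 0 ≤ C * {z : ℝ | |z| ≤ r}.indicator (fun z => min 1 |z|) z :=
      mul_nonneg hC0 (indicator_nonneg (fun _ _ => le_min zero_le_one (abs_nonneg _)) _)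
    have p2 : 0 ≤ {z : ℝ | r < |z|}.indicator (fun _ => 2 * M * I) z :=
      indicator_nonneg (fun _ _ => by positivity) _
    rcases le_or_gt |z| r with hz | hz
    · have : ∫ x, |s x| * |w (x + z) - w x| ≤ C * min 1 |z| := by
        refine (integral_mono_of_nonneg (Eventually.of_forall fun x => by positivity)
          ((hw.incr_int z).abs.const_mul C₀) (Eventually.of_forall fun x =>
            mul_le_mul_of_nonneg_right (hsC x) (abs_nonneg _))).trans ?_
        rw [integral_const_mul, hC, mul_assoc]
        exact mul_le_mul_of_nonneg_left (hw.incr_le z) hC₀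
      rw [indicator_of_mem (show z ∈ {z : ℝ | |z| ≤ r} from hz)]
      linarith
    · have : ∫ x, |s x| * |w (x + z) - w x| ≤ 2 * M * I := by
        rw [hI, ← integral_const_mul]
        refine integral_mono_of_nonneg (Eventually.of_forall fun x => by positivity)
          (hsi.abs.const_mul _) (Eventually.of_forall fun x => ?_)
        have h1 := abs_le.1 (hw.bdd x)
        have h2 := abs_le.1 (hw.bdd (x + z))
        simp only
        rw [mul_comm]
        exact mul_le_mul_of_nonneg_right (abs_le.2 ⟨by linarith, by linarith⟩) (abs_nonneg _)
      rw [indicator_of_mem (show z ∈ {z : ℝ | r < |z|} from hz)]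
      linarith
  have hint : Integrable (fun z => ∫ x, |s x| * |w (x + z) - w x|) ν := by
    have := (hw.incr_int_prod hν hsm hsC).abs.integral_prod_right
    simpa only [abs_mul] using this
  refine (integral_mono hint (ib1.add ib2) hbound).trans ?_
  simp only [Pi.add_apply]
  rw [integral_add ib1 ib2, integral_const_mul, integral_indicator (measurableSet_jump r)]
  simp only [setIntegral_const, smul_eq_mul]
  have e1 : C * ∫ z, {z : ℝ | |z| ≤ r}.indicator (fun z => min 1 |z|) z ∂ν ≤ ε := by
    have : C * (ε / (C + 1)) ≤ ε := by
      rw [mul_div_assoc', div_le_iff₀ (by positivity)]; nlinarith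
    exact (mul_le_mul_of_nonneg_left hr'.le hC0).trans this
  linarith

end

theorem monotone_sign : Monotone Real.sign := by
  intro a b hab
  rcases lt_trichotomy a 0 with ha | ha | ha <;> rcases lt_trichotomy b 0 with hb | hb | hb <;>
    simp [Real.sign_of_neg, Real.sign_of_pos, *] <;> linarith

theorem abs_sign_le_one (r : ℝ) : |Real.sign r| ≤ 1 := by
  rcases Real.sign_apply_eq r with h | h | h <;> simp [h]

theorem real_sign_mul_self (r : ℝ) : Real.sign r * r = |r| := by
  rcases lt_trichotomy r 0 with h | h | h
  · rw [Real.sign_of_neg h, abs_of_neg h]; ring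
  · simp [h]
  · rw [Real.sign_of_pos h, abs_of_pos h]; ring

theorem abs_add_sign_mul_le (a b : ℝ) : |a| + Real.sign a * (b - a) ≤ |b| := by
  have h1 := real_sign_mul_self a
  have h2 : Real.sign a * b ≤ |b| := by
    refine (le_abs_self _).trans ?_
    rw [abs_mul]
    exact mul_le_of_le_one_left (abs_nonneg _) (abs_sign_le_one a)
  linarith [mul_sub (Real.sign a) b a]

/-- The Kruzkov entropy flux attached to the entropy `|· - k|`. -/
noncomputable def kruzFlux (f : ℝ → ℝ) (k r : ℝ) : ℝ := Real.sign (r - k) * (f r - f k)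

theorem kruzFlux_comm (f : ℝ → ℝ) (k r : ℝ) : kruzFlux f k r = kruzFlux f r k := by
  rw [kruzFlux, kruzFlux, ← neg_sub r k, Real.sign_neg]; ring

section
variable {f : ℝ → ℝ} {L : ℝ} (hf : ∀ a b, |f a - f b| ≤ L * |a - b|)
include hf

theorem abs_kruzFlux_sub_le (k a b : ℝ) :
    |kruzFlux f k a - kruzFlux f k b| ≤ L * |a - b| := by
  have h1 := abs_le.1 (hf a b)
  have h2 := abs_le.1 (hf a k)
  have h3 := abs_le.1 (hf b k)
  unfold kruzFlux
  rw [abs_le]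
  rcases lt_trichotomy a k with ha | ha | ha <;> rcases lt_trichotomy b k with hb | hb | hb
  · rw [Real.sign_of_neg (sub_neg.2 ha), Real.sign_of_neg (sub_neg.2 hb)]
    constructor <;> linarith
  · subst hb; rw [Real.sign_of_neg (sub_neg.2 ha)]; simp; constructor <;> linarith
  · rw [Real.sign_of_neg (sub_neg.2 ha), Real.sign_of_pos (sub_pos.2 hb)]
    rw [abs_of_neg (by linarith)] at h1 h2 ⊢
    rw [abs_of_pos (by linarith)] at h3
    constructor <;> linarith
  · subst ha; rw [Real.sign_of_neg (sub_neg.2 hb)]; simp; constructor <;> linarith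
  · subst ha; subst hb; simp
  · subst ha; rw [Real.sign_of_pos (sub_pos.2 hb)]; simp; constructor <;> linarith
  · rw [Real.sign_of_pos (sub_pos.2 ha), Real.sign_of_neg (sub_neg.2 hb)]
    rw [abs_of_pos (by linarith)] at h1 h2 ⊢
    rw [abs_of_neg (by linarith)] at h3
    constructor <;> linarith
  · subst hb; rw [Real.sign_of_pos (sub_pos.2 ha)]; simp; constructor <;> linarith
  · rw [Real.sign_of_pos (sub_pos.2 ha), Real.sign_of_pos (sub_pos.2 hb)]
    constructor <;> linarith

theorem abs_kruzFlux_sub_le' (k l r : ℝ) :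
    |kruzFlux f k r - kruzFlux f l r| ≤ L * |k - l| := by
  rw [kruzFlux_comm, kruzFlux_comm f l]
  exact abs_kruzFlux_sub_le hf r k l

/-- Discrete entropy inequality of the Lax-Friedrichs averaging for the Kruzkov entropies. -/
theorem abs_laxFriedrichs_sub_le {σ : ℝ} (hσ : 0 ≤ σ) (hσL : σ * L ≤ 1) (k p m : ℝ) :
    |(p - σ * f p + (m + σ * f m)) / 2 - k| ≤
      (|p - k| + |m - k|) / 2 - σ / 2 * (kruzFlux f k p - kruzFlux f k m) := by
  have key : ∀ r, |σ * (f r - f k)| ≤ |r - k| := fun r => by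
    rw [abs_mul, abs_of_nonneg hσ]
    calc σ * |f r - f k| ≤ σ * (L * |r - k|) := by gcongr; exact hf _ _
      _ = σ * L * |r - k| := by ring
      _ ≤ 1 * |r - k| := by gcongr
      _ = _ := one_mul _
  have hp : |(p - k) - σ * (f p - f k)| ≤ |p - k| - σ * kruzFlux f k p := by
    have := abs_le.1 (key p)
    unfold kruzFlux
    rcases lt_trichotomy p k with h | h | h
    · rw [Real.sign_of_neg (sub_neg.2 h)]
      rw [abs_of_neg (by linarith : p - k < 0)] at *
      rw [abs_le]; constructor <;> linarith
    · subst h; simp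
    · rw [Real.sign_of_pos (sub_pos.2 h)]
      rw [abs_of_pos (by linarith : 0 < p - k)] at *
      rw [abs_le]; constructor <;> linarith
  have hm : |(m - k) + σ * (f m - f k)| ≤ |m - k| + σ * kruzFlux f k m := by
    have := abs_le.1 (key m)
    unfold kruzFlux
    rcases lt_trichotomy m k with h | h | h
    · rw [Real.sign_of_neg (sub_neg.2 h)]
      rw [abs_of_neg (by linarith : m - k < 0)] at *
      rw [abs_le]; constructor <;> linarith
    · subst h; simp
    · rw [Real.sign_of_pos (sub_pos.2 h)]
      rw [abs_of_pos (by linarith : 0 < m - k)] at *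
      rw [abs_le]; constructor <;> linarith
  have : (p - σ * f p + (m + σ * f m)) / 2 - k =
      (((p - k) - σ * (f p - f k)) + ((m - k) + σ * (f m - f k))) / 2 := by ring
  rw [this, abs_div, abs_two]
  have := abs_add_le ((p - k) - σ * (f p - f k)) ((m - k) + σ * (f m - f k))
  linarith

theorem continuous_of_abs_sub_le : Continuous f := by
  have : LipschitzWith (Real.toNNReal L) f := LipschitzWith.of_dist_le_mul fun a b => by
    rw [Real.dist_eq, Real.dist_eq]
    exact (hf a b).trans (by gcongr; exact Real.le_coe_toNNReal L)
  exact this.continuous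

end

/-- The mean value of `g` over `[-δ, δ]`. -/
noncomputable def avg (δ : ℝ) (g : ℝ → ℝ) : ℝ := (2 * δ)⁻¹ * ∫ κ in (-δ)..δ, g κ

section
variable {δ : ℝ} {g h : ℝ → ℝ}

theorem avg_mono (hδ : 0 < δ) (hg : IntervalIntegrable g volume (-δ) δ)
    (hh : IntervalIntegrable h volume (-δ) δ) (H : ∀ x, g x ≤ h x) : avg δ g ≤ avg δ h :=
  mul_le_mul_of_nonneg_left (intervalIntegral.integral_mono (by linarith) hg hh H) (by positivity)

theorem avg_const (hδ : 0 < δ) (c : ℝ) : avg δ (fun _ => c) = c := by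
  unfold avg; rw [intervalIntegral.integral_const, smul_eq_mul]; field_simp; ring

theorem avg_add (hg : IntervalIntegrable g volume (-δ) δ)
    (hh : IntervalIntegrable h volume (-δ) δ) :
    avg δ (fun κ => g κ + h κ) = avg δ g + avg δ h := by
  unfold avg; rw [intervalIntegral.integral_add hg hh]; ring

theorem avg_sub (hg : IntervalIntegrable g volume (-δ) δ)
    (hh : IntervalIntegrable h volume (-δ) δ) :
    avg δ (fun κ => g κ - h κ) = avg δ g - avg δ h := by
  unfold avg; rw [intervalIntegral.integral_sub hg hh]; ring

theorem avg_const_mul (c : ℝ) : avg δ (fun κ => c * g κ) = c * avg δ g := by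
  unfold avg; rw [intervalIntegral.integral_const_mul]; ring

theorem avg_comp_neg : avg δ (fun κ => g (-κ)) = avg δ g := by
  unfold avg; rw [intervalIntegral.integral_comp_neg (fun x => g x), neg_neg]

theorem abs_avg_sub_le (hδ : 0 < δ) (hg : IntervalIntegrable g volume (-δ) δ)
    (hh : IntervalIntegrable h volume (-δ) δ) {C : ℝ} (H : ∀ x ∈ Icc (-δ) δ, |g x - h x| ≤ C) :
    |avg δ g - avg δ h| ≤ C := by
  rw [← avg_sub hg hh, avg, abs_mul, abs_of_pos (by positivity : 0 < (2 * δ)⁻¹)]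
  have := intervalIntegral.norm_integral_le_of_norm_le_const (a := -δ) (b := δ)
    (f := fun κ => g κ - h κ) (C := C) fun x hx => by
      rw [uIoc_of_le (by linarith)] at hx
      exact H x ⟨hx.1.le, hx.2⟩
  rw [Real.norm_eq_abs, abs_of_nonneg (by linarith : 0 ≤ δ - -δ)] at this
  rw [inv_mul_le_iff₀ (by positivity)]
  linarith

end

/-- The smoothed modulus. -/
noncomputable def ent (δ r : ℝ) : ℝ := avg δ fun κ => |r - κ|

/-- The derivative of the smoothed modulus. -/
noncomputable def sgnAvg (δ r : ℝ) : ℝ := avg δ fun κ => Real.sign (r - κ)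

/-- The entropy flux associated with the smoothed modulus. -/
noncomputable def fluxAvg (f : ℝ → ℝ) (δ k r : ℝ) : ℝ := avg δ fun κ => kruzFlux f (k + κ) r

theorem intervalIntegrable_abs_sub (r a b : ℝ) :
    IntervalIntegrable (fun κ => |r - κ|) volume a b :=
  Continuous.intervalIntegrable (by fun_prop) _ _

theorem intervalIntegrable_sign_sub (r a b : ℝ) :
    IntervalIntegrable (fun κ => Real.sign (r - κ)) volume a b :=
  Antitone.intervalIntegrable fun _ _ h => monotone_sign (by linarith)

section
variable {δ : ℝ} (hδ : 0 < δ)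
include hδ

theorem abs_ent_sub_le (a b : ℝ) : |ent δ a - ent δ b| ≤ |a - b| :=
  abs_avg_sub_le hδ (intervalIntegrable_abs_sub a _ _) (intervalIntegrable_abs_sub b _ _)
    fun x _ => by
      refine (abs_abs_sub_abs_le _ _).trans_eq ?_
      congr 1; ring

theorem abs_ent_sub_abs_le (a : ℝ) : |ent δ a - (|a|)| ≤ δ := by
  rw [← avg_const hδ |a|]
  refine abs_avg_sub_le hδ (intervalIntegrable_abs_sub a _ _) intervalIntegrable_const
    fun x hx => ?_
  refine (abs_abs_sub_abs_le _ _).trans ?_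
  rw [show a - x - a = -x by ring, abs_neg]
  exact abs_le.2 hx

omit hδ in
theorem ent_neg (a : ℝ) : ent δ (-a) = ent δ a := by
  unfold ent
  rw [← avg_comp_neg]
  congr 1; ext κ
  rw [← abs_neg]; congr 1; ring

omit hδ in
theorem sgnAvg_neg (a : ℝ) : sgnAvg δ (-a) = -sgnAvg δ a := by
  unfold sgnAvg
  rw [← avg_comp_neg, ← neg_one_mul (avg _ _), ← avg_const_mul]
  congr 1; ext κ
  rw [show -a - -κ = -(a - κ) by ring, Real.sign_neg, neg_one_mul]

theorem abs_sgnAvg_le_one (a : ℝ) : |sgnAvg δ a| ≤ 1 := by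
  have := abs_avg_sub_le hδ (intervalIntegrable_sign_sub a _ _)
    (intervalIntegrable_const (c := (0 : ℝ))) (C := 1) fun x _ => by
      rw [sub_zero]; exact abs_sign_le_one _
  rwa [avg_const hδ, sub_zero] at this

/-- Subgradient inequality for the smoothed modulus. -/
theorem ent_add_sgnAvg_mul_le (a b : ℝ) : ent δ a + sgnAvg δ a * (b - a) ≤ ent δ b := by
  have h1 := intervalIntegrable_abs_sub a (-δ) δ
  have h2 := intervalIntegrable_sign_sub a (-δ) δ
  rw [ent, sgnAvg, mul_comm, ← avg_const_mul, ← avg_add h1 (h2.const_mul _)]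
  refine avg_mono hδ (h1.add (h2.const_mul _)) (intervalIntegrable_abs_sub b _ _) fun κ => ?_
  have := abs_add_sign_mul_le (a - κ) (b - κ)
  rw [show b - κ - (a - κ) = b - a by ring, mul_comm] at this
  exact this

omit hδ in
theorem integral_sign (a b : ℝ) : ∫ x in a..b, Real.sign x = |b| - |a| := by
  have h0 : ∀ b : ℝ, ∫ x in (0:ℝ)..b, Real.sign x = |b| := by
    intro b
    rcases le_total 0 b with hb | hb
    · rw [abs_of_nonneg hb, intervalIntegral.integral_congr_ae (g := fun _ => (1:ℝ))]
      · simp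
      · refine Eventually.of_forall fun x hx => ?_
        rw [uIoc_of_le hb] at hx
        exact Real.sign_of_pos hx.1
    · rw [abs_of_nonpos hb, intervalIntegral.integral_congr_ae (g := fun _ => (-1:ℝ))]
      · simp
      · filter_upwards [Measure.ae_ne volume (0:ℝ)] with x hx0 hx
        rw [uIoc_of_ge hb] at hx
        exact Real.sign_of_neg (lt_of_le_of_ne hx.2 hx0)
  have hi : ∀ a b, IntervalIntegrable Real.sign volume a b := fun a b =>
    monotone_sign.intervalIntegrable
  rw [← h0 a, ← h0 b, intervalIntegral.integral_interval_sub_left (hi _ _) (hi _ _)]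

omit hδ in
theorem sgnAvg_eq (a : ℝ) : sgnAvg δ a = (2 * δ)⁻¹ * (|a + δ| - |a - δ|) := by
  unfold sgnAvg avg
  rw [intervalIntegral.integral_comp_sub_left (fun x => Real.sign x), integral_sign, sub_neg_eq_add]

theorem abs_sgnAvg_sub_le (a b : ℝ) : |sgnAvg δ a - sgnAvg δ b| ≤ δ⁻¹ * |a - b| := by
  rw [sgnAvg_eq, sgnAvg_eq, ← mul_sub, abs_mul, abs_of_pos (by positivity : 0 < (2 * δ)⁻¹)]
  have h1 := abs_abs_sub_abs_le (a + δ) (b + δ)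
  have h2 := abs_abs_sub_abs_le (b - δ) (a - δ)
  rw [show a + δ - (b + δ) = a - b by ring] at h1
  rw [show b - δ - (a - δ) = b - a by ring, abs_sub_comm b a] at h2
  have h3 : |(|a + δ| - |a - δ|) - (|b + δ| - |b - δ|)| ≤ 2 * |a - b| := by
    rw [abs_le] at *; constructor <;> linarith
  calc _ ≤ (2 * δ)⁻¹ * (2 * |a - b|) := by gcongr
    _ = _ := by field_simp

theorem continuous_ent : Continuous (ent δ) :=
  continuous_of_abs_sub_le (L := 1) fun a b => by rw [one_mul]; exact abs_ent_sub_le hδ a b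

theorem continuous_sgnAvg : Continuous (sgnAvg δ) :=
  continuous_of_abs_sub_le (abs_sgnAvg_sub_le hδ)

theorem sgnAvg_eq_sign {a : ℝ} (ha : δ ≤ |a|) : sgnAvg δ a = Real.sign a := by
  rw [sgnAvg_eq]
  rcases le_total 0 a with h | h
  · rw [abs_of_nonneg h] at ha
    rw [abs_of_nonneg (by linarith), abs_of_nonneg (by linarith),
      Real.sign_of_pos (by linarith)]
    field_simp; ring
  · rw [abs_of_nonpos h] at ha
    rw [abs_of_nonpos (by linarith), abs_of_nonpos (by linarith),
      Real.sign_of_neg (by linarith)]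
    field_simp; ring

omit hδ in
theorem tendsto_sgnAvg (a : ℝ) : Tendsto (fun δ => sgnAvg δ a) (𝓝[>] 0) (𝓝 (Real.sign a)) := by
  by_cases ha : a = 0
  · subst ha
    refine tendsto_const_nhds.congr fun δ => ?_
    rw [sgnAvg_eq, zero_add, zero_sub, abs_neg, sub_self, mul_zero, Real.sign_zero]
  · refine tendsto_const_nhds.congr' ?_
    filter_upwards [Ioo_mem_nhdsGT (abs_pos.2 ha)] with δ hδ
    exact (sgnAvg_eq_sign hδ.1 hδ.2.le).symm

omit hδ in
theorem tendsto_ent (a : ℝ) : Tendsto (fun δ => ent δ a) (𝓝[>] 0) (𝓝 |a|) := by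
  rw [tendsto_iff_dist_tendsto_zero]
  refine squeeze_zero' (Eventually.of_forall fun _ => dist_nonneg) (g := fun δ => δ) ?_
    (tendsto_nhdsWithin_of_tendsto_nhds tendsto_id)
  filter_upwards [self_mem_nhdsWithin] with δ hδ
  exact abs_ent_sub_abs_le hδ a

end

section
variable {f : ℝ → ℝ} {L : ℝ} (hf : ∀ a b, |f a - f b| ≤ L * |a - b|) {δ : ℝ} (hδ : 0 < δ)
include hf

theorem intervalIntegrable_kruzFlux (k r a b : ℝ) :
    IntervalIntegrable (fun κ => kruzFlux f (k + κ) r) volume a b :=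
  Continuous.intervalIntegrable (continuous_of_abs_sub_le (L := L) fun a b => by
    have := abs_kruzFlux_sub_le' hf (k + a) (k + b) r
    rwa [show k + a - (k + b) = a - b by ring] at this) _ _

theorem measurable_kruzFlux (k : ℝ) : Measurable (kruzFlux f k) :=
  (continuous_of_abs_sub_le (abs_kruzFlux_sub_le hf k)).measurable

include hδ

theorem abs_fluxAvg_sub_le (k a b : ℝ) : |fluxAvg f δ k a - fluxAvg f δ k b| ≤ L * |a - b| :=
  abs_avg_sub_le hδ (intervalIntegrable_kruzFlux hf _ _ _ _)
    (intervalIntegrable_kruzFlux hf _ _ _ _) fun _ _ => abs_kruzFlux_sub_le hf _ _ _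

theorem abs_fluxAvg_sub_le' (k l r : ℝ) : |fluxAvg f δ k r - fluxAvg f δ l r| ≤ L * |k - l| :=
  abs_avg_sub_le hδ (intervalIntegrable_kruzFlux hf _ _ _ _)
    (intervalIntegrable_kruzFlux hf _ _ _ _) fun κ _ => by
      have := abs_kruzFlux_sub_le' hf (k + κ) (l + κ) r
      rwa [show k + κ - (l + κ) = k - l by ring] at this

theorem abs_fluxAvg_sub_kruzFlux_le (hL : 0 ≤ L) (k r : ℝ) :
    |fluxAvg f δ k r - kruzFlux f k r| ≤ L * δ := by
  rw [← avg_const hδ (kruzFlux f k r)]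
  refine abs_avg_sub_le hδ (intervalIntegrable_kruzFlux hf _ _ _ _) intervalIntegrable_const
    fun κ hκ => (abs_kruzFlux_sub_le' hf _ _ _).trans ?_
  rw [add_sub_cancel_left]
  gcongr
  exact abs_le.2 hκ

theorem ent_laxFriedrichs_sub_le {σ : ℝ} (hσ : 0 ≤ σ) (hσL : σ * L ≤ 1) (k p m : ℝ) :
    ent δ ((p - σ * f p + (m + σ * f m)) / 2 - k) ≤
      (ent δ (p - k) + ent δ (m - k)) / 2 - σ / 2 * (fluxAvg f δ k p - fluxAvg f δ k m) := by
  have e1 := intervalIntegrable_abs_sub (p - k) (-δ) δ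
  have e2 := intervalIntegrable_abs_sub (m - k) (-δ) δ
  have e3 := intervalIntegrable_kruzFlux hf k p (-δ) δ
  have e4 := intervalIntegrable_kruzFlux hf k m (-δ) δ
  unfold ent fluxAvg
  rw [← avg_add e1 e2, ← avg_sub e3 e4, div_eq_inv_mul (avg _ _), ← avg_const_mul,
    ← avg_const_mul, ← avg_sub ((e1.add e2).const_mul _) ((e3.sub e4).const_mul _)]
  refine avg_mono hδ (intervalIntegrable_abs_sub _ _ _)
    (((e1.add e2).const_mul _).sub ((e3.sub e4).const_mul _)) fun κ => ?_
  have := abs_laxFriedrichs_sub_le hf hσ hσL (k + κ) p m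
  simp only [← sub_sub] at this
  linarith

omit hδ in
theorem tendsto_fluxAvg (hL : 0 ≤ L) (k r : ℝ) :
    Tendsto (fun δ => fluxAvg f δ k r) (𝓝[>] 0) (𝓝 (kruzFlux f k r)) := by
  rw [tendsto_iff_dist_tendsto_zero]
  refine squeeze_zero' (Eventually.of_forall fun _ => dist_nonneg) (g := fun δ => L * δ) ?_
    (tendsto_nhdsWithin_of_tendsto_nhds ?_)
  · filter_upwards [self_mem_nhdsWithin] with δ hδ
    exact abs_fluxAvg_sub_kruzFlux_le hf hδ hL k r
  · have : Continuous fun δ : ℝ => L * δ := by fun_prop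
    simpa using this.tendsto 0

end

/-- Bounded measurable functions vanishing outside `[-R, R]`. -/
structure Cutoff (R C : ℝ) (p : ℝ → ℝ) : Prop where
  meas : Measurable p
  bdd : ∀ x, |p x| ≤ C
  supp : ∀ x ∉ Icc (-R) R, p x = 0

namespace Cutoff

variable {R C C' : ℝ} {p q g : ℝ → ℝ}

theorem nonneg (hp : Cutoff R C p) : 0 ≤ C := (abs_nonneg _).trans (hp.bdd 0)

theorem sub (hp : Cutoff R C p) (hq : Cutoff R C' q) {c : ℝ} (h : ∀ x, |p x - q x| ≤ c) :
    Cutoff R c (fun x => p x - q x) where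
  meas := hp.meas.sub hq.meas
  bdd := h
  supp x hx := by simp [hp.supp x hx, hq.supp x hx]

theorem integrable_mul (hp : Cutoff R C p) (hg : IntegrableOn g (Icc (-R) R)) :
    Integrable (fun x => g x * p x) := by
  have h1 : IntegrableOn (fun x => g x * p x) (Icc (-R) R) :=
    Integrable.mul_bdd (c := C) hg hp.meas.aestronglyMeasurable
      (Eventually.of_forall fun x => hp.bdd x)
  refine (integrableOn_iff_integrable_of_support_subset fun x hx => ?_).1 h1
  by_contra h
  exact hx (by simp [hp.supp x h])

theorem abs_integral_mul_le (hp : Cutoff R C p) (hg : IntegrableOn g (Icc (-R) R)) :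
    |∫ x, g x * p x| ≤ C * ∫ x in Icc (-R) R, |g x| := by
  rw [← setIntegral_eq_integral_of_forall_compl_eq_zero (s := Icc (-R) R)
    (fun x hx => by simp [hp.supp x hx]), ← integral_const_mul]
  refine (abs_integral_le_integral_abs).trans
    (integral_mono (hp.integrable_mul hg).abs.integrableOn (hg.abs.const_mul C) fun x => ?_)
  simp only [abs_mul]
  rw [mul_comm]
  exact mul_le_mul_of_nonneg_right (hp.bdd x) (abs_nonneg _)

theorem integrableOn_bdd (hg : Measurable g) (hb : ∀ x, |g x| ≤ C) :
    IntegrableOn g (Icc (-R) R) :=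
  Integrable.of_bound hg.aestronglyMeasurable C (Eventually.of_forall hb)

end Cutoff

theorem setIntegral_abs_le_of_bdd {R C : ℝ} {g : ℝ → ℝ} (hb : ∀ x, |g x| ≤ C) :
    ∫ x in Icc (-R) R, |g x| ≤ C * (2 * |R|) := by
  have hC : 0 ≤ C := (abs_nonneg _).trans (hb 0)
  have := norm_setIntegral_le_of_norm_le_const (μ := volume) (s := Icc (-R) R)
    (f := fun x => |g x|) (C := C) (by simp) (fun x _ => by
      rw [Real.norm_eq_abs, abs_abs]; exact hb x)
  refine (le_abs_self _).trans (this.trans ?_)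
  rw [Real.volume_real_Icc]
  gcongr
  exact max_le (by linarith [le_abs_self R]) (by positivity)

theorem setIntegral_Icc_mono {R R' : ℝ} (h : R ≤ R') {g : ℝ → ℝ} (hg : Integrable g) :
    ∫ x in Icc (-R) R, |g x| ≤ ∫ x in Icc (-R') R', |g x| :=
  setIntegral_mono_set hg.abs.integrableOn (Eventually.of_forall fun _ => abs_nonneg _)
    (LE.le.eventuallyLE (Icc_subset_Icc (by linarith) h))

theorem setIntegral_Icc_le {R : ℝ} {g : ℝ → ℝ} (hg : Integrable g) :
    ∫ x in Icc (-R) R, |g x| ≤ ∫ x, |g x| :=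
  setIntegral_le_integral hg.abs (Eventually.of_forall fun _ => abs_nonneg _)

section
variable {ν : Measure ℝ} [SFinite ν]

/-- Local `L¹` modulus of continuity of `(v, w) ↦ S(v) g[w]` on bounded sets of `RegL1`. -/
theorem exists_production_modulus (hν : Integrable (fun z : ℝ => min 1 |z|) ν) (M N B R : ℝ)
    {C : ℝ} (hC : 0 ≤ C) {ε : ℝ} (hε : 0 < ε) :
    ∃ K ≥ 0, ∃ R', ∀ S : ℝ → ℝ, (∀ a b, |S a - S b| ≤ C * |a - b|) → (∀ a, |S a| ≤ 1) →
      ∀ v v' w w', RegL1 M N B v → RegL1 M N B v' → RegL1 M N B w → RegL1 M N B w' →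
      ∫ x in Icc (-R) R, |S (v x) * nonlocal ν w x - S (v' x) * nonlocal ν w' x| ≤
        ε + K * ((∫ x in Icc (-R') R', |w x - w' x|) + ∫ x in Icc (-R') R', |v x - v' x|) := by
  obtain ⟨K₁, hK₁, R₁, h₁⟩ := exists_nonlocal_modulus hν (M + M) (N + N) (B + B) R (half_pos hε)
  obtain ⟨K₂, hK₂, h₂⟩ := exists_mul_nonlocal_modulus hν M N B (zero_le_two (α := ℝ)) (half_pos hε)
  refine ⟨K₁ + K₂ * C, by positivity, max R R₁, fun S hS hS1 v v' w w' hv hv' hw hw' => ?_⟩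
  have hSm : Measurable S := (continuous_of_abs_sub_le hS).measurable
  set s : ℝ → ℝ := (Icc (-R) R).indicator fun x => S (v x) - S (v' x) with hs
  have hsm : Measurable s :=
    ((hSm.comp hv.meas).sub (hSm.comp hv'.meas)).indicator measurableSet_Icc
  have hs2 : ∀ x, |s x| ≤ 2 := fun x => by
    rw [hs]
    by_cases hx : x ∈ Icc (-R) R
    · rw [indicator_of_mem hx]
      have a1 := abs_le.1 (hS1 (v x))
      have a2 := abs_le.1 (hS1 (v' x))
      rw [abs_le]; constructor <;> linarith
    · rw [indicator_of_notMem hx]; simp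
  have hsi : Integrable s := by
    refine (integrable_indicator_iff measurableSet_Icc).2
      (Cutoff.integrableOn_bdd (C := 2) ((hSm.comp hv.meas).sub (hSm.comp hv'.meas)) fun x => ?_)
    show |S (v x) - S (v' x)| ≤ 2
    have a1 := abs_le.1 (hS1 (v x))
    have a2 := abs_le.1 (hS1 (v' x))
    rw [abs_le]; constructor <;> linarith
  have e1 := h₁ _ (hw.sub hw')
  have e2 := h₂ w' hw' s hsm hs2 hsi
  have e3 : ∫ x, |s x| ≤ C * ∫ x in Icc (-R) R, |v x - v' x| := by
    rw [← integral_const_mul, ← integral_indicator measurableSet_Icc]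
    refine integral_mono hsi.abs
      (((hv.sub hv').int.abs.const_mul C).indicator measurableSet_Icc) fun x => ?_
    by_cases hx : x ∈ Icc (-R) R
    · simp only [hs, indicator_of_mem hx]; exact hS _ _
    · simp [hs, indicator_of_notMem hx]
  have i1 := ((hw.sub hw').nonlocal_int hν).abs
  have i2 := (hw'.mul_nonlocal hν hsm hs2).1.abs
  have e4 : ∫ x in Icc (-R) R, |S (v x) * nonlocal ν w x - S (v' x) * nonlocal ν w' x| ≤
      ∫ x in Icc (-R) R, (|nonlocal ν (fun x => w x - w' x) x| + |s x * nonlocal ν w' x|) := by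
    have m1 := ((hw.mul_nonlocal hν (hSm.comp hv.meas) (C := 1) fun x => hS1 _).1.sub
      (hw'.mul_nonlocal hν (hSm.comp hv'.meas) (C := 1) fun x => hS1 _).1).abs
    refine integral_mono_ae m1.integrableOn (i1.add i2).integrableOn ?_
    filter_upwards [ae_restrict_of_ae (hw.nonlocal_sub hw' hν), ae_restrict_mem measurableSet_Icc]
      with x hx hxm
    simp only [hs, indicator_of_mem hxm, hx]
    calc |S (v x) * nonlocal ν w x - S (v' x) * nonlocal ν w' x|
        = |S (v x) * (nonlocal ν w x - nonlocal ν w' x)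
          + (S (v x) - S (v' x)) * nonlocal ν w' x| := by congr 1; ring
      _ ≤ |S (v x) * (nonlocal ν w x - nonlocal ν w' x)|
          + |(S (v x) - S (v' x)) * nonlocal ν w' x| := abs_add_le _ _
      _ ≤ _ := by
        refine add_le_add_left ?_ _
        rw [abs_mul]
        exact mul_le_of_le_one_left (abs_nonneg _) (hS1 _)
  rw [integral_add i1.integrableOn i2.integrableOn] at e4
  have e5 := setIntegral_le_integral (s := Icc (-R) R) i2
    (Eventually.of_forall fun _ => abs_nonneg _)
  have f1 := setIntegral_Icc_mono (le_max_right R R₁) (hw.sub hw').int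
  have f2 := setIntegral_Icc_mono (le_max_left R R₁) (hv.sub hv').int
  set I := ∫ x in Icc (-max R R₁) (max R R₁), |w x - w' x|
  set J := ∫ x in Icc (-max R R₁) (max R R₁), |v x - v' x|
  have hI : 0 ≤ I := integral_nonneg fun _ => abs_nonneg _
  have hJ : 0 ≤ J := integral_nonneg fun _ => abs_nonneg _
  have g1 := mul_le_mul_of_nonneg_left f1 hK₁
  have g2 := mul_le_mul_of_nonneg_left (e3.trans (mul_le_mul_of_nonneg_left f2 hC)) hK₂
  have g3 : 0 ≤ K₁ * J := by positivity
  have g4 : 0 ≤ K₂ * C * I := by positivity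
  nlinarith

end

/-- The entropy `∫ η(w - k) p`. -/
noncomputable def entInt (δ k : ℝ) (w p : ℝ → ℝ) : ℝ := ∫ x, ent δ (w x - k) * p x

/-- The entropy production `∫ (q(k, w) q + S(w - k) g[w] r)`. -/
noncomputable def prodInt (ν : Measure ℝ) (f : ℝ → ℝ) (δ k : ℝ) (w q r : ℝ → ℝ) : ℝ :=
  ∫ x, (fluxAvg f δ k (w x) * q x + sgnAvg δ (w x - k) * nonlocal ν w x * r x)

section
variable {M N B R C C' δ k : ℝ} {w w' p p' : ℝ → ℝ}

theorem abs_ent_le (hδ : 0 < δ) (hw : RegL1 M N B w) (x : ℝ) :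
    |ent δ (w x - k)| ≤ M + |k| + δ := by
  have h1 := abs_le.1 (abs_ent_sub_abs_le hδ (w x - k))
  have h2 := abs_sub (w x) k
  have h3 := hw.bdd x
  have h4 := abs_nonneg (w x - k)
  rw [abs_le]; constructor <;> linarith

theorem measurable_ent_comp (hδ : 0 < δ) (hw : Measurable w) :
    Measurable fun x => ent δ (w x - k) :=
  (continuous_ent hδ).measurable.comp (hw.sub_const k)

theorem integrable_ent_mul (hδ : 0 < δ) (hw : RegL1 M N B w) (hp : Cutoff R C p) :
    Integrable fun x => ent δ (w x - k) * p x :=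
  hp.integrable_mul (Cutoff.integrableOn_bdd (measurable_ent_comp hδ hw.meas)
    (abs_ent_le hδ hw))

theorem abs_entInt_sub_le (hδ : 0 < δ) (hw : RegL1 M N B w) (hw' : RegL1 M N B w')
    (hp : Cutoff R C p) :
    |entInt δ k w p - entInt δ k w' p| ≤ C * ∫ x in Icc (-R) R, |w x - w' x| := by
  unfold entInt
  rw [← integral_sub (integrable_ent_mul hδ hw hp) (integrable_ent_mul hδ hw' hp)]
  simp only [← sub_mul]
  have hi : IntegrableOn (fun x => ent δ (w x - k) - ent δ (w' x - k)) (Icc (-R) R) :=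
    (Cutoff.integrableOn_bdd (measurable_ent_comp hδ hw.meas) (abs_ent_le hδ hw)).sub
    (Cutoff.integrableOn_bdd (measurable_ent_comp hδ hw'.meas) (abs_ent_le hδ hw'))
  refine (hp.abs_integral_mul_le hi).trans
    (mul_le_mul_of_nonneg_left ?_ hp.nonneg)
  refine integral_mono hi.abs (hw.sub hw').int.abs.integrableOn fun x => ?_
  have := abs_ent_sub_le hδ (w x - k) (w' x - k)
  rwa [show w x - k - (w' x - k) = w x - w' x by ring] at this

theorem abs_entInt_sub_le' (hδ : 0 < δ) (hw : RegL1 M N B w) (hp : Cutoff R C p)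
    (hp' : Cutoff R C' p') {c : ℝ} (hc : ∀ x, |p x - p' x| ≤ c) :
    |entInt δ k w p - entInt δ k w p'| ≤ c * ((M + |k| + δ) * (2 * |R|)) := by
  unfold entInt
  rw [← integral_sub (integrable_ent_mul hδ hw hp) (integrable_ent_mul hδ hw hp')]
  simp only [← mul_sub]
  refine ((hp.sub hp' hc).abs_integral_mul_le (Cutoff.integrableOn_bdd
    (measurable_ent_comp hδ hw.meas) (abs_ent_le hδ hw))).trans
    (mul_le_mul_of_nonneg_left (setIntegral_abs_le_of_bdd (abs_ent_le hδ hw))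
      (hp.sub hp' hc).nonneg)

variable {f : ℝ → ℝ} {L : ℝ} (hf : ∀ a b, |f a - f b| ≤ L * |a - b|) {ν : Measure ℝ} [SFinite ν]
  {q r q' r' : ℝ → ℝ}

include hf

theorem abs_kruzFlux_le (k r : ℝ) : |kruzFlux f k r| ≤ L * |r - k| := by
  have := abs_kruzFlux_sub_le hf k r k
  rwa [show kruzFlux f k k = 0 by simp [kruzFlux], sub_zero] at this

theorem abs_fluxAvg_le (hL : 0 ≤ L) (hδ : 0 < δ) (hw : RegL1 M N B w) (x : ℝ) :
    |fluxAvg f δ k (w x)| ≤ L * (M + |k| + δ) := by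
  have h1 := abs_fluxAvg_sub_kruzFlux_le hf hδ hL k (w x)
  have h2 := abs_kruzFlux_le hf k (w x)
  have h3 : L * |w x - k| ≤ L * (M + |k|) := by
    gcongr
    linarith [abs_sub (w x) k, hw.bdd x]
  have h4 := abs_sub_abs_le_abs_sub (fluxAvg f δ k (w x)) (kruzFlux f k (w x))
  linarith

theorem measurable_fluxAvg_comp (hδ : 0 < δ) (hw : Measurable w) :
    Measurable fun x => fluxAvg f δ k (w x) :=
  (continuous_of_abs_sub_le (abs_fluxAvg_sub_le hf hδ k)).measurable.comp hw

theorem integrableOn_fluxAvg (hL : 0 ≤ L) (hδ : 0 < δ) (hw : RegL1 M N B w) :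
    IntegrableOn (fun x => fluxAvg f δ k (w x)) (Icc (-R) R) :=
  Cutoff.integrableOn_bdd (measurable_fluxAvg_comp hf hδ hw.meas) (abs_fluxAvg_le hf hL hδ hw)

omit hf in
theorem measurable_sgnAvg_comp (hδ : 0 < δ) (hw : Measurable w) :
    Measurable fun x => sgnAvg δ (w x - k) :=
  (continuous_sgnAvg hδ).measurable.comp (hw.sub_const k)

omit hf in
theorem integrable_sgnAvg_mul_nonlocal (hν : Integrable (fun z : ℝ => min 1 |z|) ν)
    (hδ : 0 < δ) (hw : RegL1 M N B w) (hw' : RegL1 M N B w') :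
    Integrable fun x => sgnAvg δ (w' x - k) * nonlocal ν w x :=
  (hw.mul_nonlocal hν (measurable_sgnAvg_comp hδ hw'.meas) fun _ => abs_sgnAvg_le_one hδ _).1

theorem integrable_prodInt (hν : Integrable (fun z : ℝ => min 1 |z|) ν) (hL : 0 ≤ L)
    (hδ : 0 < δ) (hw : RegL1 M N B w) (hq : Cutoff R C q) (hr : Cutoff R C r) :
    Integrable fun x => fluxAvg f δ k (w x) * q x + sgnAvg δ (w x - k) * nonlocal ν w x * r x :=
  (hq.integrable_mul (integrableOn_fluxAvg hf hL hδ hw)).add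
    (hr.integrable_mul (integrable_sgnAvg_mul_nonlocal hν hδ hw hw).integrableOn)

/-- Local `L¹` modulus of continuity of the entropy production. -/
theorem exists_prodInt_modulus (hν : Integrable (fun z : ℝ => min 1 |z|) ν) (hL : 0 ≤ L)
    (hδ : 0 < δ) (M N B R : ℝ) (hC : 0 ≤ C) {ε : ℝ} (hε : 0 < ε) :
    ∃ K ≥ 0, ∃ R', ∀ k w w' q r, RegL1 M N B w → RegL1 M N B w' →
      Cutoff R C q → Cutoff R C r →
      |prodInt ν f δ k w q r - prodInt ν f δ k w' q r| ≤
        ε + K * ∫ x in Icc (-R') R', |w x - w' x| := by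
  obtain ⟨K, hK, R₁, h⟩ := exists_production_modulus hν M N B R (inv_nonneg.2 hδ.le)
    (ε := ε / (C + 1)) (by positivity)
  refine ⟨C * (L + 2 * K), by positivity, max R R₁, fun k w w' q r hw hw' hq hr => ?_⟩
  have i1 := integrableOn_fluxAvg (k := k) (R := R) hf hL hδ hw
  have i2 := integrableOn_fluxAvg (k := k) (R := R) hf hL hδ hw'
  have j1 := (integrable_sgnAvg_mul_nonlocal (k := k) hν hδ hw hw).integrableOn (s := Icc (-R) R)
  have j2 := (integrable_sgnAvg_mul_nonlocal (k := k) hν hδ hw' hw').integrableOn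
    (s := Icc (-R) R)
  have e1 := hq.abs_integral_mul_le (i1.sub i2)
  have e2 := hr.abs_integral_mul_le (j1.sub j2)
  have e3 : ∫ x in Icc (-R) R, |fluxAvg f δ k (w x) - fluxAvg f δ k (w' x)| ≤
      L * ∫ x in Icc (-R) R, |w x - w' x| := by
    rw [← integral_const_mul]
    exact integral_mono (i1.sub i2).abs ((hw.sub hw').int.abs.const_mul L).integrableOn
      fun x => abs_fluxAvg_sub_le hf hδ k _ _
  have e4 := h (fun a => sgnAvg δ (a - k)) (fun a b => by
    have := abs_sgnAvg_sub_le hδ (a - k) (b - k)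
    rwa [show a - k - (b - k) = a - b by ring] at this) (fun a => abs_sgnAvg_le_one hδ _)
    w w' w w' hw hw' hw hw'
  have f1 := setIntegral_Icc_mono (le_max_left R R₁) (hw.sub hw').int
  have f2 := setIntegral_Icc_mono (le_max_right R R₁) (hw.sub hw').int
  have key : prodInt ν f δ k w q r - prodInt ν f δ k w' q r =
      (∫ x, (fluxAvg f δ k (w x) - fluxAvg f δ k (w' x)) * q x) +
      ∫ x, (sgnAvg δ (w x - k) * nonlocal ν w x - sgnAvg δ (w' x - k) * nonlocal ν w' x) * r x := by
    have hqi := hq.integrable_mul (i1.sub i2)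
    have hri := hr.integrable_mul (j1.sub j2)
    simp only [Pi.sub_apply] at hqi hri
    unfold prodInt
    rw [← integral_sub (integrable_prodInt hf hν hL hδ hw hq hr)
      (integrable_prodInt hf hν hL hδ hw' hq hr), ← integral_add hqi hri]
    congr 1; ext x; ring
  rw [key]
  simp only [Pi.sub_apply] at e1 e2
  refine (abs_add_le _ _).trans ?_
  set I := ∫ x in Icc (-max R R₁) (max R R₁), |w x - w' x|
  have g1 := e1.trans (mul_le_mul_of_nonneg_left (e3.trans
    (mul_le_mul_of_nonneg_left f1 hL)) hC)
  have g2 := e2.trans (mul_le_mul_of_nonneg_left (e4.trans (add_le_add_right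
    (mul_le_mul_of_nonneg_left (add_le_add f2 f2) hK) _)) hC)
  have g3 : C * (ε / (C + 1)) ≤ ε := by
    rw [mul_div_assoc', div_le_iff₀ (by positivity)]; nlinarith
  nlinarith

theorem abs_prodInt_sub_le (hν : Integrable (fun z : ℝ => min 1 |z|) ν) (hL : 0 ≤ L)
    (hδ : 0 < δ) (hw : RegL1 M N B w) (hq : Cutoff R C q) (hr : Cutoff R C r)
    (hq' : Cutoff R C q') (hr' : Cutoff R C r') {c : ℝ} (hcq : ∀ x, |q x - q' x| ≤ c)
    (hcr : ∀ x, |r x - r' x| ≤ c) :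
    |prodInt ν f δ k w q r - prodInt ν f δ k w q' r'| ≤
      c * (L * (M + |k| + δ) * (2 * |R|) + (B + 2 * N) * ∫ z, min 1 |z| ∂ν) := by
  have i1 := integrableOn_fluxAvg (k := k) (R := R) hf hL hδ hw
  have j1 := integrable_sgnAvg_mul_nonlocal (k := k) hν hδ hw hw
  have hc : 0 ≤ c := (abs_nonneg _).trans (hcq 0)
  have key : prodInt ν f δ k w q r - prodInt ν f δ k w q' r' =
      (∫ x, fluxAvg f δ k (w x) * (q x - q' x)) +
      ∫ x, sgnAvg δ (w x - k) * nonlocal ν w x * (r x - r' x) := by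
    unfold prodInt
    rw [← integral_sub (integrable_prodInt hf hν hL hδ hw hq hr)
      (integrable_prodInt hf hν hL hδ hw hq' hr'),
      ← integral_add ((hq.sub hq' hcq).integrable_mul i1)
        ((hr.sub hr' hcr).integrable_mul j1.integrableOn)]
    congr 1; ext x; ring
  rw [key, mul_add]
  refine (abs_add_le _ _).trans (add_le_add ?_ ?_)
  · exact ((hq.sub hq' hcq).abs_integral_mul_le i1).trans (mul_le_mul_of_nonneg_left
      (setIntegral_abs_le_of_bdd (abs_fluxAvg_le hf hL hδ hw)) hc)
  · refine ((hr.sub hr' hcr).abs_integral_mul_le j1.integrableOn).trans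
      (mul_le_mul_of_nonneg_left ((setIntegral_Icc_le j1).trans ?_) hc)
    refine (integral_mono j1.abs (hw.nonlocal_int hν).abs fun x => ?_).trans
      (hw.nonlocal_norm hν)
    simp only [abs_mul]
    exact mul_le_of_le_one_left (abs_nonneg _) (abs_sgnAvg_le_one hδ _)

end

theorem RegL1.shift {M N B : ℝ} {w : ℝ → ℝ} (h : RegL1 M N B w) (a : ℝ) :
    RegL1 M N B fun x => w (x + a) where
  meas := h.meas.comp (measurable_add_const a)
  bdd x := h.bdd _
  int := h.int.comp_add_right a
  norm := (integral_add_right_eq_self (μ := volume) (fun x => |w x|) a).trans_le h.norm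
  trans z := by
    have := integral_add_right_eq_self (μ := volume) (fun x => |w (x + z) - w x|) a
    simp only [add_right_comm _ a z] at this ⊢
    exact this.trans_le (h.trans z)

/-- One step of the explicit scheme: Lax-Friedrichs averaging for the convection and explicit
Euler for the jump operator. -/
noncomputable def stepOp (f : ℝ → ℝ) (σ h τ : ℝ) (μ : Measure ℝ) (w : ℝ → ℝ) (x : ℝ) : ℝ :=
  ((w (x + h) - σ * f (w (x + h)) + (w (x - h) + σ * f (w (x - h)))) / 2 + w x) / 2 +
    τ * nonlocal μ w x

theorem nonlocal_eq_sub {μ : Measure ℝ} [IsFiniteMeasure μ] {M : ℝ} {w : ℝ → ℝ}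
    (hw : Measurable w) (hb : ∀ x, |w x| ≤ M) (x : ℝ) :
    nonlocal μ w x = (∫ z, w (x + z) ∂μ) - μ.real univ * w x := by
  have : Integrable (fun z => w (x + z)) μ :=
    Integrable.of_bound (hw.comp (measurable_const_add x)).aestronglyMeasurable M
      (Eventually.of_forall fun z => hb _)
  rw [nonlocal, integral_sub this (integrable_const _), integral_const, smul_eq_mul]

theorem integrable_jump_finite (μ : Measure ℝ) [IsFiniteMeasure μ] :
    Integrable (fun z : ℝ => min 1 |z|) μ :=
  Integrable.of_bound (by fun_prop) 1 (Eventually.of_forall fun z => by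
    rw [Real.norm_eq_abs, abs_of_nonneg (le_min zero_le_one (abs_nonneg _))]
    exact min_le_left _ _)

section
variable {f : ℝ → ℝ} {L : ℝ} (hf : ∀ a b, |f a - f b| ≤ L * |a - b|)
  {σ h τ : ℝ} {μ : Measure ℝ} {M N B M' N' B' : ℝ} {w v : ℝ → ℝ}

theorem stepOp_shift (a x : ℝ) :
    stepOp f σ h τ μ (fun x => w (x + a)) x = stepOp f σ h τ μ w (x + a) := by
  simp only [stepOp, nonlocal]
  simp only [show ∀ z, x + z + a = x + a + z from fun z => by ring,
    show x - h + a = x + a - h by ring]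

theorem stepOp_zero : stepOp f σ h τ μ (fun _ => 0) = fun _ => 0 := by
  ext x; simp [stepOp, nonlocal]

include hf

theorem measurable_stepOp [SFinite μ] (hw : Measurable w) :
    Measurable (stepOp f σ h τ μ w) := by
  have hfm := (continuous_of_abs_sub_le hf).measurable
  have := measurable_nonlocal (ν := μ) hw
  unfold stepOp
  fun_prop

theorem abs_flow_add_abs_flow (hσ : 0 ≤ σ) (hσL : σ * L ≤ 1) (a b : ℝ) :
    |(a - σ * f a) - (b - σ * f b)| + |(a + σ * f a) - (b + σ * f b)| = 2 * |a - b| := by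
  have key : |σ * (f a - f b)| ≤ |a - b| := by
    rw [abs_mul, abs_of_nonneg hσ]
    calc σ * |f a - f b| ≤ σ * (L * |a - b|) := by gcongr; exact hf _ _
      _ = σ * L * |a - b| := by ring
      _ ≤ 1 * |a - b| := by gcongr
      _ = _ := one_mul _
  have e1 : (a - σ * f a) - (b - σ * f b) = (a - b) - σ * (f a - f b) := by ring
  have e2 : (a + σ * f a) - (b + σ * f b) = (a - b) + σ * (f a - f b) := by ring
  rw [e1, e2]
  have k := abs_le.1 key
  rcases le_total 0 (a - b) with h | h
  · rw [abs_of_nonneg h] at *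
    rw [abs_of_nonneg (by linarith), abs_of_nonneg (by linarith)]; ring
  · rw [abs_of_nonpos h] at *
    rw [abs_of_nonpos (by linarith), abs_of_nonpos (by linarith)]; ring

theorem monotone_flow (hσ : 0 ≤ σ) (hσL : σ * L ≤ 1) {a b : ℝ} (hab : a ≤ b) :
    a - σ * f a ≤ b - σ * f b ∧ a + σ * f a ≤ b + σ * f b := by
  have h1 : |σ * (f a - f b)| ≤ b - a := by
    rw [abs_mul, abs_of_nonneg hσ]
    calc σ * |f a - f b| ≤ σ * (L * |a - b|) := by gcongr; exact hf _ _
      _ = σ * L * |a - b| := by ring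
      _ ≤ 1 * |a - b| := by gcongr
      _ = _ := by rw [one_mul, abs_sub_comm, abs_of_nonneg (by linarith)]
  have := abs_le.1 h1
  constructor <;> linarith

variable [IsFiniteMeasure μ] (hσ : 0 ≤ σ) (hσL : σ * L ≤ 1) (hτ : 0 ≤ τ)
  (hτμ : τ * μ.real univ ≤ 1 / 2)
include hσ hσL hτ hτμ

theorem abs_stepOp_le (hw : RegL1 M N B w) (x : ℝ) : |stepOp f σ h τ μ w x| ≤ M := by
  have h1 : |∫ z, w (x + z) ∂μ| ≤ M * μ.real univ :=
    norm_integral_le_of_norm_le_const (μ := μ) (f := fun z => w (x + z))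
      (Eventually.of_forall fun z => hw.bdd _)
  have h2 := abs_le.1 (hw.bdd x)
  have b1 := abs_le.1 (hw.bdd (x + h))
  have b2 := abs_le.1 (hw.bdd (x - h))
  have m1 := monotone_flow hf hσ hσL b1.1
  have m2 := monotone_flow hf hσ hσL b1.2
  have m3 := monotone_flow hf hσ hσL b2.1
  have m4 := monotone_flow hf hσ hσL b2.2
  have h3 : |((w (x + h) - σ * f (w (x + h)) + (w (x - h) + σ * f (w (x - h)))) / 2)| ≤ M := by
    rw [abs_le]
    constructor
    · linarith [m1.1, m3.2]
    · linarith [m2.1, m4.2]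
  rw [stepOp, nonlocal_eq_sub hw.meas hw.bdd]
  have h4 : |τ * ∫ z, w (x + z) ∂μ| ≤ τ * μ.real univ * M := by
    rw [abs_mul, abs_of_nonneg hτ, mul_assoc, mul_comm (μ.real univ)]
    gcongr
  have h5 : |(1 / 2 - τ * μ.real univ) * w x| ≤ (1 / 2 - τ * μ.real univ) * M := by
    rw [abs_mul, abs_of_nonneg (by linarith)]
    exact mul_le_mul_of_nonneg_left (hw.bdd x) (by linarith)
  rw [abs_le] at *
  constructor <;> nlinarith

omit hf hσ hσL in
theorem integral_abs_half_add_nonlocal_le (hw : RegL1 M N B w) :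
    Integrable (fun x => w x / 2 + τ * nonlocal μ w x) ∧
      ∫ x, |w x / 2 + τ * nonlocal μ w x| ≤ 1 / 2 * ∫ x, |w x| := by
  have hμ := integrable_jump_finite μ
  have hi : Integrable (fun x => w x / 2 + τ * nonlocal μ w x) :=
    (hw.int.div_const 2).add ((hw.nonlocal_int hμ).const_mul τ)
  refine ⟨hi, ?_⟩
  have hp : Integrable (fun p : ℝ × ℝ => w (p.1 + p.2)) (volume.prod μ) := by
    have h1 := hw.incr_int_prod hμ (s := fun _ => 1) (C := 1) measurable_const (by simp)
    have h2 := hw.int.comp_fst μ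
    refine (h1.add h2).congr (Eventually.of_forall fun p => ?_)
    simp
  have h3 : ∫ x, |∫ z, w (x + z) ∂μ| ≤ μ.real univ * ∫ x, |w x| := by
    calc ∫ x, |∫ z, w (x + z) ∂μ| ≤ ∫ x, ∫ z, |w (x + z)| ∂μ :=
          integral_mono hp.integral_prod_left.abs hp.abs.integral_prod_left
            fun x => abs_integral_le_integral_abs
      _ = ∫ z, (∫ x, |w (x + z)|) ∂μ := integral_integral_swap hp.abs
      _ = μ.real univ * ∫ x, |w x| := by
        simp_rw [integral_add_right_eq_self (μ := volume) (fun x => |w x|)]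
        rw [integral_const, smul_eq_mul]
  have i1 : Integrable fun x => |∫ z, w (x + z) ∂μ| := hp.integral_prod_left.abs
  calc ∫ x, |w x / 2 + τ * nonlocal μ w x|
      ≤ ∫ x, ((1 / 2 - τ * μ.real univ) * |w x| + τ * |∫ z, w (x + z) ∂μ|) := by
        refine integral_mono hi.abs ((hw.int.abs.const_mul _).add (i1.const_mul τ)) fun x => ?_
        simp only [nonlocal_eq_sub hw.meas hw.bdd x]
        have : w x / 2 + τ * ((∫ z, w (x + z) ∂μ) - μ.real univ * w x) =
          (1 / 2 - τ * μ.real univ) * w x + τ * ∫ z, w (x + z) ∂μ := by ring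
        rw [this]
        refine (abs_add_le _ _).trans_eq ?_
        rw [abs_mul, abs_mul, abs_of_nonneg hτ, abs_of_nonneg (by linarith)]
    _ = (1 / 2 - τ * μ.real univ) * (∫ x, |w x|) + τ * ∫ x, |∫ z, w (x + z) ∂μ| := by
        rw [integral_add (hw.int.abs.const_mul _) (i1.const_mul τ), integral_const_mul,
          integral_const_mul]
    _ ≤ _ := by nlinarith [mul_le_mul_of_nonneg_left h3 hτ]

/-- The scheme is an `L¹` contraction. -/
theorem integral_abs_stepOp_sub_le (hw : RegL1 M N B w) (hv : RegL1 M' N' B' v) :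
    Integrable (fun x => stepOp f σ h τ μ w x - stepOp f σ h τ μ v x) ∧
      ∫ x, |stepOp f σ h τ μ w x - stepOp f σ h τ μ v x| ≤ ∫ x, |w x - v x| := by
  have hd := hw.sub hv
  obtain ⟨g1, g2⟩ := integral_abs_half_add_nonlocal_le hτ hτμ hd
  set Fm : ℝ → ℝ := fun x => (w x - σ * f (w x)) - (v x - σ * f (v x)) with hFm
  set Fp : ℝ → ℝ := fun x => (w x + σ * f (w x)) - (v x + σ * f (v x)) with hFp
  have hfm := (continuous_of_abs_sub_le hf).measurable
  have hw' := hw.meas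
  have hv' := hv.meas
  have key : ∀ x, |Fm x| + |Fp x| = 2 * |w x - v x| := fun x =>
    abs_flow_add_abs_flow hf hσ hσL _ _
  have im : Integrable Fm := (hd.int.abs.const_mul 2).mono' (by fun_prop)
    (Eventually.of_forall fun x => by
      rw [← key, Real.norm_eq_abs]; linarith [abs_nonneg (Fp x)])
  have ip : Integrable Fp := (hd.int.abs.const_mul 2).mono' (by fun_prop)
    (Eventually.of_forall fun x => by
      rw [← key, Real.norm_eq_abs]; linarith [abs_nonneg (Fm x)])
  have im' : Integrable fun x => Fm (x + h) := im.comp_add_right h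
  have ip' : Integrable fun x => Fp (x + -h) := ip.comp_add_right (-h)
  have hsum : ∫ x, |Fm x| + |Fp x| = 2 * ∫ x, |w x - v x| := by
    simp_rw [key]; rw [integral_const_mul]
  rw [integral_add im.abs ip.abs] at hsum
  have hae : (fun x => stepOp f σ h τ μ w x - stepOp f σ h τ μ v x) =ᵐ[volume]
      fun x => (Fm (x + h) + Fp (x + -h)) / 4 +
        ((w x - v x) / 2 + τ * nonlocal μ (fun x => w x - v x) x) := by
    filter_upwards [hw.nonlocal_sub hv (integrable_jump_finite μ)] with x hx
    rw [hx]
    simp only [stepOp, hFm, hFp, ← sub_eq_add_neg]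
    ring
  have hall := ((im'.add ip').div_const 4).add g1
  refine ⟨hall.congr hae.symm, ?_⟩
  rw [integral_congr_ae (hae.mono fun x hx => congrArg abs hx)]
  calc _ ≤ ∫ x, ((|Fm (x + h)| + |Fp (x + -h)|) / 4 +
        |(w x - v x) / 2 + τ * nonlocal μ (fun x => w x - v x) x|) := by
        refine integral_mono hall.abs (((im'.abs.add ip'.abs).div_const 4).add g1.abs) fun x => ?_
        refine (abs_add_le _ _).trans (add_le_add_left ?_ _)
        rw [abs_div, abs_of_pos (by norm_num : (0:ℝ) < 4)]
        exact div_le_div_of_nonneg_right (abs_add_le _ _) (by norm_num)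
    _ = ((∫ x, |Fm x|) + ∫ x, |Fp x|) / 4 +
        ∫ x, |(w x - v x) / 2 + τ * nonlocal μ (fun x => w x - v x) x| := by
        have is : Integrable fun x => (|Fm (x + h)| + |Fp (x + -h)|) / 4 :=
          (im'.abs.add ip'.abs).div_const 4
        rw [integral_add is g1.abs, integral_div,
          integral_add im'.abs ip'.abs,
          integral_add_right_eq_self (μ := volume) (fun x => |Fm x|) h,
          integral_add_right_eq_self (μ := volume) (fun x => |Fp x|) (-h)]
    _ ≤ _ := by rw [hsum]; linarith

theorem RegL1.stepOp (hw : RegL1 M N B w) : RegL1 M N B (stepOp f σ h τ μ w) := by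
  have h0 : RegL1 0 0 0 (fun _ : ℝ => (0 : ℝ)) :=
    ⟨measurable_const, by simp, by simp, by simp, by simp⟩
  have h1 := integral_abs_stepOp_sub_le (h := h) hf hσ hσL hτ hτμ hw h0
  simp only [stepOp_zero, sub_zero] at h1
  refine ⟨measurable_stepOp hf hw.meas, abs_stepOp_le hf hσ hσL hτ hτμ hw, h1.1,
    h1.2.trans hw.norm, fun z => ?_⟩
  have := (integral_abs_stepOp_sub_le (h := h) hf hσ hσL hτ hτμ (hw.shift z) hw).2
  simp only [stepOp_shift] at this
  exact this.trans (hw.trans z)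

/-- The displacement of one step of the scheme. -/
theorem integral_abs_stepOp_sub_self_le (hh : 0 ≤ h) (hw : RegL1 M N B w) :
    ∫ x, |stepOp f σ h τ μ w x - w x| ≤
      B * h + τ * ((B + 2 * N) * ∫ z, min 1 |z| ∂μ) := by
  have hμ := integrable_jump_finite μ
  have i1 := hw.incr_int h
  have i2 := hw.incr_int (-h)
  have i3 := hw.nonlocal_int hμ
  have hS := (RegL1.stepOp (h := h) hf hσ hσL hτ hτμ hw)
  have flow : ∀ a b, |(a - σ * f a) - (b - σ * f b)| ≤ 2 * |a - b| ∧
      |(a + σ * f a) - (b + σ * f b)| ≤ 2 * |a - b| := fun a b => by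
    have := abs_flow_add_abs_flow hf hσ hσL a b
    have h1 := abs_nonneg ((a - σ * f a) - (b - σ * f b))
    have h2 := abs_nonneg ((a + σ * f a) - (b + σ * f b))
    constructor <;> linarith
  calc ∫ x, |_root_.stepOp f σ h τ μ w x - w x|
      ≤ ∫ x, ((|w (x + h) - w x| + |w (x + -h) - w x|) / 2 + τ * |nonlocal μ w x|) := by
        refine integral_mono (hS.int.sub hw.int).abs
          (((i1.abs.add i2.abs).div_const 2).add (i3.abs.const_mul τ)) fun x => ?_
        have e : _root_.stepOp f σ h τ μ w x - w x =
          (((w (x + h) - σ * f (w (x + h))) - (w x - σ * f (w x))) +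
            ((w (x + -h) + σ * f (w (x + -h))) - (w x + σ * f (w x)))) / 4 +
            τ * nonlocal μ w x := by
          simp only [_root_.stepOp, ← sub_eq_add_neg]; ring
        simp only [e]
        refine (abs_add_le _ _).trans (add_le_add ?_ ?_)
        · rw [abs_div, abs_of_pos (by norm_num : (0:ℝ) < 4)]
          have := abs_add_le ((w (x + h) - σ * f (w (x + h))) - (w x - σ * f (w x)))
            ((w (x + -h) + σ * f (w (x + -h))) - (w x + σ * f (w x)))
          linarith [(flow (w (x + h)) (w x)).1, (flow (w (x + -h)) (w x)).2]
        · rw [abs_mul, abs_of_nonneg hτ]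
    _ = ((∫ x, |w (x + h) - w x|) + ∫ x, |w (x + -h) - w x|) / 2 +
        τ * ∫ x, |nonlocal μ w x| := by
        have is : Integrable fun x => (|w (x + h) - w x| + |w (x + -h) - w x|) / 2 :=
          (i1.abs.add i2.abs).div_const 2
        rw [integral_add is (i3.abs.const_mul τ), integral_div,
          integral_add i1.abs i2.abs, integral_const_mul]
    _ ≤ _ := by
        have t1 := hw.trans h
        have t2 := hw.trans (-h)
        rw [abs_neg] at t2
        rw [abs_of_nonneg hh] at t1 t2
        have t3 := mul_le_mul_of_nonneg_left (hw.nonlocal_norm hμ) hτ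
        linarith

end

namespace Cutoff

variable {R R' C C' : ℝ} {p q : ℝ → ℝ}

theorem mono_radius (hp : Cutoff R C p) (h : R ≤ R') : Cutoff R' C p :=
  ⟨hp.meas, hp.bdd, fun x hx => hp.supp x fun h' => hx (Icc_subset_Icc (by linarith) h h')⟩

theorem shift (hp : Cutoff R C p) {a : ℝ} (ha : |a| ≤ 1) :
    Cutoff (|R| + 1) C fun x => p (x + a) := by
  refine ⟨hp.meas.comp (measurable_add_const a), fun x => hp.bdd _, fun x hx => hp.supp _ ?_⟩
  intro h
  have h1 := abs_le.1 ha
  have h2 := le_abs_self R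
  exact hx ⟨by linarith [h.1], by linarith [h.2]⟩

theorem integrable_bdd_mul (hp : Cutoff R C p) {g : ℝ → ℝ} (hg : Measurable g)
    (hb : ∀ x, |g x| ≤ C') : Integrable (fun x => g x * p x) :=
  hp.integrable_mul (integrableOn_bdd hg hb)

theorem abs_integral_bdd_mul_le (hp : Cutoff R C p) {g : ℝ → ℝ} (hg : Measurable g)
    (hb : ∀ x, |g x| ≤ C') : |∫ x, g x * p x| ≤ C * (C' * (2 * |R|)) :=
  (hp.abs_integral_mul_le (integrableOn_bdd hg hb)).trans
    (mul_le_mul_of_nonneg_left (setIntegral_abs_le_of_bdd hb) hp.nonneg)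

end Cutoff

/-- Nonnegative compactly supported test functions with a Taylor estimate. -/
structure TestFn (R C : ℝ) (φ φ' : ℝ → ℝ) : Prop where
  cut : Cutoff R C φ
  cut' : Cutoff R C φ'
  nonneg : ∀ x, 0 ≤ φ x
  taylor : ∀ x y, |φ (x + y) - φ x - y * φ' x| ≤ C * y ^ 2

section
variable {f : ℝ → ℝ} {L : ℝ} (hf : ∀ a b, |f a - f b| ≤ L * |a - b|)
  {σ h τ δ k M N B R C : ℝ} {μ : Measure ℝ} {w φ φ' : ℝ → ℝ}

theorem ent_midpoint_le (hδ : 0 < δ) (a b : ℝ) : ent δ ((a + b) / 2) ≤ (ent δ a + ent δ b) / 2 := by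
  have h1 := ent_add_sgnAvg_mul_le hδ ((a + b) / 2) a
  have h2 := ent_add_sgnAvg_mul_le hδ ((a + b) / 2) b
  nlinarith

include hf

theorem ent_stepOp_le (hδ : 0 < δ) (hσ : 0 ≤ σ) (hσL : σ * L ≤ 1) (x : ℝ) :
    ent δ (stepOp f σ h τ μ w x - k) ≤
      ent δ (w x - k) / 2 + (ent δ (w (x + h) - k) + ent δ (w (x + -h) - k)) / 4 -
      σ / 4 * (fluxAvg f δ k (w (x + h)) - fluxAvg f δ k (w (x + -h))) +
      τ * (sgnAvg δ (stepOp f σ h τ μ w x - k) * nonlocal μ w x) := by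
  set s := stepOp f σ h τ μ w x with hs
  have h1 := ent_add_sgnAvg_mul_le hδ (s - k) (s - k - τ * nonlocal μ w x)
  have h2 := ent_midpoint_le hδ ((w (x + h) - σ * f (w (x + h)) +
    (w (x + -h) + σ * f (w (x + -h)))) / 2 - k) (w x - k)
  have h3 := ent_laxFriedrichs_sub_le hf hδ hσ hσL k (w (x + h)) (w (x + -h))
  have e : s - k - τ * nonlocal μ w x = (((w (x + h) - σ * f (w (x + h)) +
    (w (x + -h) + σ * f (w (x + -h)))) / 2 - k) + (w x - k)) / 2 := by
    rw [hs, stepOp, ← sub_eq_add_neg]; ring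
  rw [e] at h1
  rw [show (((w (x + h) - σ * f (w (x + h)) +
    (w (x + -h) + σ * f (w (x + -h)))) / 2 - k) + (w x - k)) / 2 - (s - k) =
    - (τ * nonlocal μ w x) by rw [← e]; ring] at h1
  linarith

/-- The discrete entropy inequality for one step of the scheme. -/
theorem entInt_stepOp_sub_le [IsFiniteMeasure μ] (hL : 0 ≤ L) (hδ : 0 < δ) (hσ : 0 ≤ σ)
    (hσL : σ * L ≤ 1) (hτ : τ = h * σ / 2) (hτμ : τ * μ.real univ ≤ 1 / 2) (hh : 0 ≤ h)
    (hh1 : h ≤ 1) (hw : RegL1 M N B w) (hφ : TestFn R C φ φ') :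
    entInt δ k (stepOp f σ h τ μ w) φ - entInt δ k w φ ≤
      τ * ((∫ x, fluxAvg f δ k (w x) * φ' x) +
        ∫ x, sgnAvg δ (stepOp f σ h τ μ w x - k) * nonlocal μ w x * φ x) +
      h ^ 2 * (C * (M + |k| + δ) * (2 * (|R| + 1))) := by
  have hτ0 : 0 ≤ τ := by rw [hτ]; positivity
  have hμ := integrable_jump_finite μ
  have hS := (RegL1.stepOp (h := h) hf hσ hσL hτ0 hτμ hw)
  set A : ℝ → ℝ := fun x => ent δ (w x - k) with hA
  set Q : ℝ → ℝ := fun x => fluxAvg f δ k (w x) with hQ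
  set G : ℝ → ℝ := fun x => sgnAvg δ (stepOp f σ h τ μ w x - k) * nonlocal μ w x with hG
  have mA : Measurable A := measurable_ent_comp hδ hw.meas
  have mQ : Measurable Q := measurable_fluxAvg_comp hf hδ hw.meas
  have bA : ∀ x, |A x| ≤ M + |k| + δ := abs_ent_le hδ hw
  have bQ : ∀ x, |Q x| ≤ L * (M + |k| + δ) := abs_fluxAvg_le hf hL hδ hw
  have iG : Integrable G := (hw.mul_nonlocal hμ (measurable_sgnAvg_comp hδ hS.meas)
    fun _ => abs_sgnAvg_le_one hδ _).1
  have hab : |h| ≤ 1 := by rwa [abs_of_nonneg hh]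
  have hab' : |-h| ≤ 1 := by rwa [abs_neg]
  have c1 := hφ.cut.shift hab
  have c2 := hφ.cut.shift hab'
  have c0 := hφ.cut
  have c' := hφ.cut'
  have tr : ∀ (P : ℝ → ℝ) (a : ℝ), ∫ x, P (x + a) * φ x = ∫ x, P x * φ (x + -a) := fun P a => by
    rw [← integral_add_right_eq_self (μ := volume) (fun x => P x * φ (x + -a)) a]
    simp
  have i1 := c0.integrable_bdd_mul mA bA
  have i2 := c0.integrable_bdd_mul (mA.comp (measurable_add_const h)) fun x => bA _
  have i3 := c0.integrable_bdd_mul (mA.comp (measurable_add_const (-h))) fun x => bA _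
  have i4 := c0.integrable_bdd_mul (mQ.comp (measurable_add_const h)) fun x => bQ _
  have i5 := c0.integrable_bdd_mul (mQ.comp (measurable_add_const (-h))) fun x => bQ _
  have i6 := c0.integrable_mul iG.integrableOn
  simp only [Function.comp_apply] at i2 i3 i4 i5
  have main : entInt δ k (stepOp f σ h τ μ w) φ ≤
      (∫ x, A x * φ x) / 2 + ((∫ x, A (x + h) * φ x) + ∫ x, A (x + -h) * φ x) / 4
      - σ / 4 * ((∫ x, Q (x + h) * φ x) - ∫ x, Q (x + -h) * φ x) + τ * ∫ x, G x * φ x := by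
    have e : (∫ x, A x * φ x) / 2 + ((∫ x, A (x + h) * φ x) + ∫ x, A (x + -h) * φ x) / 4
        - σ / 4 * ((∫ x, Q (x + h) * φ x) - ∫ x, Q (x + -h) * φ x) + τ * ∫ x, G x * φ x =
        ∫ x, (A x * φ x / 2 + (A (x + h) * φ x + A (x + -h) * φ x) / 4
        - σ / 4 * (Q (x + h) * φ x - Q (x + -h) * φ x) + τ * (G x * φ x)) := by
      have j1 : Integrable fun x => A x * φ x / 2 := i1.div_const 2
      have j2 : Integrable fun x => (A (x + h) * φ x + A (x + -h) * φ x) / 4 :=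
        (i2.add i3).div_const 4
      have j3 : Integrable fun x => σ / 4 * (Q (x + h) * φ x - Q (x + -h) * φ x) :=
        (i4.sub i5).const_mul _
      have j12 : Integrable fun x => A x * φ x / 2 +
        (A (x + h) * φ x + A (x + -h) * φ x) / 4 := j1.add j2
      have j123 : Integrable fun x => A x * φ x / 2 +
        (A (x + h) * φ x + A (x + -h) * φ x) / 4 -
        σ / 4 * (Q (x + h) * φ x - Q (x + -h) * φ x) := j12.sub j3
      rw [integral_add j123 (i6.const_mul τ), integral_sub j12 j3, integral_add j1 j2,
        integral_div, integral_div, integral_add i2 i3, integral_const_mul, integral_sub i4 i5,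
        integral_const_mul]
    rw [e]
    refine integral_mono (integrable_ent_mul hδ hS c0)
      ((((i1.div_const 2).add ((i2.add i3).div_const 4)).sub ((i4.sub i5).const_mul _)).add
        (i6.const_mul τ)) fun x => ?_
    have := mul_le_mul_of_nonneg_right (ent_stepOp_le (w := w) (h := h) (τ := τ) (μ := μ)
      (k := k) hf hδ hσ hσL x) (hφ.nonneg x)
    refine this.trans_eq ?_
    simp only [hA, hQ, hG]
    ring
  rw [tr A h, tr A (-h), tr Q h, tr Q (-h), neg_neg] at main
  have a1 := c1.integrable_bdd_mul mA bA
  have a2 := c2.integrable_bdd_mul mA bA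
  have q1 := c1.integrable_bdd_mul mQ bQ
  have q2 := c2.integrable_bdd_mul mQ bQ
  have q3 := c'.integrable_bdd_mul mQ bQ
  have hC := c0.nonneg
  have cR : R ≤ |R| + 1 := by linarith [le_abs_self R]
  have d2 : Cutoff (|R| + 1) (2 * C * h ^ 2) fun x => φ (x + h) + φ (x + -h) - 2 * φ x := by
    refine ⟨(c1.meas.add c2.meas).sub (c0.meas.const_mul 2), fun x => ?_, fun x hx => ?_⟩
    · have t1 := abs_le.1 (hφ.taylor x h)
      have t2 := abs_le.1 (hφ.taylor x (-h))
      rw [abs_le]; constructor <;> nlinarith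
    · have s1 := c1.supp x hx
      have s2 := c2.supp x hx
      have s3 := (c0.mono_radius cR).supp x hx
      simp only [s1, s2, s3]; ring
  have d1 : Cutoff (|R| + 1) (2 * C * h ^ 2) fun x => φ (x + h) - φ (x + -h) - 2 * h * φ' x := by
    refine ⟨(c1.meas.sub c2.meas).sub (c'.meas.const_mul (2 * h)), fun x => ?_, fun x hx => ?_⟩
    · have t1 := abs_le.1 (hφ.taylor x h)
      have t2 := abs_le.1 (hφ.taylor x (-h))
      rw [abs_le]; constructor <;> nlinarith
    · have s1 := c1.supp x hx
      have s2 := c2.supp x hx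
      have s3 := (c'.mono_radius cR).supp x hx
      simp only [s1, s2, s3]; ring
  have b2 := (abs_le.1 (d2.abs_integral_bdd_mul_le mA bA)).2
  have b1 := (abs_le.1 (d1.abs_integral_bdd_mul_le mQ bQ)).2
  have e2 : ∫ x, A x * (φ (x + h) + φ (x + -h) - 2 * φ x) =
      (∫ x, A x * φ (x + h)) + (∫ x, A x * φ (x + -h)) - 2 * ∫ x, A x * φ x := by
    have j : Integrable fun x => A x * φ (x + h) + A x * φ (x + -h) := a1.add a2
    rw [← integral_add a1 a2, ← integral_const_mul, ← integral_sub j (i1.const_mul 2)]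
    congr 1; ext x; ring
  have e1 : ∫ x, Q x * (φ (x + h) - φ (x + -h) - 2 * h * φ' x) =
      (∫ x, Q x * φ (x + h)) - (∫ x, Q x * φ (x + -h)) - 2 * h * ∫ x, Q x * φ' x := by
    have j : Integrable fun x => Q x * φ (x + h) - Q x * φ (x + -h) := q1.sub q2
    rw [← integral_sub q1 q2, ← integral_const_mul, ← integral_sub j (q3.const_mul (2 * h))]
    congr 1; ext x; ring
  rw [e2] at b2
  rw [e1] at b1
  have b1' := mul_le_mul_of_nonneg_left b1 hσ
  have hE : entInt δ k w φ = ∫ x, A x * φ x := rfl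
  rw [hE]
  rw [abs_of_nonneg (by positivity : 0 ≤ |R| + 1)] at b1' b2
  have hMk : 0 ≤ M + |k| + δ := by have := hw.nonneg_M; positivity
  have hx : σ * (2 * C * h ^ 2 * (L * (M + |k| + δ) * (2 * (|R| + 1)))) ≤
      2 * C * h ^ 2 * ((M + |k| + δ) * (2 * (|R| + 1))) := by
    calc _ = σ * L * (2 * C * h ^ 2 * ((M + |k| + δ) * (2 * (|R| + 1)))) := by ring
      _ ≤ 1 * (2 * C * h ^ 2 * ((M + |k| + δ) * (2 * (|R| + 1)))) := by gcongr
      _ = _ := one_mul _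
  have hb := b1'.trans hx
  have : τ * ((∫ x, Q x * φ' x) + ∫ x, G x * φ x) =
      h * σ / 2 * (∫ x, Q x * φ' x) + τ * ∫ x, G x * φ x := by rw [mul_add, hτ]
  rw [this]
  nlinarith

/-- Comparison of the production of one step of the scheme with the production of a nearby
reference state. -/
theorem exists_step_production_le {ν : Measure ℝ} [SFinite ν]
    (hν : Integrable (fun z : ℝ => min 1 |z|) ν) (hL : 0 ≤ L)
    (hδ : 0 < δ) (M N B R : ℝ) (hC : 0 ≤ C) {ε : ℝ} (hε : 0 < ε) :
    ∃ K ≥ 0, ∀ k r v w w₀ φ φ', RegL1 M N B v → RegL1 M N B w → RegL1 M N B w₀ →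
      TestFn R C φ φ' →
      (∫ x, fluxAvg f δ k (w x) * φ' x) +
        ∫ x, sgnAvg δ (v x - k) * nonlocal (ν.restrict {z | r < |z|}) w x * φ x ≤
      prodInt ν f δ k w₀ φ' φ + ε + K * ((∫ x, |w x - w₀ x|) + ∫ x, |v x - w₀ x|) +
        C * ((B + 2 * N) * ∫ z, min 1 |z| ∂(ν.restrict {z | r < |z|}ᶜ)) := by
  obtain ⟨K, hK, R₁, H⟩ := exists_production_modulus hν M N B R (inv_nonneg.2 hδ.le)
    (ε := ε / (C + 1)) (by positivity)
  refine ⟨C * (K + L), by positivity, fun k r v w w₀ φ φ' hv hw hw₀ hφ => ?_⟩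
  set μ := ν.restrict {z | r < |z|}
  set ρ := ν.restrict {z | r < |z|}ᶜ
  have hμ : Integrable (fun z : ℝ => min 1 |z|) μ := hν.restrict
  have hρ : Integrable (fun z : ℝ => min 1 |z|) ρ := hν.restrict
  have i1 := integrableOn_fluxAvg (k := k) (R := R) hf hL hδ hw
  have i2 := integrableOn_fluxAvg (k := k) (R := R) hf hL hδ hw₀
  have jμ := integrable_sgnAvg_mul_nonlocal (k := k) hμ hδ hw hv
  have jν := integrable_sgnAvg_mul_nonlocal (k := k) hν hδ hw hv
  have jρ := integrable_sgnAvg_mul_nonlocal (k := k) hρ hδ hw hv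
  have j₀ := integrable_sgnAvg_mul_nonlocal (k := k) hν hδ hw₀ hw₀
  have c := hφ.cut
  have c' := hφ.cut'
  have i12 : IntegrableOn (fun x => fluxAvg f δ k (w x) - fluxAvg f δ k (w₀ x)) (Icc (-R) R) :=
    i1.sub i2
  have jj : IntegrableOn (fun x => sgnAvg δ (v x - k) * nonlocal ν w x -
    sgnAvg δ (w₀ x - k) * nonlocal ν w₀ x) (Icc (-R) R) := (jν.sub j₀).integrableOn
  have e1 := (abs_le.1 (c'.abs_integral_mul_le i12)).2
  have e2 := (abs_le.1 (c.abs_integral_mul_le jj)).2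
  have e3 := (abs_le.1 (c.abs_integral_mul_le jρ.integrableOn)).1
  have f1 : ∫ x in Icc (-R) R, |fluxAvg f δ k (w x) - fluxAvg f δ k (w₀ x)| ≤
      L * ∫ x, |w x - w₀ x| := by
    refine le_trans ?_ (mul_le_mul_of_nonneg_left (setIntegral_Icc_le (R := R) (hw.sub hw₀).int) hL)
    rw [← integral_const_mul]
    exact integral_mono i12.abs ((hw.sub hw₀).int.abs.const_mul L).integrableOn
      fun x => abs_fluxAvg_sub_le hf hδ k _ _
  have f2 := H (fun a => sgnAvg δ (a - k)) (fun a b => by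
    have := abs_sgnAvg_sub_le hδ (a - k) (b - k)
    rwa [show a - k - (b - k) = a - b by ring] at this) (fun a => abs_sgnAvg_le_one hδ _)
    v w₀ w w₀ hv hw₀ hw hw₀
  have f3 : ∫ x in Icc (-R) R, |sgnAvg δ (v x - k) * nonlocal ρ w x| ≤
      (B + 2 * N) * ∫ z, min 1 |z| ∂ρ := by
    refine (setIntegral_Icc_le jρ).trans ((integral_mono jρ.abs (hw.nonlocal_int hρ).abs
      fun x => ?_).trans (hw.nonlocal_norm hρ))
    simp only [abs_mul]
    exact mul_le_of_le_one_left (abs_nonneg _) (abs_sgnAvg_le_one hδ _)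
  have g1 := setIntegral_Icc_le (R := R₁) (hw.sub hw₀).int
  have g2 := setIntegral_Icc_le (R := R₁) (hv.sub hw₀).int
  have key : (∫ x, fluxAvg f δ k (w x) * φ' x) +
        (∫ x, sgnAvg δ (v x - k) * nonlocal μ w x * φ x) - prodInt ν f δ k w₀ φ' φ =
      (∫ x, (fluxAvg f δ k (w x) - fluxAvg f δ k (w₀ x)) * φ' x) +
      (∫ x, (sgnAvg δ (v x - k) * nonlocal ν w x -
        sgnAvg δ (w₀ x - k) * nonlocal ν w₀ x) * φ x) -
      ∫ x, sgnAvg δ (v x - k) * nonlocal ρ w x * φ x := by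
    have hsp : ∫ x, sgnAvg δ (v x - k) * nonlocal μ w x * φ x =
        (∫ x, sgnAvg δ (v x - k) * nonlocal ν w x * φ x) -
        ∫ x, sgnAvg δ (v x - k) * nonlocal ρ w x * φ x := by
      rw [← integral_sub (c.integrable_mul jν.integrableOn) (c.integrable_mul jρ.integrableOn)]
      refine integral_congr_ae ?_
      filter_upwards [hw.nonlocal_split hν (measurableSet_jump r)] with x hx
      rw [hx]; ring
    have hp : prodInt ν f δ k w₀ φ' φ = (∫ x, fluxAvg f δ k (w₀ x) * φ' x) +
        ∫ x, sgnAvg δ (w₀ x - k) * nonlocal ν w₀ x * φ x :=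
      integral_add (c'.integrable_mul i2) (c.integrable_mul j₀.integrableOn)
    simp only [sub_mul]
    rw [integral_sub (c'.integrable_mul i1) (c'.integrable_mul i2),
      integral_sub (c.integrable_mul jν.integrableOn) (c.integrable_mul j₀.integrableOn), hsp, hp]
    ring
  have h1 := mul_le_mul_of_nonneg_left f1 hC
  have h2 := mul_le_mul_of_nonneg_left (f2.trans (add_le_add_right
    (mul_le_mul_of_nonneg_left (add_le_add g1 g2) hK) _)) hC
  have h3 := mul_le_mul_of_nonneg_left f3 hC
  have h4 : C * (ε / (C + 1)) ≤ ε := by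
    rw [mul_div_assoc', div_le_iff₀ (by positivity)]; nlinarith
  have hJ : 0 ≤ C * L * ∫ x, |v x - w₀ x| :=
    mul_nonneg (mul_nonneg hC hL) (integral_nonneg fun _ => abs_nonneg _)
  nlinarith

end

theorem sub_le_of_step_le {a : ℕ → ℝ} {X : ℝ} {i : ℕ} :
    ∀ m, (∀ j, j < m → a (i + j + 1) - a (i + j) ≤ X) → a (i + m) - a i ≤ m * X
  | 0, _ => by simp
  | m + 1, h => by
    have h1 := sub_le_of_step_le m fun j hj => h j (hj.trans m.lt_succ_self)
    have h2 := h m m.lt_succ_self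
    push_cast
    rw [← add_assoc]
    linarith

theorem tendsto_small_jumps_seq {ν : Measure ℝ} (hν : Integrable (fun z : ℝ => min 1 |z|) ν) :
    Tendsto (fun n : ℕ => ∫ z, min 1 |z| ∂(ν.restrict {z | 1 / ((n : ℝ) + 1) < |z|}ᶜ)) atTop
      (𝓝 0) := by
  have h1 : Tendsto (fun n : ℕ => 1 / ((n : ℝ) + 1)) atTop (𝓝[>] 0) :=
    tendsto_nhdsWithin_iff.2 ⟨tendsto_one_div_add_atTop_nhds_zero_nat,
      Eventually.of_forall fun n => by rw [mem_Ioi]; positivity⟩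
  refine ((tendsto_small_jumps hν).comp h1).congr fun n => ?_
  have h2 : {z : ℝ | 1 / ((n : ℝ) + 1) < |z|}ᶜ = {z : ℝ | |z| ≤ 1 / ((n : ℝ) + 1)} := by
    ext z; simp
  rw [Function.comp, integral_indicator (h2 ▸ (measurableSet_jump _).compl), h2]

section
variable {f : ℝ → ℝ} {L : ℝ} (hf : ∀ a b, |f a - f b| ≤ L * |a - b|)
  {σ h τ : ℝ} {μ : Measure ℝ} {M N B : ℝ} {w : ℝ → ℝ}
  [IsFiniteMeasure μ] (hσ : 0 ≤ σ) (hσL : σ * L ≤ 1) (hτ : 0 ≤ τ)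
  (hτμ : τ * μ.real univ ≤ 1 / 2)
include hf hσ hσL hτ hτμ

theorem RegL1.stepOp_iterate (hw : RegL1 M N B w) (j : ℕ) :
    RegL1 M N B ((_root_.stepOp f σ h τ μ)^[j] w) := by
  induction j with
  | zero => exact hw
  | succ j ih =>
    rw [Function.iterate_succ_apply']
    exact ih.stepOp hf hσ hσL hτ hτμ

theorem integral_abs_iterate_sub_le (hw : RegL1 M N B w) {D : ℝ}
    (hD : ∀ v, RegL1 M N B v → ∫ x, |stepOp f σ h τ μ v x - v x| ≤ D) (i j : ℕ) :
    ∫ x, |(stepOp f σ h τ μ)^[i + j] w x - (stepOp f σ h τ μ)^[i] w x| ≤ j * D := by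
  have hR := RegL1.stepOp_iterate (h := h) hf hσ hσL hτ hτμ hw
  induction j with
  | zero => simp
  | succ j ih =>
    have h1 := hD _ (hR (i + j))
    rw [← Function.iterate_succ_apply' (f := stepOp f σ h τ μ)] at h1
    push_cast
    refine (integral_mono ((hR _).int.sub (hR _).int).abs
      (((hR (i + j + 1)).int.sub (hR (i + j)).int).abs.add
        ((hR (i + j)).int.sub (hR i).int).abs) fun x => abs_sub_le _ _ _).trans ?_
    rw [integral_add' ((hR (i + j + 1)).int.sub (hR (i + j)).int).abs
        ((hR (i + j)).int.sub (hR i).int).abs]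
    simp only [Pi.sub_apply]
    linarith

end

/-- Uniformly regular approximate solutions, with an approximate entropy inequality. -/
theorem exists_approximations {f : ℝ → ℝ} {L : ℝ} (hf : ∀ a b, |f a - f b| ≤ L * |a - b|)
    (hL : 0 ≤ L) {ν : Measure ℝ} [SFinite ν] (hν : Integrable (fun z : ℝ => min 1 |z|) ν)
    {M N B : ℝ} {u₀ : ℝ → ℝ} (hu : RegL1 M N B u₀) :
    ∃ C₀ ≥ 0, ∃ (τ : ℕ → ℝ) (u : ℕ → ℝ → ℝ → ℝ), (∀ n, 0 < τ n) ∧ Tendsto τ atTop (𝓝 0) ∧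
      (∀ n t, RegL1 M N B (u n t)) ∧
      (∀ n s t, 0 ≤ s → s ≤ t → ∫ x, |u n t x - u n s x| ≤ C₀ * (t - s + τ n)) ∧
      (∀ n, u n 0 = u₀) ∧
      ∀ δ > 0, ∀ k R C ε : ℝ, 0 ≤ C → 0 < ε → ∃ K ≥ 0, ∀ᶠ n in atTop, ∀ φ φ',
        TestFn R C φ φ' → ∀ s t, 0 ≤ s → s ≤ t → ∃ m ≥ 0, |m - (t - s)| ≤ τ n ∧
          entInt δ k (u n t) φ - entInt δ k (u n s) φ ≤
            m * (prodInt ν f δ k (u n s) φ' φ + ε + K * (t - s)) := by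
  set I := ∫ z, min 1 |z| ∂ν with hI
  have hI0 : 0 ≤ I := integral_nonneg fun z => le_min zero_le_one (abs_nonneg z)
  have hM := hu.nonneg_M
  have hN := hu.nonneg_N
  have hB := hu.nonneg_B
  let r : ℕ → ℝ := fun n => 1 / ((n : ℝ) + 1)
  have hr : ∀ n, 0 < r n := fun n => by positivity
  let μ : ℕ → Measure ℝ := fun n => ν.restrict {z | r n < |z|}
  have hμ : ∀ n, IsFiniteMeasure (μ n) := fun n =>
    ⟨by rw [Measure.restrict_apply_univ]; exact measure_jump_lt_top hν (hr n)⟩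
  let σ : ℝ := 1 / (L + 1)
  have hσ : 0 < σ := by positivity
  have hσL : σ * L ≤ 1 := by
    change 1 / (L + 1) * L ≤ 1
    rw [one_div_mul_eq_div, div_le_one (by positivity)]; linarith
  have hσ1 : σ ≤ 1 := by
    change 1 / (L + 1) ≤ 1
    rw [div_le_one (by positivity)]; linarith
  let h : ℕ → ℝ := fun n => 1 / (((n : ℝ) + 1) * (1 + (μ n).real univ))
  have hh : ∀ n, 0 < h n := fun n => by positivity
  have hh1 : ∀ n, h n ≤ r n := fun n => by
    apply one_div_le_one_div_of_le (by positivity)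
    nlinarith [measureReal_nonneg (μ := μ n) (s := univ), (Nat.cast_nonneg n : (0 : ℝ) ≤ n)]
  have hr1 : ∀ n, r n ≤ 1 := fun n => by
    change 1 / ((n : ℝ) + 1) ≤ 1
    rw [div_le_one (by positivity)]; linarith [(Nat.cast_nonneg n : (0 : ℝ) ≤ n)]
  let τ : ℕ → ℝ := fun n => h n * σ / 2
  have hτ : ∀ n, 0 < τ n := fun n => by positivity
  have hhτ : ∀ n, h n = 2 * (L + 1) * τ n := fun n => by
    change h n = 2 * (L + 1) * (h n * (1 / (L + 1)) / 2)
    field_simp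
  have hτμ : ∀ n, τ n * (μ n).real univ ≤ 1 / 2 := fun n => by
    have h1 : h n * (μ n).real univ ≤ 1 := by
      change 1 / (((n : ℝ) + 1) * (1 + (μ n).real univ)) * (μ n).real univ ≤ 1
      rw [one_div_mul_eq_div, div_le_one (by positivity)]
      nlinarith [measureReal_nonneg (μ := μ n) (s := univ), (Nat.cast_nonneg n : (0 : ℝ) ≤ n)]
    have h2 : τ n * (μ n).real univ = σ * (h n * (μ n).real univ) / 2 := by
      change h n * σ / 2 * _ = _; ring
    rw [h2]
    nlinarith [mul_le_mul hσ1 h1 (by positivity) zero_le_one]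
  have hτ0 : Tendsto τ atTop (𝓝 0) := by
    refine squeeze_zero (fun n => (hτ n).le) (fun n => ?_) tendsto_one_div_add_atTop_nhds_zero_nat
    change h n * σ / 2 ≤ r n
    nlinarith [hh1 n, hh n, hσ1]
  let S : ℕ → (ℝ → ℝ) → ℝ → ℝ := fun n => stepOp f σ (h n) (τ n) (μ n)
  let W : ℕ → ℕ → ℝ → ℝ := fun n j => (S n)^[j] u₀
  have hW : ∀ n j, RegL1 M N B (W n j) := fun n j =>
    RegL1.stepOp_iterate hf hσ.le hσL (hτ n).le (hτμ n) hu j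
  set C₀ := 2 * B * (L + 1) + (B + 2 * N) * I with hC₀
  have hC₀0 : 0 ≤ C₀ := by positivity
  have hstep : ∀ n v, RegL1 M N B v → ∫ x, |S n v x - v x| ≤ C₀ * τ n := fun n v hv => by
    refine (integral_abs_stepOp_sub_self_le hf hσ.le hσL (hτ n).le (hτμ n) (hh n).le hv).trans ?_
    have h1 : ∫ z, min 1 |z| ∂(μ n) ≤ I :=
      setIntegral_le_integral hν (Eventually.of_forall fun z => le_min zero_le_one (abs_nonneg z))
    have h2 : (B + 2 * N) * ∫ z, min 1 |z| ∂(μ n) ≤ (B + 2 * N) * I := by gcongr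
    rw [hhτ n, hC₀]
    nlinarith [mul_le_mul_of_nonneg_left h2 (hτ n).le]
  have hWW : ∀ n i j, ∫ x, |W n (i + j) x - W n i x| ≤ C₀ * (j * τ n) := fun n i j => by
    refine (integral_abs_iterate_sub_le hf hσ.le hσL (hτ n).le (hτμ n) hu (hstep n) i j).trans_eq ?_
    ring
  have hfl : ∀ n s t, 0 ≤ s → s ≤ t → ∃ m : ℕ, ⌊t / τ n⌋₊ = ⌊s / τ n⌋₊ + m ∧
      |m * τ n - (t - s)| ≤ τ n := fun n s t hs hst => by
    have h1 : ⌊s / τ n⌋₊ ≤ ⌊t / τ n⌋₊ :=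
      Nat.floor_mono (div_le_div_of_nonneg_right hst (hτ n).le)
    obtain ⟨m, hm⟩ := Nat.exists_eq_add_of_le h1
    refine ⟨m, hm, ?_⟩
    have a1 := Nat.floor_le (div_nonneg hs (hτ n).le)
    have a2 := Nat.lt_floor_add_one (s / τ n)
    have a3 := Nat.floor_le (div_nonneg (hs.trans hst) (hτ n).le)
    have a4 := Nat.lt_floor_add_one (t / τ n)
    rw [hm] at a3 a4
    push_cast at a3 a4
    rw [le_div_iff₀ (hτ n)] at a1 a3
    rw [div_lt_iff₀ (hτ n)] at a2 a4
    rw [abs_le]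
    constructor <;> nlinarith
  refine ⟨C₀, hC₀0, τ, fun n t => W n ⌊t / τ n⌋₊, hτ, hτ0, fun n t => hW _ _,
    fun n s t hs hst => ?_, fun n => by simp [W], fun δ hδ k R C ε hC hε => ?_⟩
  · obtain ⟨m, hm, hm'⟩ := hfl n s t hs hst
    beta_reduce
    rw [hm]
    refine (hWW n _ m).trans (mul_le_mul_of_nonneg_left ?_ hC₀0)
    linarith [(abs_le.1 hm').2]
  · obtain ⟨K, hK, H⟩ := exists_step_production_le hf hν hL hδ M N B R hC (half_pos hε)
    set J : ℕ → ℝ := fun n => ∫ z, min 1 |z| ∂(ν.restrict {z | r n < |z|}ᶜ) with hJ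
    set D := C * (M + |k| + δ) * (2 * (|R| + 1)) with hD
    have hsmall : Tendsto (fun n => C * ((B + 2 * N) * J n) +
        (2 * (L + 1)) ^ 2 * D * τ n + 2 * K * C₀ * τ n) atTop (𝓝 0) := by
      have e1 := ((tendsto_small_jumps_seq hν).const_mul (B + 2 * N)).const_mul C
      have := (e1.add (hτ0.const_mul ((2 * (L + 1)) ^ 2 * D))).add (hτ0.const_mul (2 * K * C₀))
      simp only [mul_zero, add_zero] at this
      exact this
    refine ⟨2 * K * C₀, by positivity, ?_⟩
    filter_upwards [hsmall.eventually (gt_mem_nhds (half_pos hε))] with n hn φ φ' hφ s t hs hst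
    obtain ⟨m, hm, hm'⟩ := hfl n s t hs hst
    refine ⟨m * τ n, mul_nonneg (Nat.cast_nonneg m) (hτ n).le, hm', ?_⟩
    rw [hm]
    set i := ⌊s / τ n⌋₊
    have key := sub_le_of_step_le (a := fun j => entInt δ k (W n j) φ) (i := i)
      (X := τ n * (prodInt ν f δ k (W n i) φ' φ + ε + 2 * K * C₀ * (t - s))) m fun j hj => ?_
    · refine key.trans_eq ?_
      ring
    have h1 : W n (i + j + 1) = S n (W n (i + j)) := Function.iterate_succ_apply' _ _ _
    have s1 := entInt_stepOp_sub_le (k := k) hf hL hδ hσ.le hσL (rfl : τ n = h n * σ / 2) (hτμ n)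
      (hh n).le ((hh1 n).trans (hr1 n)) (hW n (i + j)) hφ
    have s2 := H k (r n) (S n (W n (i + j))) (W n (i + j)) (W n i) φ φ'
      (h1 ▸ hW n (i + j + 1)) (hW _ _) (hW _ _) hφ
    have s3 := hWW n i j
    have s4 := hWW n i (j + 1)
    have h1' : W n (i + (j + 1)) = S n (W n (i + j)) := h1
    rw [h1'] at s4
    have s5 : ((j + 1 : ℕ) : ℝ) * τ n ≤ t - s + τ n := by
      have : ((j + 1 : ℕ) : ℝ) ≤ m := by exact_mod_cast hj
      linarith [(abs_le.1 hm').2, mul_le_mul_of_nonneg_right this (hτ n).le]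
    have s6 : (j : ℝ) * τ n ≤ t - s + τ n := by
      refine le_trans ?_ s5
      push_cast
      linarith [hτ n, add_mul (j : ℝ) 1 (τ n)]
    have s7 : K * ((∫ x, |W n (i + j) x - W n i x|) + ∫ x, |S n (W n (i + j)) x - W n i x|) ≤
        K * (C₀ * (t - s + τ n) + C₀ * (t - s + τ n)) :=
      mul_le_mul_of_nonneg_left (add_le_add (s3.trans (mul_le_mul_of_nonneg_left s6 hC₀0))
        (s4.trans (mul_le_mul_of_nonneg_left s5 hC₀0))) hK
    have s8 : h n ^ 2 * D = τ n * ((2 * (L + 1)) ^ 2 * D * τ n) := by rw [hhτ n]; ring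
    rw [s8] at s1
    rw [h1]
    refine s1.trans ?_
    rw [← mul_add]
    refine mul_le_mul_of_nonneg_left ?_ (hτ n).le
    linarith

/-- The moving average `a⁻¹ ∫ w` over `[x, x + a]`. -/
noncomputable def movAvg (a : ℝ) (w : ℝ → ℝ) (x : ℝ) : ℝ := a⁻¹ * ∫ s in x..x + a, w s

section
variable {M N B a : ℝ} {w : ℝ → ℝ}

theorem RegL1.movAvg_sub_self (hw : RegL1 M N B w) (ha : 0 < a) (x : ℝ) :
    movAvg a w x - w x = a⁻¹ * nonlocal (volume.restrict (Ioc 0 a)) w x := by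
  have h1 : nonlocal (volume.restrict (Ioc 0 a)) w x = (∫ s in x..x + a, w s) - a * w x := by
    unfold nonlocal
    rw [← intervalIntegral.integral_of_le ha.le, intervalIntegral.integral_sub
      ((hw.int.comp_add_left x).intervalIntegrable) intervalIntegrable_const,
      intervalIntegral.integral_comp_add_left]
    simp
  rw [h1, movAvg]
  field_simp

theorem RegL1.integral_abs_movAvg_sub_le (hw : RegL1 M N B w) (ha : 0 < a) :
    ∫ x, |movAvg a w x - w x| ≤ B * a := by
  have hf : IsFiniteMeasure (volume.restrict (Ioc 0 a) : Measure ℝ) := inferInstance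
  have h0 := integrable_jump_finite (volume.restrict (Ioc 0 a))
  have h1 := (hw.mul_nonlocal h0 (s := fun _ => 1) measurable_const (C := 1) (by simp)).2
  simp only [one_mul, abs_one] at h1
  have h2 : ∫ z in Ioc 0 a, (∫ x, |w (x + z) - w x|) ≤ B * a * a := by
    refine (Real.le_norm_self _).trans ((norm_setIntegral_le_of_norm_le_const (C := B * a)
      (by simp) fun z hz => ?_).trans_eq (by simp [Measure.real, ha.le]))
    rw [Real.norm_of_nonneg (integral_nonneg fun _ => abs_nonneg _)]
    refine (hw.trans z).trans (mul_le_mul_of_nonneg_left ?_ hw.nonneg_B)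
    rw [abs_of_pos hz.1]; exact hz.2
  calc ∫ x, |movAvg a w x - w x|
      = a⁻¹ * ∫ x, |nonlocal (volume.restrict (Ioc 0 a)) w x| := by
        rw [← integral_const_mul]
        refine integral_congr_ae (Eventually.of_forall fun x => ?_)
        beta_reduce
        rw [hw.movAvg_sub_self ha, abs_mul, abs_of_pos (inv_pos.2 ha)]
    _ ≤ a⁻¹ * (B * a * a) := by gcongr; exact h1.trans h2
    _ = B * a := by field_simp

theorem RegL1.abs_movAvg_le (hw : RegL1 M N B w) (ha : 0 < a) (x : ℝ) : |movAvg a w x| ≤ M := by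
  have := intervalIntegral.norm_integral_le_of_norm_le_const (a := x) (b := x + a)
    (f := w) (C := M) fun s _ => hw.bdd s
  rw [movAvg, abs_mul, abs_of_pos (inv_pos.2 ha)]
  rw [Real.norm_eq_abs, add_sub_cancel_left, abs_of_pos ha] at this
  calc a⁻¹ * |∫ s in x..x + a, w s| ≤ a⁻¹ * (M * a) := by gcongr
    _ = M := by field_simp

theorem RegL1.exists_movAvg_dominating (hw : RegL1 M N B w) (ha : 0 < a) :
    ∃ V : ℝ → ℝ, Monotone V ∧ (∀ x, 0 ≤ V x ∧ V x ≤ B) ∧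
      ∀ x y, x ≤ y → |movAvg a w y - movAvg a w x| ≤ V y - V x := by
  have hd := (hw.incr_int a).abs
  have hsub : ∀ x y, x ≤ y → a⁻¹ * (∫ s in Iic y, |w (s + a) - w s|) -
      a⁻¹ * (∫ s in Iic x, |w (s + a) - w s|) = a⁻¹ * ∫ s in x..y, |w (s + a) - w s| :=
    fun x y _ => by
      rw [← intervalIntegral.integral_Iic_sub_Iic hd.integrableOn hd.integrableOn]; ring
  have hkey : ∀ x y, x ≤ y → |movAvg a w y - movAvg a w x| ≤
      a⁻¹ * ∫ s in x..y, |w (s + a) - w s| := fun x y hxy => by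
    have ii : ∀ p q, IntervalIntegrable w volume p q := fun p q => hw.int.intervalIntegrable
    have e : (∫ s in y..y + a, w s) - ∫ s in x..x + a, w s =
        ∫ s in x..y, (w (s + a) - w s) := by
      rw [intervalIntegral.integral_sub (hw.int.comp_add_right a).intervalIntegrable (ii _ _),
        intervalIntegral.integral_comp_add_right]
      have e1 := intervalIntegral.integral_add_adjacent_intervals (ii x y) (ii y (y + a))
      have e2 := intervalIntegral.integral_add_adjacent_intervals (ii x (x + a))
        (ii (x + a) (y + a))
      linarith
    rw [movAvg, movAvg, ← mul_sub, e, abs_mul, abs_of_pos (inv_pos.2 ha)]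
    gcongr
    exact intervalIntegral.abs_integral_le_integral_abs hxy
  have hpos : ∀ x y, x ≤ y → 0 ≤ a⁻¹ * ∫ s in x..y, |w (s + a) - w s| := fun x y hxy =>
    mul_nonneg (inv_nonneg.2 ha.le) (intervalIntegral.integral_nonneg hxy fun _ _ => abs_nonneg _)
  refine ⟨fun x => a⁻¹ * ∫ s in Iic x, |w (s + a) - w s|, fun x y hxy => ?_, fun x => ⟨?_, ?_⟩,
    fun x y hxy => ?_⟩
  · linarith [hsub x y hxy, hpos x y hxy]
  · exact mul_nonneg (inv_nonneg.2 ha.le) (integral_nonneg fun _ => abs_nonneg _)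
  · calc a⁻¹ * ∫ s in Iic x, |w (s + a) - w s| ≤ a⁻¹ * (B * |a|) := by
          gcongr
          exact (setIntegral_le_integral hd (Eventually.of_forall fun _ => abs_nonneg _)).trans
            (hw.trans a)
      _ = B := by rw [abs_of_pos ha]; field_simp
  · rw [hsub x y hxy]; exact hkey x y hxy

theorem eVariationOn_le_of_dominating {w V : ℝ → ℝ} (hb : ∀ x, 0 ≤ V x ∧ V x ≤ B)
    (h : ∀ x y, x ≤ y → |w y - w x| ≤ V y - V x) :
    eVariationOn w univ ≤ ENNReal.ofReal B := by
  refine iSup_le fun ⟨n, u, hu, _⟩ => ?_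
  calc ∑ i ∈ Finset.range n, edist (w (u (i + 1))) (w (u i))
      ≤ ∑ i ∈ Finset.range n, ENNReal.ofReal (V (u (i + 1)) - V (u i)) := by
        refine Finset.sum_le_sum fun i _ => ?_
        rw [edist_dist, Real.dist_eq]
        exact ENNReal.ofReal_le_ofReal (h _ _ (hu i.le_succ))
    _ = ENNReal.ofReal (∑ i ∈ Finset.range n, (V (u (i + 1)) - V (u i))) :=
        (ENNReal.ofReal_sum_of_nonneg fun i _ =>
          (abs_nonneg _).trans (h _ _ (hu i.le_succ))).symm
    _ ≤ ENNReal.ofReal B := by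
        rw [Finset.sum_range_sub fun i => V (u i)]
        exact ENNReal.ofReal_le_ofReal (by linarith [(hb (u n)).2, (hb (u 0)).1])

end

/-- Quantitative sampling estimate for functions of bounded variation. -/
theorem setIntegral_abs_le_sampling {d V : ℝ → ℝ} {B : ℝ} (hV : Monotone V)
    (hb : ∀ x, 0 ≤ V x ∧ V x ≤ B) (h : ∀ x y, x ≤ y → |d y - d x| ≤ V y - V x)
    (hd : Measurable d) {R : ℝ} (hR : 0 ≤ R) {ε : ℝ} (hε : 0 < ε) {J : ℕ} (hJ : R / ε + 1 ≤ J) :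
    ∫ x in Icc (-R) R, |d x| ≤
      2 * R * (∑ j ∈ Finset.Icc (-(J : ℤ)) J, |d (j * ε)|) + B * ε := by
  have ht := integrable_monotone_translate_sub hV hb hε.le
  have ht1 : Integrable (fun x => V x - V (x - ε)) := by
    simpa using ht.1.comp_sub_right ε
  have ht2 : ∫ x, (V x - V (x - ε)) ≤ B * ε := by
    rw [← integral_sub_right_eq_self (fun x => V (x + ε) - V x) ε] at ht
    simpa using ht.2
  set c := ∑ j ∈ Finset.Icc (-(J : ℤ)) J, |d (j * ε)| with hc
  have hpt : ∀ x ∈ Icc (-R) R, |d x| ≤ c + (V x - V (x - ε)) := fun x hx => by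
    set j := ⌊x / ε⌋ with hj
    have h1 : (j : ℝ) ≤ x / ε := Int.floor_le _
    have h2 : x / ε < j + 1 := Int.lt_floor_add_one _
    have h3 : (j : ℝ) * ε ≤ x := by rwa [le_div_iff₀ hε] at h1
    have h4 : x - ε ≤ j * ε := by rw [div_lt_iff₀ hε] at h2; linarith
    have h5 := h _ _ h3
    have h6 := hV h4
    have h7 : -(R / ε) ≤ x / ε := by rw [← neg_div]; gcongr; exact hx.1
    have h8 : x / ε ≤ R / ε := by gcongr; exact hx.2
    have hmem : j ∈ Finset.Icc (-(J : ℤ)) J := by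
      rw [Finset.mem_Icc]
      constructor
      · have : (-(J : ℝ)) ≤ j := by linarith
        exact_mod_cast this
      · have : (j : ℝ) ≤ J := by linarith
        exact_mod_cast this
    have h9 : |d (j * ε)| ≤ c :=
      Finset.single_le_sum (f := fun j : ℤ => |d (j * ε)|) (fun _ _ => abs_nonneg _) hmem
    have h10 := abs_sub_abs_le_abs_sub (d x) (d (j * ε))
    linarith
  have hdb : ∀ x, |d x| ≤ |d 0| + B := fun x => by
    have h0 := abs_sub_abs_le_abs_sub (d x) (d 0)
    rcases le_total x 0 with hx | hx
    · have := h _ _ hx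
      rw [abs_sub_comm] at this
      linarith [(hb 0).2, (hb x).1]
    · have := h _ _ hx
      linarith [(hb x).2, (hb 0).1]
  have hdi : IntegrableOn d (Icc (-R) R) := Cutoff.integrableOn_bdd hd hdb
  have hci : IntegrableOn (fun _ : ℝ => c) (Icc (-R) R) := integrableOn_const (by simp) (by simp)
  calc ∫ x in Icc (-R) R, |d x| ≤ ∫ x in Icc (-R) R, (c + (V x - V (x - ε))) :=
        setIntegral_mono_on hdi.abs (hci.add ht1.integrableOn) measurableSet_Icc hpt
    _ = 2 * R * c + ∫ x in Icc (-R) R, (V x - V (x - ε)) := by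
        rw [integral_add hci ht1.integrableOn, setIntegral_const]
        simp only [Measure.real, Real.volume_Icc, sub_neg_eq_add, smul_eq_mul]
        rw [ENNReal.toReal_ofReal (by linarith)]; ring
    _ ≤ 2 * R * c + B * ε := by
        gcongr
        refine (setIntegral_le_integral ht1 (Eventually.of_forall fun x => ?_)).trans ht2
        exact sub_nonneg.2 (hV (by linarith))

theorem integrable_of_setIntegral_Icc_le {w : ℝ → ℝ} {N M : ℝ} (hm : Measurable w)
    (hb : ∀ x, |w x| ≤ M) (h : ∀ R, ∫ x in Icc (-R) R, |w x| ≤ N) :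
    Integrable w ∧ ∫ x, |w x| ≤ N := by
  have hc : AECover (volume : Measure ℝ) atTop fun R : ℝ => Icc (-R) R :=
    aecover_Icc tendsto_neg_atTop_atBot tendsto_id
  have hi : Integrable w := hc.integrable_of_integral_norm_bounded N
    (fun R => Cutoff.integrableOn_bdd hm hb) (Eventually.of_forall h)
  exact ⟨hi, le_of_tendsto (hc.integral_tendsto_of_countably_generated hi.abs)
    (Eventually.of_forall h)⟩

/-- Helly-type compactness along an ultrafilter. -/
theorem exists_ultralimit {M N B : ℝ} {U : Ultrafilter ℕ} (hU : (U : Filter ℕ) ≤ atTop)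
    {w : ℕ → ℝ → ℝ} (hw : ∀ n, RegL1 M N B (w n)) :
    ∃ w', RegL1 M N B w' ∧ eVariationOn w' univ ≤ ENNReal.ofReal B ∧
      ∀ R, Tendsto (fun n => ∫ x in Icc (-R) R, |w n x - w' x|) U (𝓝 0) := by
  have hB := (hw 0).nonneg_B
  let a : ℕ → ℝ := fun n => 1 / ((n : ℝ) + 1)
  have ha : ∀ n, 0 < a n := fun n => by positivity
  let v : ℕ → ℝ → ℝ := fun n => movAvg (a n) (w n)
  have hvM : ∀ n x, |v n x| ≤ M := fun n x => (hw n).abs_movAvg_le (ha n) x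
  choose F hF hFb hFd using fun n => (hw n).exists_movAvg_dominating (ha n)
  have hvm : ∀ n, Measurable (v n) := fun n => measurable_of_monotone_dominating (hF n) (hFd n)
  have hlim : ∀ x, ∃ y ∈ Icc (-M) M, Tendsto (fun n => v n x) U (𝓝 y) := fun x => by
    have := isCompact_Icc.ultrafilter_le_nhds (U.map fun n => v n x) (by
      rw [le_principal_iff]
      exact (Eventually.of_forall fun n => abs_le.1 (hvM n x) :
        ∀ᶠ n in (U : Filter ℕ), v n x ∈ Icc (-M) M))
    exact this
  choose w' hw'M hw' using hlim
  have hvar : eVariationOn w' univ ≤ ENNReal.ofReal B := by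
    by_contra! hlt
    obtain ⟨n, hn⟩ := (eVariationOn.lowerSemicontinuous_aux (F := v) (p := (U : Filter ℕ))
      (fun x _ => hw' x) hlt).exists
    exact not_lt.2 (eVariationOn_le_of_dominating (hFb n) (hFd n)) hn
  obtain ⟨G, hG, hGb, hGd⟩ := exists_monotone_dominating hB hvar
  have hwm : Measurable w' := measurable_of_monotone_dominating hG hGd
  have hwb : ∀ x, |w' x| ≤ M := fun x => abs_le.2 (hw'M x)
  have hvw : ∀ R, Tendsto (fun n => ∫ x in Icc (-R) R, |v n x - w' x|) U (𝓝 0) := fun R => by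
    refine tendsto_order.2 ⟨fun b hb => Eventually.of_forall fun n =>
      hb.trans_le (integral_nonneg fun _ => abs_nonneg _), fun e he => ?_⟩
    set R₁ := max R 0
    have hR₁ : 0 ≤ R₁ := le_max_right _ _
    set ε := e / (2 * (2 * B + 1)) with hε
    have hε0 : 0 < ε := by positivity
    obtain ⟨J, hJ⟩ := exists_nat_ge (R₁ / ε + 1)
    have hs : Tendsto (fun n => 2 * R₁ * ∑ j ∈ Finset.Icc (-(J : ℤ)) J, |v n (j * ε) - w' (j * ε)|)
        U (𝓝 0) := by
      have : Tendsto (fun n => ∑ j ∈ Finset.Icc (-(J : ℤ)) J, |v n (j * ε) - w' (j * ε)|)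
          U (𝓝 (∑ j ∈ Finset.Icc (-(J : ℤ)) J, 0)) := tendsto_finsetSum _ fun j _ => by
        simpa using ((hw' (j * ε)).sub_const (w' (j * ε))).abs
      simpa using this.const_mul (2 * R₁)
    filter_upwards [hs.eventually (gt_mem_nhds (half_pos he))] with n hn
    have h1 := setIntegral_abs_le_sampling (d := fun x => v n x - w' x)
      (V := fun x => F n x + G x) (B := 2 * B) ((hF n).add hG)
      (fun x => ⟨add_nonneg (hFb n x).1 (hGb x).1, by linarith [(hFb n x).2, (hGb x).2]⟩)
      (fun x y hxy => by
        have := abs_sub (v n y - v n x) (w' y - w' x)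
        rw [show v n y - w' y - (v n x - w' x) = v n y - v n x - (w' y - w' x) by ring]
        linarith [hFd n x y hxy, hGd x y hxy]) ((hvm n).sub hwm) hR₁ hε0 hJ
    have h2 : 2 * B * ε < e / 2 := by
      rw [hε, ← mul_div_assoc, div_lt_div_iff₀ (by positivity) two_pos]
      nlinarith
    have h3 : ∫ x in Icc (-R) R, |v n x - w' x| ≤ ∫ x in Icc (-R₁) R₁, |v n x - w' x| := by
      have hi : IntegrableOn (fun x => |v n x - w' x|) (Icc (-R₁) R₁) :=
        ((Cutoff.integrableOn_bdd (hvm n) (hvM n)).sub (Cutoff.integrableOn_bdd hwm hwb)).abs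
      exact setIntegral_mono_set hi (Eventually.of_forall fun _ => abs_nonneg _)
        (LE.le.eventuallyLE (Icc_subset_Icc (neg_le_neg (le_max_left _ _)) (le_max_left _ _)))
    linarith
  have ha0 : Tendsto (fun n => B * a n) U (𝓝 0) := by
    have := (tendsto_one_div_add_atTop_nhds_zero_nat (𝕜 := ℝ).mono_left hU).const_mul B
    rwa [mul_zero] at this
  have hconv : ∀ R, Tendsto (fun n => ∫ x in Icc (-R) R, |w n x - w' x|) U (𝓝 0) := fun R => by
    have hs := ha0.add (hvw R)
    rw [add_zero] at hs
    refine squeeze_zero (fun n => integral_nonneg fun _ => abs_nonneg _) (fun n => ?_) hs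
    have j1 : Integrable (fun x => v n x - w n x) := by
      have := ((hw n).nonlocal_int
        (integrable_jump_finite (volume.restrict (Ioc 0 (a n))))).const_mul
        (a n)⁻¹
      exact this.congr (Eventually.of_forall fun x => ((hw n).movAvg_sub_self (ha n) x).symm)
    have j2 : IntegrableOn (fun x => |v n x - w' x|) (Icc (-R) R) :=
      ((Cutoff.integrableOn_bdd (hvm n) (hvM n)).sub (Cutoff.integrableOn_bdd hwm hwb)).abs
    have j3 : IntegrableOn (fun x => |w n x - w' x|) (Icc (-R) R) :=
      ((hw n).int.integrableOn.sub (Cutoff.integrableOn_bdd hwm hwb)).abs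
    calc ∫ x in Icc (-R) R, |w n x - w' x|
        ≤ ∫ x in Icc (-R) R, (|v n x - w n x| + |v n x - w' x|) :=
          integral_mono j3 (j1.abs.integrableOn.add j2) fun x => by
            have := abs_sub_le (w n x) (v n x) (w' x)
            rwa [abs_sub_comm (w n x) (v n x)] at this
      _ = (∫ x in Icc (-R) R, |v n x - w n x|) + ∫ x in Icc (-R) R, |v n x - w' x| :=
          integral_add j1.abs.integrableOn j2
      _ ≤ B * a n + ∫ x in Icc (-R) R, |v n x - w' x| :=
          add_le_add_left ((setIntegral_Icc_le j1).trans
            ((hw n).integral_abs_movAvg_sub_le (ha n))) _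
  have hN : ∀ R, ∫ x in Icc (-R) R, |w' x| ≤ N := fun R => by
    have hs : Tendsto (fun n => N + ∫ x in Icc (-R) R, |w n x - w' x|) U (𝓝 (N + 0)) :=
      tendsto_const_nhds.add (hconv R)
    rw [add_zero] at hs
    refine ge_of_tendsto hs (Eventually.of_forall fun n => ?_)
    have j1 : IntegrableOn (fun x => w' x) (Icc (-R) R) := Cutoff.integrableOn_bdd hwm hwb
    have j2 : IntegrableOn (fun x => |w n x - w' x|) (Icc (-R) R) :=
      ((hw n).int.integrableOn.sub j1).abs
    calc ∫ x in Icc (-R) R, |w' x| ≤ ∫ x in Icc (-R) R, (|w n x| + |w n x - w' x|) :=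
          integral_mono j1.abs ((hw n).int.abs.integrableOn.add j2) fun x => by
            have := abs_sub_abs_le_abs_sub (w' x) (w n x)
            rw [abs_sub_comm] at this
            beta_reduce
            linarith
      _ = (∫ x in Icc (-R) R, |w n x|) + ∫ x in Icc (-R) R, |w n x - w' x| :=
          integral_add (hw n).int.abs.integrableOn j2
      _ ≤ _ := add_le_add_left ((setIntegral_Icc_le (hw n).int).trans (hw n).norm) _
  obtain ⟨hi, hN'⟩ := integrable_of_setIntegral_Icc_le hwm hwb hN
  exact ⟨w', ⟨hwm, hwb, hi, hN', fun z => (integral_abs_translate_sub_le hB hvar z).2⟩, hvar, hconv⟩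

theorem RegL1.setIntegral_abs_sub_le {M N B M' N' B' M₁ N₁ B₁ R : ℝ} {w v z : ℝ → ℝ}
    (hw : RegL1 M N B w) (hv : RegL1 M' N' B' v) (hz : RegL1 M₁ N₁ B₁ z) :
    ∫ x in Icc (-R) R, |w x - z x| ≤
      (∫ x in Icc (-R) R, |w x - v x|) + ∫ x in Icc (-R) R, |v x - z x| := by
  rw [← integral_add (hw.sub hv).int.abs.integrableOn (hv.sub hz).int.abs.integrableOn]
  exact integral_mono (hw.sub hz).int.abs.integrableOn
    ((hw.sub hv).int.abs.integrableOn.add (hv.sub hz).int.abs.integrableOn)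
    fun x => abs_sub_le _ _ _

/-- Limits of the approximations satisfy an infinitesimal entropy inequality. -/
theorem exists_limit_solution {f : ℝ → ℝ} {L : ℝ} (hf : ∀ a b, |f a - f b| ≤ L * |a - b|)
    (hL : 0 ≤ L) {ν : Measure ℝ} [SFinite ν] (hν : Integrable (fun z : ℝ => min 1 |z|) ν)
    {M N B : ℝ} {u₀ : ℝ → ℝ} (hu : RegL1 M N B u₀) :
    ∃ C₀ ≥ 0, ∃ u : ℝ → ℝ → ℝ, (∀ t, RegL1 M N B (u t)) ∧
      (∀ t, eVariationOn (u t) univ ≤ ENNReal.ofReal B) ∧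
      (∀ s t, 0 ≤ s → s ≤ t → ∫ x, |u t x - u s x| ≤ C₀ * (t - s)) ∧
      (u 0 =ᵐ[volume] u₀) ∧
      ∀ δ > 0, ∀ k R C ε : ℝ, 0 ≤ C → 0 < ε → ∃ K ≥ 0, ∀ φ φ',
        TestFn R C φ φ' → ∀ s t, 0 ≤ s → s ≤ t →
          entInt δ k (u t) φ - entInt δ k (u s) φ ≤
            (t - s) * (prodInt ν f δ k (u s) φ' φ + ε + K * (t - s)) := by
  obtain ⟨C₀, hC₀, τ, un, hτ, hτ0, hreg, htime, hinit, hent⟩ := exists_approximations hf hL hν hu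
  let U : Ultrafilter ℕ := hyperfilter ℕ
  have hU : (U : Filter ℕ) ≤ atTop := Nat.hyperfilter_le_atTop
  choose u hureg huvar huconv using fun t => exists_ultralimit hU fun n => hreg n t
  have hM := hu.nonneg_M
  refine ⟨C₀, hC₀, u, hureg, huvar, fun s t hs hst => ?_, ?_, fun δ hδ k R C ε hC hε => ?_⟩
  · refine (integrable_of_setIntegral_Icc_le ((hureg t).sub (hureg s)).meas
      ((hureg t).sub (hureg s)).bdd fun R => ?_).2
    have hs1 : Tendsto (fun n => (∫ x in Icc (-R) R, |un n t x - u t x|) +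
        (C₀ * (t - s + τ n) + ∫ x in Icc (-R) R, |un n s x - u s x|)) U
        (𝓝 (0 + (C₀ * (t - s + 0) + 0))) :=
      (huconv t R).add ((((hτ0.mono_left hU).const_add (t - s)).const_mul C₀).add (huconv s R))
    rw [zero_add, add_zero, add_zero] at hs1
    refine ge_of_tendsto hs1 (Eventually.of_forall fun n => ?_)
    have h1 := (hureg t).setIntegral_abs_sub_le (R := R) (hreg n t) (hureg s)
    have h2 := (hreg n t).setIntegral_abs_sub_le (R := R) (hreg n s) (hureg s)
    have h3 := (setIntegral_Icc_le (R := R) ((hreg n t).sub (hreg n s)).int).trans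
      (htime n s t hs hst)
    simp_rw [abs_sub_comm (un n t _) (u t _)]
    linarith
  · have hd := hu.sub (hureg 0)
    have hz : ∫ x, |u₀ x - u 0 x| = 0 := by
      refine le_antisymm ?_ (integral_nonneg fun _ => abs_nonneg _)
      refine (integrable_of_setIntegral_Icc_le hd.meas hd.bdd fun R => ?_).2
      have := huconv 0 R
      simp_rw [hinit] at this
      exact (tendsto_nhds_unique tendsto_const_nhds this).le
    rw [integral_eq_zero_iff_of_nonneg (fun _ => abs_nonneg _) hd.int.abs] at hz
    filter_upwards [hz] with x hx
    exact (sub_eq_zero.1 (abs_eq_zero.1 hx)).symm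
  · obtain ⟨K, hK, H⟩ := hent δ hδ k R C (ε / 3) hC (by positivity)
    obtain ⟨K', -, R', H'⟩ := exists_prodInt_modulus hf hν hL hδ M N B R hC
      (ε := ε / 3) (by positivity)
    refine ⟨K, hK, fun φ φ' hφ s t hs hst => ?_⟩
    have hE : ∀ r, Tendsto (fun n => entInt δ k (un n r) φ)
      U (𝓝 (entInt δ k (u r) φ)) := fun r => by
      rw [tendsto_iff_dist_tendsto_zero]
      refine squeeze_zero (fun _ => dist_nonneg) (fun n => ?_)
        (by simpa using (huconv r R).const_mul C)
      rw [Real.dist_eq]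
      exact abs_entInt_sub_le hδ (hreg n r) (hureg r) hφ.cut
    set P := prodInt ν f δ k (u s) φ' φ
    have hH : ∀ᶠ n in (U : Filter ℕ), ∃ m ≥ 0, |m - (t - s)| ≤ τ n ∧
        entInt δ k (un n t) φ - entInt δ k (un n s) φ ≤
          m * (P + ε + K * (t - s)) := by
      have hsm : ∀ᶠ n in (U : Filter ℕ), K' * ∫ x in Icc (-R') R', |un n s x - u s x| < ε / 3 := by
        have := (huconv s R').const_mul K'
        rw [mul_zero] at this
        exact this.eventually (gt_mem_nhds (by positivity))
      filter_upwards [hU H, hsm] with n hn hn'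
      obtain ⟨m, hm, hm1, hm2⟩ := hn φ φ' hφ s t hs hst
      refine ⟨m, hm, hm1, hm2.trans (mul_le_mul_of_nonneg_left ?_ hm)⟩
      have := (abs_le.1 (H' k (un n s) (u s) φ' φ (hreg n s) (hureg s) hφ.cut' hφ.cut)).2
      linarith
    obtain ⟨m, hm⟩ := hH.choice
    have hmt : Tendsto m U (𝓝 (t - s)) := by
      rw [tendsto_iff_dist_tendsto_zero]
      refine squeeze_zero' (Eventually.of_forall fun _ => dist_nonneg) ?_ (hτ0.mono_left hU)
      filter_upwards [hm] with n hn
      rw [Real.dist_eq]; exact hn.2.1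
    exact le_of_tendsto_of_tendsto ((hE t).sub (hE s)) (hmt.mul_const _)
      (hm.mono fun n hn => hn.2.2)

/-- A function whose upper right Dini derivative is bounded by a continuous function. -/
theorem sub_le_integral_of_dini {F H : ℝ → ℝ} {a b : ℝ} (hab : a ≤ b)
    (hF : ContinuousOn F (Icc a b))
    (hH : Continuous H)
    (h : ∀ t ∈ Ico a b, ∀ ε > 0, ∀ᶠ s in 𝓝[>] t, F s - F t ≤ (s - t) * (H t + ε)) :
    F b - F a ≤ ∫ t in a..b, H t := by
  have key := image_le_of_liminf_slope_right_le_deriv_boundary (f := F) hF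
    (B := fun t => F a + ∫ s in a..t, H s) (B' := H) (by simp)
    (fun t _ =>
      ((hH.integral_hasStrictDerivAt a t).hasDerivAt.const_add _).continuousAt.continuousWithinAt)
    (fun t _ => ((hH.integral_hasStrictDerivAt a t).hasDerivAt.const_add _).hasDerivWithinAt)
    (fun t ht r hr => ?_) (right_mem_Icc.2 hab)
  · linarith
  · refine Eventually.frequently ?_
    filter_upwards [h t ht ((r - H t) / 2) (by linarith), self_mem_nhdsWithin] with s hs hst
    have hst' : t < s := hst
    rw [slope_def_field, div_lt_iff₀ (sub_pos.2 hst')]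
    nlinarith [sub_pos.2 hst']

/-- An `L¹`-continuous curve of uniformly regular functions. -/
structure Curve (M N B : ℝ) (u : ℝ → ℝ → ℝ) : Prop where
  reg : ∀ t, RegL1 M N B (u t)
  cont : ∀ t, Tendsto (fun s => ∫ x, |u s x - u t x|) (𝓝 t) (𝓝 0)

/-- A uniformly continuous family of cutoffs. -/
structure TimeCutoff (R C : ℝ) (p : ℝ → ℝ → ℝ) : Prop where
  cut : ∀ t, Cutoff R C (p t)
  cont : ∀ t, ∀ ε > 0, ∀ᶠ s in 𝓝 t, ∀ x, |p s x - p t x| ≤ ε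

theorem continuous_of_modulus {F : ℝ → ℝ} (m : ℝ → ℝ → ℝ) (hm : ∀ t, Tendsto (m t) (𝓝 t) (𝓝 0))
    (h : ∀ t, ∀ ε > 0, ∃ K, ∀ᶠ s in 𝓝 t, |F s - F t| ≤ ε + K * m t s) : Continuous F := by
  refine continuous_iff_continuousAt.2 fun t => Metric.tendsto_nhds.2 fun ε hε => ?_
  obtain ⟨K, hK⟩ := h t (ε / 2) (half_pos hε)
  have h1 := (hm t).const_mul K
  rw [mul_zero] at h1
  filter_upwards [hK, h1.eventually (gt_mem_nhds (half_pos hε))] with s hs hs'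
  rw [Real.dist_eq]
  linarith

theorem Cutoff.zero {R C : ℝ} (hC : 0 ≤ C) : Cutoff R C fun _ => 0 :=
  ⟨measurable_const, fun _ => by simpa using hC, fun _ _ => rfl⟩

section
variable {M N B R C δ k : ℝ} {w p₁ q₁ r₁ : ℝ → ℝ} {u p q r : ℝ → ℝ → ℝ}

theorem Curve.continuous_entInt (hu : Curve M N B u) (hδ : 0 < δ) (hp : TimeCutoff R C p) :
    Continuous fun t => entInt δ k (u t) (p t) := by
  have hM := (hu.reg 0).nonneg_M
  refine continuous_of_modulus (fun t s => ∫ x, |u s x - u t x|) hu.cont fun t ε hε => ⟨C, ?_⟩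
  set D := (M + |k| + δ) * (2 * |R|) with hD
  have hD0 : 0 ≤ D := by positivity
  filter_upwards [hp.cont t (ε / (D + 1)) (by positivity)] with s hs
  have h1 := abs_entInt_sub_le' (k := k) hδ (hu.reg s) (hp.cut s) (hp.cut t) hs
  have h2 := (abs_entInt_sub_le (k := k) hδ (hu.reg s) (hu.reg t) (hp.cut t)).trans
    (mul_le_mul_of_nonneg_left (setIntegral_Icc_le ((hu.reg s).sub (hu.reg t)).int)
      (hp.cut t).nonneg)
  have h3 : ε / (D + 1) * D ≤ ε := by
    rw [div_mul_eq_mul_div, div_le_iff₀ (by positivity)]; nlinarith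
  have h4 := abs_sub_le (entInt δ k (u s) (p s)) (entInt δ k (u s) (p t)) (entInt δ k (u t) (p t))
  linarith

variable {f : ℝ → ℝ} {L : ℝ} (hf : ∀ a b, |f a - f b| ≤ L * |a - b|) {ν : Measure ℝ} [SFinite ν]
include hf

theorem Curve.continuous_prodInt (hν : Integrable (fun z : ℝ => min 1 |z|) ν) (hL : 0 ≤ L)
    (hu : Curve M N B u) (hδ : 0 < δ) (hq : TimeCutoff R C q) (hr : TimeCutoff R C r) :
    Continuous fun t => prodInt ν f δ k (u t) (q t) (r t) := by
  have hM := (hu.reg 0).nonneg_M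
  have hN := (hu.reg 0).nonneg_N
  have hB := (hu.reg 0).nonneg_B
  have hC := (hq.cut 0).nonneg
  refine continuous_of_modulus (fun t s => ∫ x, |u s x - u t x|) hu.cont fun t ε hε => ?_
  obtain ⟨K, hK, R', H⟩ := exists_prodInt_modulus hf hν hL hδ M N B R hC (half_pos hε)
  refine ⟨K, ?_⟩
  set D := L * (M + |k| + δ) * (2 * |R|) + (B + 2 * N) * ∫ z, min 1 |z| ∂ν with hD
  have hI0 : 0 ≤ ∫ z, min 1 |z| ∂ν := integral_nonneg fun z => le_min zero_le_one (abs_nonneg z)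
  have hD0 : 0 ≤ D := by positivity
  have hc : 0 < ε / 2 / (D + 1) := by positivity
  filter_upwards [hq.cont t _ hc, hr.cont t _ hc] with s hs hs'
  have h1 := abs_prodInt_sub_le (k := k) hf hν hL hδ (hu.reg s) (hq.cut s) (hr.cut s) (hq.cut t)
    (hr.cut t) hs hs'
  have h2 := (H k (u s) (u t) (q t) (r t) (hu.reg s) (hu.reg t) (hq.cut t) (hr.cut t)).trans
    (add_le_add_right (mul_le_mul_of_nonneg_left
      (setIntegral_Icc_le ((hu.reg s).sub (hu.reg t)).int) hK) _)
  have h3 : ε / 2 / (D + 1) * D ≤ ε / 2 := by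
    rw [div_mul_eq_mul_div, div_le_iff₀ (by positivity)]; nlinarith
  have h4 := abs_sub_le (prodInt ν f δ k (u s) (q s) (r s)) (prodInt ν f δ k (u s) (q t) (r t))
    (prodInt ν f δ k (u t) (q t) (r t))
  linarith

omit hf in
theorem tendsto_entInt (hw : RegL1 M N B (w)) (hp : Cutoff R C (p₁)) :
    Tendsto (fun δ => entInt δ k (w) (p₁)) (𝓝[>] 0) (𝓝 (∫ x, |w x - k| * p₁ x)) := by
  have hM := hw.nonneg_M
  have pi : Integrable (p₁) := by
    simpa using hp.integrable_mul (g := fun _ => 1) (integrableOn_const (by simp) (by simp))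
  refine tendsto_integral_filter_of_dominated_convergence (fun x => (M + |k| + 1) * |p₁ x|) ?_ ?_
    (pi.abs.const_mul _) (Eventually.of_forall fun x => (tendsto_ent _).mul_const _)
  · filter_upwards [self_mem_nhdsWithin] with δ hδ
    exact (integrable_ent_mul hδ hw hp).aestronglyMeasurable
  · filter_upwards [Ioo_mem_nhdsGT (zero_lt_one (α := ℝ))] with δ hδ
    refine Eventually.of_forall fun x => ?_
    rw [norm_mul, Real.norm_eq_abs, Real.norm_eq_abs]
    gcongr
    linarith [abs_ent_le (k := k) hδ.1 hw x, hδ.2]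

theorem tendsto_prodInt (hν : Integrable (fun z : ℝ => min 1 |z|) ν) (hL : 0 ≤ L)
    (hw : RegL1 M N B (w)) (hq : Cutoff R C (q₁)) (hr : Cutoff R C (r₁)) :
    Tendsto (fun δ => prodInt ν f δ k (w) (q₁) (r₁)) (𝓝[>] 0)
      (𝓝 (∫ x, (kruzFlux f k (w x) * q₁ x +
        Real.sign (w x - k) * nonlocal ν (w) x * r₁ x))) := by
  have hM := hw.nonneg_M
  have qi : Integrable (q₁) := by
    simpa using hq.integrable_mul (g := fun _ => 1) (integrableOn_const (by simp) (by simp))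
  have hC := hq.nonneg
  refine tendsto_integral_filter_of_dominated_convergence
    (fun x => L * (M + |k| + 1) * |q₁ x| + C * |nonlocal ν (w) x|) ?_ ?_
    ((qi.abs.const_mul _).add ((hw.nonlocal_int hν).abs.const_mul _))
    (Eventually.of_forall fun x => ?_)
  · filter_upwards [self_mem_nhdsWithin] with δ hδ
    exact (integrable_prodInt hf hν hL hδ hw hq hr).aestronglyMeasurable
  · filter_upwards [Ioo_mem_nhdsGT (zero_lt_one (α := ℝ))] with δ hδ
    refine Eventually.of_forall fun x => (norm_add_le _ _).trans (add_le_add ?_ ?_)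
    · rw [norm_mul, Real.norm_eq_abs, Real.norm_eq_abs]
      gcongr
      refine (abs_fluxAvg_le (k := k) hf hL hδ.1 hw x).trans ?_
      gcongr
      exact hδ.2.le
    · rw [norm_mul, norm_mul, Real.norm_eq_abs, Real.norm_eq_abs, Real.norm_eq_abs, mul_comm]
      have h1 := abs_sgnAvg_le_one hδ.1 (w x - k)
      have h2 := hr.bdd x
      calc |r₁ x| * (|sgnAvg δ (w x - k)| * |nonlocal ν (w) x|)
          ≤ C * (1 * |nonlocal ν (w) x|) := by gcongr
        _ = _ := by rw [one_mul]
  · exact ((tendsto_fluxAvg hf hL k (w x)).mul_const _).add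
      (((tendsto_sgnAvg _).mul_const _).mul_const _)

omit hf in
theorem abs_entInt_le (hδ : 0 < δ) (hw : RegL1 M N B (w)) (hp : Cutoff R C (p₁)) :
    |entInt δ k (w) (p₁)| ≤ C * ((M + |k| + δ) * (2 * |R|)) := by
  have := abs_entInt_sub_le' (k := k) hδ hw hp (Cutoff.zero (R := R) hp.nonneg) (c := C)
    (by simpa using hp.bdd)
  simpa [entInt] using this

theorem abs_prodInt_le (hν : Integrable (fun z : ℝ => min 1 |z|) ν) (hL : 0 ≤ L)
    (hδ : 0 < δ) (hw : RegL1 M N B (w)) (hq : Cutoff R C (q₁)) (hr : Cutoff R C (r₁)) :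
    |prodInt ν f δ k (w) (q₁) (r₁)| ≤
      C * (L * (M + |k| + δ) * (2 * |R|) + (B + 2 * N) * ∫ z, min 1 |z| ∂ν) := by
  have := abs_prodInt_sub_le (k := k) hf hν hL hδ hw hq hr (Cutoff.zero (R := R) hq.nonneg)
    (Cutoff.zero (R := R) hq.nonneg) (c := C) (by simpa using hq.bdd) (by simpa using hr.bdd)
  simpa [prodInt] using this

end

section
variable {M N B R C δ k : ℝ} {w p q r : ℝ → ℝ}

theorem entInt_add_mul (hδ : 0 < δ) (hw : RegL1 M N B w) (hp : Cutoff R C p) (hq : Cutoff R C q)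
    (c : ℝ) : entInt δ k w (fun x => p x + c * q x) = entInt δ k w p + c * entInt δ k w q := by
  unfold entInt
  rw [← integral_const_mul, ← integral_add (integrable_ent_mul hδ hw hp)
    ((integrable_ent_mul hδ hw hq).const_mul c)]
  congr 1 with x
  ring

theorem Cutoff.add_mul (hp : Cutoff R C p) (hq : Cutoff R C q) (c : ℝ) :
    Cutoff R (C + |c| * C) (fun x => p x + c * q x) where
  meas := hp.meas.add (hq.meas.const_mul c)
  bdd x := (abs_add_le _ _).trans (add_le_add (hp.bdd x)
    ((abs_mul _ _).trans_le (mul_le_mul_of_nonneg_left (hq.bdd x) (abs_nonneg c))))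
  supp x hx := by rw [hp.supp x hx, hq.supp x hx]; ring

theorem Cutoff.integrable (hp : Cutoff R C p) : Integrable p := by
  simpa using hp.integrable_mul (g := fun _ => 1) (integrableOn_const (by simp) (by simp))

theorem RegL1.integrable_abs_sub_mul (hw : RegL1 M N B w) (hp : Cutoff R C p) :
    Integrable fun x => |w x - k| * p x :=
  hp.integrable_mul (hw.int.integrableOn.sub (integrableOn_const (by simp) (by simp))).abs

theorem RegL1.integrable_production {f : ℝ → ℝ} {L : ℝ} (hf : ∀ a b, |f a - f b| ≤ L * |a - b|)
    {ν : Measure ℝ} [SFinite ν] (hν : Integrable (fun z : ℝ => min 1 |z|) ν)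
    (hw : RegL1 M N B w) (hq : Cutoff R C q) (hr : Cutoff R C r) :
    Integrable fun x => kruzFlux f k (w x) * q x +
      Real.sign (w x - k) * nonlocal ν w x * r x := by
  refine Integrable.add (hq.integrable_mul ?_) (hr.integrable_mul ?_)
  · refine Integrable.mono' ((hw.int.integrableOn.sub
      (integrableOn_const (C := k) (by simp) (by simp))).abs.const_mul L)
      ((measurable_kruzFlux hf k).comp hw.meas).aestronglyMeasurable
      (Eventually.of_forall fun x => abs_kruzFlux_le hf k (w x))
  · exact (hw.mul_nonlocal hν (monotone_sign.measurable.comp (hw.meas.sub_const k))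
      (fun x => abs_sign_le_one _)).1.integrableOn

end

/-- A nonnegative space-time test function `φ` with its derivatives `φx` and `φt`. -/
structure TimeTestFn (R C : ℝ) (φ φx φt : ℝ → ℝ → ℝ) : Prop where
  fn : TimeCutoff R C φ
  dx : TimeCutoff R C φx
  dt : TimeCutoff R C φt
  space : ∀ t, TestFn R C (φ t) (φx t)
  time : ∀ s t x, |φ s x - φ t x - (s - t) * φt t x| ≤ C * (s - t) ^ 2

section
variable {f : ℝ → ℝ} {L : ℝ} (hf : ∀ a b, |f a - f b| ≤ L * |a - b|) {ν : Measure ℝ} [SFinite ν]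
  {M N B R C T δ k : ℝ} {u φ φx φt : ℝ → ℝ → ℝ}
include hf

theorem smoothed_entropy_inequality (hν : Integrable (fun z : ℝ => min 1 |z|) ν) (hL : 0 ≤ L)
    (hu : Curve M N B u)
    (hinc : ∀ R C ε : ℝ, 0 ≤ C → 0 < ε → ∃ K ≥ 0, ∀ φ φ',
        TestFn R C φ φ' → ∀ s t, 0 ≤ s → s ≤ t →
          entInt δ k (u t) φ - entInt δ k (u s) φ ≤
            (t - s) * (prodInt ν f δ k (u s) φ' φ + ε + K * (t - s)))
    (hφ : TimeTestFn R C φ φx φt) (hδ : 0 < δ) (hT : 0 ≤ T) :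
    entInt δ k (u T) (φ T) - entInt δ k (u 0) (φ 0) ≤
      ∫ t in 0..T, (entInt δ k (u t) (φt t) + prodInt ν f δ k (u t) (φx t) (φ t)) := by
  have hC := (hφ.fn.cut 0).nonneg
  have hM := (hu.reg 0).nonneg_M
  refine sub_le_integral_of_dini hT (hu.continuous_entInt hδ hφ.fn).continuousOn
    ((hu.continuous_entInt hδ hφ.dt).add (hu.continuous_prodInt hf hν hL hδ hφ.dx hφ.fn))
    fun t ht ε hε => ?_
  obtain ⟨K, hK, H⟩ := hinc R C (ε / 4) hC (by positivity)
  set D := (M + |k| + δ) * (2 * |R|) with hD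
  have h1 : Tendsto (fun s => entInt δ k (u s) (φt t)) (𝓝 t) (𝓝 (entInt δ k (u t) (φt t))) :=
    (hu.continuous_entInt (p := fun _ => φt t) hδ ⟨fun _ => hφ.dt.cut t, fun _ ε hε =>
      Eventually.of_forall fun _ _ => by simpa using hε.le⟩).tendsto t
  have h2 : Tendsto (fun s => K * (s - t) + C * D * (s - t)) (𝓝 t) (𝓝 0) := by
    have : Continuous fun s => K * (s - t) + C * D * (s - t) := by fun_prop
    simpa using this.tendsto t
  filter_upwards [self_mem_nhdsWithin,
    nhdsWithin_le_nhds (h1.eventually (gt_mem_nhds (lt_add_of_pos_right _ (half_pos hε)))),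
    nhdsWithin_le_nhds (h2.eventually (gt_mem_nhds (show 0 < ε / 4 by positivity)))]
    with s hs hs1 hs2
  have hst : 0 < s - t := sub_pos.2 hs
  have e1 := H (φ t) (φx t) (hφ.space t) t s ht.1 (sub_nonneg.1 hst.le)
  have e2 := abs_entInt_sub_le' (k := k) hδ (hu.reg s) (hφ.fn.cut s)
    ((hφ.fn.cut t).add_mul (hφ.dt.cut t) (s - t)) (c := C * (s - t) ^ 2) (fun x => by
      rw [← sub_sub]; exact hφ.time s t x)
  rw [entInt_add_mul hδ (hu.reg s) (hφ.fn.cut t) (hφ.dt.cut t)] at e2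
  have e3 := (abs_le.1 e2).2
  have e4 := mul_le_mul_of_nonneg_left hs1.le hst.le
  have e5 := mul_le_mul_of_nonneg_left hs2.le hst.le
  rw [← hD] at e3
  nlinarith

theorem entropy_inequality_of_increment (hν : Integrable (fun z : ℝ => min 1 |z|) ν) (hL : 0 ≤ L)
    (hu : Curve M N B u)
    (hinc : ∀ δ > 0, ∀ R C ε : ℝ, 0 ≤ C → 0 < ε → ∃ K ≥ 0, ∀ φ φ',
        TestFn R C φ φ' → ∀ s t, 0 ≤ s → s ≤ t →
          entInt δ k (u t) φ - entInt δ k (u s) φ ≤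
            (t - s) * (prodInt ν f δ k (u s) φ' φ + ε + K * (t - s)))
    (hφ : TimeTestFn R C φ φx φt) (hT : 0 ≤ T) :
    (∫ x, |u T x - k| * φ T x) - (∫ x, |u 0 x - k| * φ 0 x) ≤
      ∫ t in 0..T, ∫ x, (|u t x - k| * φt t x + kruzFlux f k (u t x) * φx t x +
        Real.sign (u t x - k) * nonlocal ν (u t) x * φ t x) := by
  have hpt : ∀ t, ∫ x, (|u t x - k| * φt t x + kruzFlux f k (u t x) * φx t x +
        Real.sign (u t x - k) * nonlocal ν (u t) x * φ t x) = (∫ x, |u t x - k| * φt t x) +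
      ∫ x, (kruzFlux f k (u t x) * φx t x +
        Real.sign (u t x - k) * nonlocal ν (u t) x * φ t x) := fun t => by
    rw [← integral_add ((hu.reg t).integrable_abs_sub_mul (hφ.dt.cut t))
      ((hu.reg t).integrable_production hf hν (hφ.dx.cut t) (hφ.fn.cut t))]
    simp only [add_assoc]
  simp_rw [hpt]
  have hδ0 : ∀ᶠ δ : ℝ in 𝓝[>] 0, δ ∈ Ioo (0 : ℝ) 1 := Ioo_mem_nhdsGT zero_lt_one
  have hM := (hu.reg 0).nonneg_M
  have hC := (hφ.fn.cut 0).nonneg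
  refine le_of_tendsto_of_tendsto
    ((tendsto_entInt (hu.reg T) (hφ.fn.cut T)).sub (tendsto_entInt (hu.reg 0) (hφ.fn.cut 0)))
    (intervalIntegral.tendsto_integral_filter_of_dominated_convergence
      (F := fun δ t => entInt δ k (u t) (φt t) + prodInt ν f δ k (u t) (φx t) (φ t))
      (fun _ => C * ((M + |k| + 1) * (2 * |R|)) +
        C * (L * (M + |k| + 1) * (2 * |R|) + (B + 2 * N) * ∫ z, min 1 |z| ∂ν))
      ?_ ?_ intervalIntegrable_const (Eventually.of_forall fun t _ =>
        (tendsto_entInt (hu.reg t) (hφ.dt.cut t)).add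
          (tendsto_prodInt hf hν hL (hu.reg t) (hφ.dx.cut t) (hφ.fn.cut t)))) ?_
  · filter_upwards [hδ0] with δ hδ
    exact ((hu.continuous_entInt hδ.1 hφ.dt).add
      (hu.continuous_prodInt hf hν hL hδ.1 hφ.dx hφ.fn)).aestronglyMeasurable
  · filter_upwards [hδ0] with δ hδ
    refine Eventually.of_forall fun t _ => (norm_add_le _ _).trans (add_le_add ?_ ?_)
    · refine (abs_entInt_le hδ.1 (hu.reg t) (hφ.dt.cut t)).trans ?_
      gcongr
      exact hδ.2.le
    · refine (abs_prodInt_le hf hν hL hδ.1 (hu.reg t) (hφ.dx.cut t) (hφ.fn.cut t)).trans ?_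
      gcongr
      exact hδ.2.le
  · filter_upwards [hδ0] with δ hδ
    exact smoothed_entropy_inequality hf hν hL hu (hinc δ hδ.1) hφ hδ.1 hT

end

theorem abs_taylor_le {g g' : ℝ → ℝ} {C : ℝ} (hg : ∀ s, HasDerivAt g (g' s) s)
    (hl : ∀ a b, |g' a - g' b| ≤ C * |a - b|) (x y : ℝ) :
    |g (x + y) - g x - y * g' x| ≤ C * y ^ 2 := by
  have hC : 0 ≤ C := by simpa using (abs_nonneg _).trans (hl 1 0)
  have hd : ∀ s ∈ uIcc x (x + y), HasDerivWithinAt (fun s => g s - (s - x) * g' x)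
      (g' s - g' x) (uIcc x (x + y)) s := fun s _ => by
    have h1 : HasDerivAt (fun s => (s - x) * g' x) (g' x) s := by
      simpa using ((hasDerivAt_id s).sub_const x).mul_const (g' x)
    exact ((hg s).sub h1).hasDerivWithinAt
  have hb : ∀ s ∈ uIcc x (x + y), ‖g' s - g' x‖ ≤ C * |y| := fun s hs => by
    refine (hl s x).trans (mul_le_mul_of_nonneg_left ?_ hC)
    simpa using abs_sub_left_of_mem_uIcc hs
  have := (convex_uIcc x (x + y)).norm_image_sub_le_of_norm_hasDerivWithin_le hd hb
    left_mem_uIcc right_mem_uIcc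
  have h2 : g (x + y) - (x + y - x) * g' x - (g x - (x - x) * g' x) =
      g (x + y) - g x - y * g' x := by ring
  rw [h2] at this
  calc |g (x + y) - g x - y * g' x| ≤ C * |y| * ‖x + y - x‖ := this
    _ = C * y ^ 2 := by
      rw [add_sub_cancel_left, Real.norm_eq_abs, mul_assoc, ← sq, sq_abs]

theorem exists_lipschitz_bound {E : Type*} [NormedAddCommGroup E] [NormedSpace ℝ E]
    {g : E → ℝ} (hg : ContDiff ℝ 1 g) (hs : HasCompactSupport g) :
    ∃ C, ∀ C' ≥ C, (∀ x, |g x| ≤ C') ∧ ∀ x y, |g x - g y| ≤ C' * ‖x - y‖ := by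
  obtain ⟨K, hK⟩ := hg.lipschitzWith_of_hasCompactSupport hs one_ne_zero
  obtain ⟨D, hD⟩ := hs.exists_bound_of_continuous hg.continuous
  refine ⟨max K D, fun C' hC' => ⟨fun x => (hD x).trans ((le_max_right _ _).trans hC'),
    fun x y => (hK.norm_sub_le x y).trans ?_⟩⟩
  gcongr
  exact (le_max_left _ _).trans hC'

theorem exists_timeTestFn {ψ : ℝ → ℝ → ℝ} (hψ : ContDiff ℝ (⊤ : ℕ∞) fun q : ℝ × ℝ => ψ q.1 q.2)
    (hs : HasCompactSupport fun q : ℝ × ℝ => ψ q.1 q.2) (h0 : ∀ x t, 0 ≤ ψ x t) :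
    ∃ R C, TimeTestFn R C (fun t x => ψ x t) (fun t x => deriv (fun y => ψ y t) x)
      fun t x => deriv (fun s => ψ x s) t := by
  set g : ℝ × ℝ → ℝ := fun q => ψ q.1 q.2 with hg
  have hdiff : Differentiable ℝ g := hψ.differentiable (by simp)
  have hx : ∀ x t, HasDerivAt (fun y => ψ y t) (fderiv ℝ g (x, t) (1, 0)) x := fun x t =>
    HasFDerivAt.comp_hasDerivAt (l := g) (f := fun y => (y, t)) x (hdiff (x, t)).hasFDerivAt
      ((hasDerivAt_id x).prodMk (hasDerivAt_const x t))
  have ht : ∀ x t, HasDerivAt (fun s => ψ x s) (fderiv ℝ g (x, t) (0, 1)) t := fun x t =>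
    HasFDerivAt.comp_hasDerivAt (l := g) (f := fun s => (x, s)) t (hdiff (x, t)).hasFDerivAt
      ((hasDerivAt_const t x).prodMk (hasDerivAt_id t))
  simp_rw [fun x t => (hx x t).deriv, fun x t => (ht x t).deriv]
  have hfd : ContDiff ℝ 1 (fderiv ℝ g) := hψ.fderiv_right (by norm_cast)
  have hc : ∀ v : ℝ × ℝ, ContDiff ℝ 1 fun q => fderiv ℝ g q v := fun v =>
    hfd.clm_apply contDiff_const
  have hcs : ∀ v : ℝ × ℝ, HasCompactSupport fun q => fderiv ℝ g q v := fun v =>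
    (hs.fderiv ℝ).comp_left (g := fun l : ℝ × ℝ →L[ℝ] ℝ => l v) rfl
  obtain ⟨C₁, h₁⟩ := exists_lipschitz_bound (hψ.of_le (by norm_cast)) hs
  obtain ⟨C₂, h₂⟩ := exists_lipschitz_bound (hc (1, 0)) (hcs (1, 0))
  obtain ⟨C₃, h₃⟩ := exists_lipschitz_bound (hc (0, 1)) (hcs (0, 1))
  obtain ⟨R, hR⟩ := hs.isCompact.isBounded.subset_closedBall (0 : ℝ × ℝ)
  set C := max C₁ (max C₂ C₃)
  have hC₁ := h₁ C (le_max_left _ _)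
  have hC₂ := h₂ C ((le_max_left _ _).trans (le_max_right _ _))
  have hC₃ := h₃ C ((le_max_right _ _).trans (le_max_right _ _))
  have hsupp : ∀ G : ℝ × ℝ → ℝ, tsupport G ⊆ tsupport g → ∀ t, ∀ x ∉ Icc (-R) R,
      G (x, t) = 0 := fun G hG t x hx => by
    by_contra hne
    have := hR (hG (subset_tsupport G hne))
    rw [mem_closedBall_zero_iff] at this
    exact hx (abs_le.1 ((norm_fst_le (x, t)).trans this))
  have hts : ∀ v : ℝ × ℝ, tsupport (fun q => fderiv ℝ g q v) ⊆ tsupport g := fun v =>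
    (closure_mono fun q hq => by
      have : fderiv ℝ g q ≠ 0 := fun h => hq (by simp [h])
      exact this).trans (tsupport_fderiv_subset ℝ)
  have hC0 : 0 ≤ C := (abs_nonneg _).trans (hC₁.1 0)
  have mk : ∀ G : ℝ × ℝ → ℝ, Continuous G → tsupport G ⊆ tsupport g →
      ((∀ x, |G x| ≤ C) ∧ ∀ x y, |G x - G y| ≤ C * ‖x - y‖) →
      TimeCutoff R C fun t x => G (x, t) := fun G hG hGs hGb => by
    refine ⟨fun t => ⟨by fun_prop, fun x => hGb.1 _, hsupp G hGs t⟩, fun t ε hε => ?_⟩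
    have : Tendsto (fun s => C * |s - t|) (𝓝 t) (𝓝 0) := by
      have : Continuous fun s => C * |s - t| := by fun_prop
      simpa using this.tendsto t
    filter_upwards [this.eventually (gt_mem_nhds hε)] with s hs x
    refine (hGb.2 _ _).trans (le_trans (mul_le_mul_of_nonneg_left ?_ hC0) hs.le)
    simp [Prod.norm_def]
  have m1 := mk g hψ.continuous subset_rfl hC₁
  have m2 := mk _ (hc (1, 0)).continuous (hts _) hC₂
  have m3 := mk _ (hc (0, 1)).continuous (hts _) hC₃
  refine ⟨R, C, m1, m2, m3, fun t => ⟨m1.cut t, m2.cut t, fun x => h0 x t, ?_⟩, fun s t x => ?_⟩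
  · refine abs_taylor_le (g := fun x => ψ x t) (fun x => hx x t) fun a b => ?_
    refine (hC₂.2 _ _).trans (mul_le_mul_of_nonneg_left ?_ hC0)
    simp [Prod.norm_def]
  · have := abs_taylor_le (g := fun t => ψ x t) (fun t => ht x t) (C := C) (fun a b => by
      refine (hC₃.2 _ _).trans (mul_le_mul_of_nonneg_left ?_ hC0)
      simp [Prod.norm_def]) t (s - t)
    rwa [add_sub_cancel] at this

/-- The Lévy measure of the fractional Laplacian. -/
noncomputable def levyMeasure (lam clam : ℝ) : Measure ℝ :=
  volume.withDensity fun z => ENNReal.ofReal (clam / |z| ^ (1 + lam))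

section
variable {lam clam : ℝ}

theorem measurable_levyDensity (lam clam : ℝ) :
    Measurable fun z : ℝ => ENNReal.ofReal (clam / |z| ^ (1 + lam)) := by fun_prop

instance sFinite_levyMeasure : SFinite (levyMeasure lam clam) := by
  unfold levyMeasure; infer_instance

theorem integrable_levyMeasure (hlam : lam ∈ Ioo (0 : ℝ) 1) (hclam : 0 < clam) :
    Integrable (fun z : ℝ => min 1 |z|) (levyMeasure lam clam) := by
  obtain ⟨h0, h1⟩ := hlam
  rw [levyMeasure, integrable_withDensity_iff_integrable_smul' (measurable_levyDensity lam clam)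
    (ae_of_all _ fun _ => ENNReal.ofReal_lt_top)]
  have e : ∀ z : ℝ, (ENNReal.ofReal (clam / |z| ^ (1 + lam))).toReal • min 1 |z| =
      clam / |z| ^ (1 + lam) * min 1 |z| := fun z => by
    rw [ENNReal.toReal_ofReal (by positivity), smul_eq_mul]
  simp_rw [e]
  have hpos : IntegrableOn (fun z : ℝ => clam / |z| ^ (1 + lam) * min 1 |z|) (Ioi 0) := by
    rw [← Ioc_union_Ioi_eq_Ioi zero_le_one]
    refine IntegrableOn.union ?_ ?_
    · have h2 : IntegrableOn (fun z : ℝ => clam * z ^ (-lam)) (Ioc 0 1) :=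
        ((intervalIntegral.intervalIntegrable_rpow' (a := 0) (b := 1) (r := -lam)
          (by linarith)).const_mul clam).1
      refine h2.congr_fun (fun z hz => ?_) measurableSet_Ioc
      have hz0 : 0 < z := hz.1
      simp only
      rw [abs_of_pos hz0, min_eq_right hz.2, Real.rpow_add hz0, Real.rpow_one, Real.rpow_neg hz0.le]
      have := (Real.rpow_pos_of_pos hz0 lam).ne'
      field_simp
    · have h2 : IntegrableOn (fun z : ℝ => clam * z ^ (-(1 + lam))) (Ioi 1) :=
        (integrableOn_Ioi_rpow_of_lt (by linarith) zero_lt_one).const_mul clam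
      refine h2.congr_fun (fun z hz => ?_) measurableSet_Ioi
      have hz1 : 1 < z := hz
      simp only
      rw [abs_of_pos (by linarith), min_eq_left hz1.le, Real.rpow_neg (by linarith)]
      ring
  rw [← integrableOn_univ, ← Iio_union_Ici (a := (0 : ℝ))]
  refine IntegrableOn.union ?_ (Iff.mpr integrableOn_Ici_iff_integrableOn_Ioi hpos)
  have := IntegrableOn.comp_neg_Iio (c := (0 : ℝ)) (by simpa using hpos)
  simpa using this

theorem fracLap_eq_nonlocal (hclam : 0 < clam) (w : ℝ → ℝ) (x : ℝ) :
    clam * ∫ z, (w (x + z) - w x) / |z| ^ (1 + lam) = nonlocal (levyMeasure lam clam) w x := by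
  rw [nonlocal, levyMeasure, integral_withDensity_eq_integral_toReal_smul
    (measurable_levyDensity lam clam) (ae_of_all _ fun _ => ENNReal.ofReal_lt_top),
    ← integral_const_mul]
  refine integral_congr_ae (ae_of_all _ fun z => ?_)
  simp only
  rw [ENNReal.toReal_ofReal (by positivity), smul_eq_mul]
  ring

end

theorem RegL1.of_eVariationOn {w : ℝ → ℝ} {M B : ℝ} (hM : ∀ x, |w x| ≤ M) (hw : Integrable w)
    (hB : 0 ≤ B) (h : eVariationOn w univ ≤ ENNReal.ofReal B) :
    RegL1 M (∫ x, |w x|) B w := by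
  obtain ⟨V, hV, -, hd⟩ := exists_monotone_dominating hB h
  exact ⟨measurable_of_monotone_dominating hV hd, hM, hw, le_rfl,
    fun z => (integral_abs_translate_sub_le hB h z).2⟩

theorem exists_isBVEntropySol {lam clam : ℝ} (hlam : lam ∈ Ioo (0 : ℝ) 1) (hclam : 0 < clam)
    {f : ℝ → ℝ} {L : ℝ} (hf : ∀ a b, |f a - f b| ≤ L * |a - b|) (hL : 0 ≤ L) {T : ℝ} (hT : 0 < T)
    {u₀ : ℝ → ℝ} (hu₀ : Integrable u₀) (hbv : BoundedVariationOn u₀ univ) :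
    ∃ u, IsBVEntropySol lam clam T f u₀ u := by
  have hν := integrable_levyMeasure hlam hclam
  set B := (eVariationOn u₀ univ).toReal with hB
  have hB0 : 0 ≤ B := ENNReal.toReal_nonneg
  have hvar : eVariationOn u₀ univ ≤ ENNReal.ofReal B := (ENNReal.ofReal_toReal hbv).ge
  have hM : ∀ x, |u₀ x| ≤ |u₀ 0| + B := fun x => by
    have h1 := hbv.dist_le (mem_univ x) (mem_univ (0 : ℝ))
    rw [Real.dist_eq] at h1
    have h2 := abs_sub_abs_le_abs_sub (u₀ x) (u₀ 0)
    linarith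
  obtain ⟨C₀, hC₀, u, hreg, huvar, hut, hu0, hinc⟩ :=
    exists_limit_solution hf hL hν (RegL1.of_eVariationOn hM hu₀ hB0 hvar)
  have hlip : ∀ s t, ∫ x, |u (max s 0) x - u (max t 0) x| ≤ C₀ * |s - t| := fun s t => by
    have h1 : |max s 0 - max t 0| ≤ |s - t| := abs_max_sub_max_le_abs s t 0
    rcases le_total (max s 0) (max t 0) with h | h
    · have h2 := hut _ _ (le_max_right s 0) h
      simp_rw [fun x => abs_sub_comm (u (max s 0) x) (u (max t 0) x)]
      rw [abs_sub_comm, abs_of_nonneg (sub_nonneg.2 h)] at h1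
      exact h2.trans (mul_le_mul_of_nonneg_left h1 hC₀)
    · have h2 := hut _ _ (le_max_right t 0) h
      rw [abs_of_nonneg (sub_nonneg.2 h)] at h1
      exact h2.trans (mul_le_mul_of_nonneg_left h1 hC₀)
  have hcurve : Curve (|u₀ 0| + B) (∫ x, |u₀ x|) B fun t => u (max t 0) := by
    refine ⟨fun t => hreg _, fun t => ?_⟩
    refine squeeze_zero (fun s => integral_nonneg fun x => abs_nonneg _) (fun s => hlip s t) ?_
    have : Tendsto (fun s => C₀ * |s - t|) (𝓝 t) (𝓝 (C₀ * |t - t|)) :=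
      Continuous.tendsto (by fun_prop) t
    simpa using this
  refine ⟨fun t => u (max t 0), ⟨_, fun t _ x => (hreg _).bdd x⟩, fun t _ => (hreg _).int,
    fun t _ ε hε => ?_, ⟨B, fun t _ => huvar _⟩, fun k ψ hψ hs h0 => ?_⟩
  · refine ⟨ε / (C₀ + 1), by positivity, fun s _ hst => ?_⟩
    refine (hlip s t).trans_lt ?_
    rw [lt_div_iff₀ (by positivity)] at hst
    have := abs_nonneg (s - t)
    nlinarith
  · obtain ⟨R, C, hφ⟩ := exists_timeTestFn hψ hs h0
    have main := entropy_inequality_of_increment (k := k) hf hν hL hcurve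
      (fun δ hδ R C ε hC hε => by
        obtain ⟨K, hK, h⟩ := hinc δ hδ k R C ε hC hε
        refine ⟨K, hK, fun φ φ' hφ s t hs hst => ?_⟩
        rw [max_eq_left hs, max_eq_left (hs.trans hst)]
        exact h φ φ' hφ s t hs hst) hφ hT.le
    have h1 : ∫ x, |u (max 0 0) x - k| * ψ x 0 = ∫ x, |u₀ x - k| * ψ x 0 := by
      rw [max_self]
      exact integral_congr_ae (hu0.mono fun x hx => by simp only; rw [hx])
    rw [h1, intervalIntegral.integral_of_le hT.le, integral_Ioc_eq_integral_Ioo] at main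
    simp only [entropyFunctional, fracLap, fracLap_eq_nonlocal hclam]
    simp only [kruzFlux] at main
    linarith

theorem deriv_smoothTransition_of_nonpos {r : ℝ} (h : r ≤ 0) : deriv Real.smoothTransition r = 0 :=
  IsLocalMin.deriv_eq_zero (Eventually.of_forall fun x => by
    rw [Real.smoothTransition.zero_of_nonpos h]; exact Real.smoothTransition.nonneg x)

theorem deriv_smoothTransition_of_one_le {r : ℝ} (h : 1 ≤ r) : deriv Real.smoothTransition r = 0 :=
  IsLocalMax.deriv_eq_zero (Eventually.of_forall fun x => by
    rw [Real.smoothTransition.one_of_one_le h]; exact Real.smoothTransition.le_one x)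

theorem differentiable_smoothTransition : Differentiable ℝ Real.smoothTransition :=
  (Real.smoothTransition.contDiff (n := 1)).differentiable (by simp)

theorem continuous_deriv_smoothTransition : Continuous (deriv Real.smoothTransition) :=
  (Real.smoothTransition.contDiff (n := 1)).continuous_deriv (by simp)

/-- A smooth ramp from `0` at `a` to `1` at `a + ε`. -/
noncomputable def ramp (a ε t : ℝ) : ℝ := Real.smoothTransition ((t - a) / ε)

/-- The derivative of `ramp`. -/
noncomputable def rampDeriv (a ε t : ℝ) : ℝ := deriv Real.smoothTransition ((t - a) / ε) / ε

section
variable {a ε t T : ℝ} {E : ℝ → ℝ}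

theorem contDiff_ramp : ContDiff ℝ (⊤ : ℕ∞) (ramp a ε) :=
  Real.smoothTransition.contDiff.comp ((contDiff_id.sub contDiff_const).div_const ε)

theorem hasDerivAt_ramp : HasDerivAt (ramp a ε) (rampDeriv a ε t) t := by
  have h1 : HasDerivAt (fun t => (t - a) / ε) (1 / ε) t :=
    ((hasDerivAt_id t).sub_const a).div_const ε
  have h2 := (differentiable_smoothTransition ((t - a) / ε)).hasDerivAt.comp t h1
  rw [rampDeriv, div_eq_mul_one_div]
  exact h2

theorem continuous_rampDeriv : Continuous (rampDeriv a ε) :=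
  (continuous_deriv_smoothTransition.comp
    (by fun_prop : Continuous fun t : ℝ => (t - a) / ε)).div_const ε

theorem ramp_of_le (hε : 0 < ε) (h : t ≤ a) : ramp a ε t = 0 :=
  Real.smoothTransition.zero_of_nonpos (div_nonpos_of_nonpos_of_nonneg (by linarith) hε.le)

theorem ramp_of_ge (hε : 0 < ε) (h : a + ε ≤ t) : ramp a ε t = 1 :=
  Real.smoothTransition.one_of_one_le ((one_le_div hε).2 (by linarith))

theorem rampDeriv_of_le (hε : 0 < ε) (h : t ≤ a) : rampDeriv a ε t = 0 := by
  rw [rampDeriv, deriv_smoothTransition_of_nonpos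
    (div_nonpos_of_nonpos_of_nonneg (by linarith) hε.le), zero_div]

theorem rampDeriv_of_ge (hε : 0 < ε) (h : a + ε ≤ t) : rampDeriv a ε t = 0 := by
  rw [rampDeriv, deriv_smoothTransition_of_one_le ((one_le_div hε).2 (by linarith)), zero_div]

theorem ramp_nonneg (a ε t : ℝ) : 0 ≤ ramp a ε t := Real.smoothTransition.nonneg _

theorem ramp_le_one (a ε t : ℝ) : ramp a ε t ≤ 1 := Real.smoothTransition.le_one _

theorem tendsto_integral_rampDeriv (hE : Continuous E) (ha : 0 ≤ a) (haT : a < T) :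
    Tendsto (fun ε => ∫ t in 0..T, E t * rampDeriv a ε t) (𝓝[>] 0) (𝓝 (E a)) := by
  have hc : Continuous fun ε => ∫ r in (0 : ℝ)..1, E (a + ε * r) * deriv Real.smoothTransition r :=
    intervalIntegral.continuous_parametric_intervalIntegral_of_continuous'
      (by have := continuous_deriv_smoothTransition; fun_prop) 0 1
  have h0 := (hc.tendsto 0).mono_left (nhdsWithin_le_nhds (s := Ioi 0))
  have h1 : ∫ r in (0 : ℝ)..1, E (a + 0 * r) * deriv Real.smoothTransition r = E a := by
    simp only [zero_mul, add_zero, intervalIntegral.integral_const_mul]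
    rw [intervalIntegral.integral_deriv_eq_sub (fun x _ => differentiable_smoothTransition x)
      (continuous_deriv_smoothTransition.intervalIntegrable _ _)]
    simp
  rw [h1] at h0
  refine h0.congr' ?_
  filter_upwards [Ioo_mem_nhdsGT (sub_pos.2 haT)] with ε hε
  have hε0 : 0 < ε := hε.1
  have hsupp : Function.support (fun t => E t * rampDeriv a ε t) ⊆ Ioc a (a + ε) := fun t ht => by
    rw [Function.mem_support] at ht
    constructor
    · by_contra! h
      exact ht (by rw [rampDeriv_of_le hε0 h, mul_zero])
    · by_contra! h
      exact ht (by rw [rampDeriv_of_ge hε0 h.le, mul_zero])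
  rw [intervalIntegral.integral_eq_integral_of_support_subset (hsupp.trans
      (Ioc_subset_Ioc ha (by linarith [hε.2]))),
    ← intervalIntegral.integral_eq_integral_of_support_subset hsupp]
  have h2 := intervalIntegral.smul_integral_comp_add_mul (a := 0) (b := 1)
    (fun t => E t * rampDeriv a ε t) ε a
  simp only [mul_zero, add_zero, mul_one] at h2
  rw [← h2, smul_eq_mul, ← intervalIntegral.integral_const_mul]
  refine intervalIntegral.integral_congr fun r _ => ?_
  simp only [rampDeriv, add_sub_cancel_left]
  rw [mul_div_cancel_left₀ _ hε0.ne']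
  field_simp

theorem tendsto_ramp (a t : ℝ) :
    Tendsto (fun ε => ramp a ε t) (𝓝[>] 0) (𝓝 ((Ioi a).indicator (fun _ => 1) t)) := by
  rcases le_or_gt t a with h | h
  · rw [indicator_of_notMem (by simpa using h)]
    exact tendsto_const_nhds.congr' (eventually_mem_nhdsWithin.mono fun ε hε =>
      (ramp_of_le hε h).symm)
  · rw [indicator_of_mem (by simpa using h)]
    refine tendsto_const_nhds.congr' ?_
    filter_upwards [Ioo_mem_nhdsGT (sub_pos.2 h)] with ε hε
    exact (ramp_of_ge hε.1 (by linarith [hε.2])).symm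

theorem tendsto_integral_mul_ramp {G : ℝ → ℝ} (hG : IntervalIntegrable G volume 0 T) (hT : 0 ≤ T)
    (a : ℝ) : Tendsto (fun ε => ∫ t in 0..T, G t * ramp a ε t) (𝓝[>] 0)
      (𝓝 (∫ t in 0..T, G t * (Ioi a).indicator (fun _ => 1) t)) := by
  refine intervalIntegral.tendsto_integral_filter_of_dominated_convergence (fun t => |G t|)
    (Eventually.of_forall fun ε => ?_) (Eventually.of_forall fun ε => ae_of_all _ fun t _ => ?_)
    hG.abs (ae_of_all _ fun t _ => (tendsto_ramp a t).const_mul _)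
  · rw [uIoc_of_le hT]
    exact hG.1.aestronglyMeasurable.mul contDiff_ramp.continuous.aestronglyMeasurable
  · rw [Real.norm_eq_abs, abs_mul, abs_of_nonneg (ramp_nonneg a ε t)]
    exact mul_le_of_le_one_right (abs_nonneg _) (ramp_le_one a ε t)

theorem ramp_sub_ramp_le {b : ℝ} (hε : 0 < ε) (hab : a ≤ b) (t : ℝ) :
    0 ≤ ramp a ε t - ramp b ε t :=
  sub_nonneg.2 (Real.smoothTransition.monotone (div_le_div_of_nonneg_right (by linarith) hε.le))

theorem hasCompactSupport_ramp_sub {b : ℝ} (hε : 0 < ε) (hab : a ≤ b) :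
    HasCompactSupport fun t => ramp a ε t - ramp b ε t :=
  HasCompactSupport.of_support_subset_isCompact (isCompact_Icc (a := a) (b := b + ε)) fun t ht => by
    rw [Function.mem_support] at ht
    constructor
    · by_contra! h
      exact ht (by rw [ramp_of_le hε h.le, ramp_of_le hε (by linarith), sub_zero])
    · by_contra! h
      exact ht (by rw [ramp_of_ge hε (by linarith), ramp_of_ge hε h.le, sub_self])

theorem le_integral_of_test_functions {G : ℝ → ℝ} {E₀ : ℝ} (hT : 0 < T) (hE : Continuous E)
    (hG : IntervalIntegrable G volume 0 T)
    (h : ∀ θ : ℝ → ℝ, ContDiff ℝ (⊤ : ℕ∞) θ → HasCompactSupport θ → (∀ t, 0 ≤ θ t) →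
      0 ≤ (∫ t in 0..T, (E t * deriv θ t + G t * θ t)) + E₀ * θ 0 - E T * θ T) :
    E 0 ≤ E₀ ∧ ∀ a b, 0 ≤ a → a ≤ b → b ≤ T → E b - E a ≤ ∫ t in a..b, G t := by
  have hGm : ∀ a, IntervalIntegrable (fun t => G t * (Ioi a).indicator (fun _ => 1) t) volume 0 T :=
    fun a => by
      have h1 : (fun t => G t * (Ioi a).indicator (fun _ => 1) t) = (Ioi a).indicator G := by
        ext t; by_cases ht : t ∈ Ioi a <;> simp [ht]
      rw [h1]
      rw [intervalIntegrable_iff_integrableOn_Ioc_of_le hT.le] at hG ⊢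
      exact hG.indicator measurableSet_Ioi
  have hGe : ∀ a, 0 ≤ a → a ≤ T →
      ∫ t in 0..T, G t * (Ioi a).indicator (fun _ => 1) t = ∫ t in a..T, G t := fun a ha haT => by
    have h1 : (fun t => G t * (Ioi a).indicator (fun _ => 1) t) = (Ioi a).indicator G := by
      ext t; by_cases ht : t ∈ Ioi a <;> simp [ht]
    rw [h1, intervalIntegral.integral_of_le hT.le, intervalIntegral.integral_of_le haT,
      setIntegral_indicator measurableSet_Ioi]
    congr 2
    ext t
    simp only [mem_inter_iff, mem_Ioc, mem_Ioi]
    constructor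
    · rintro ⟨⟨h1, h2⟩, h3⟩; exact ⟨h3, h2⟩
    · rintro ⟨h1, h2⟩; exact ⟨⟨by linarith, h2⟩, h1⟩
  have hsub : ∀ a b, 0 ≤ a → a ≤ b → b ≤ T →
      (∫ t in a..T, G t) - ∫ t in b..T, G t = ∫ t in a..b, G t := fun a b ha hab hbT => by
    have h1 : IntervalIntegrable G volume a b := hG.mono_set (by
      rw [uIcc_of_le hab, uIcc_of_le hT.le]; exact Icc_subset_Icc ha hbT)
    have h2 : IntervalIntegrable G volume b T := hG.mono_set (by
      rw [uIcc_of_le hbT, uIcc_of_le hT.le]; exact Icc_subset_Icc (ha.trans hab) le_rfl)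
    rw [← intervalIntegral.integral_add_adjacent_intervals h1 h2]; ring
  have key : ∀ a b ε, a ≤ b → 0 ≤ b → b < T → ε ∈ Ioo 0 (T - b) →
      0 ≤ (∫ t in 0..T, E t * rampDeriv a ε t) - (∫ t in 0..T, E t * rampDeriv b ε t) +
        ((∫ t in 0..T, G t * ramp a ε t) - ∫ t in 0..T, G t * ramp b ε t) + E₀ * ramp a ε 0 :=
    fun a b ε hab hb hbT hε => by
      have hε0 := hε.1
      have h1 := h (fun t => ramp a ε t - ramp b ε t) (contDiff_ramp.sub contDiff_ramp)
        (hasCompactSupport_ramp_sub hε0 hab) (ramp_sub_ramp_le hε0 hab)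
      have h2 : ∀ t, deriv (fun t => ramp a ε t - ramp b ε t) t =
          rampDeriv a ε t - rampDeriv b ε t := fun t => (hasDerivAt_ramp.sub hasDerivAt_ramp).deriv
      simp only [h2] at h1
      rw [ramp_of_ge hε0 (by linarith [hε.2] : b + ε ≤ T),
        ramp_of_ge hε0 (by linarith [hε.2] : a + ε ≤ T), ramp_of_le hε0 hb, sub_self, mul_zero,
        sub_zero, sub_zero] at h1
      have hi : ∀ c, IntervalIntegrable (fun t => E t * rampDeriv c ε t) volume 0 T := fun c =>
        (hE.mul continuous_rampDeriv).intervalIntegrable _ _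
      have hj : ∀ c, IntervalIntegrable (fun t => G t * ramp c ε t) volume 0 T := fun c =>
        hG.mul_continuousOn contDiff_ramp.continuous.continuousOn
      rw [← intervalIntegral.integral_sub (hi a) (hi b),
        ← intervalIntegral.integral_sub (hj a) (hj b),
        ← intervalIntegral.integral_add ((hi a).sub (hi b)) ((hj a).sub (hj b))]
      simpa only [mul_sub] using h1
  have lim : ∀ a b, 0 ≤ a → a ≤ b → b < T → E b - E a ≤ ∫ t in a..b, G t := fun a b ha hab hbT => by
    have h1 := (((tendsto_integral_rampDeriv hE ha (hab.trans_lt hbT)).sub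
      (tendsto_integral_rampDeriv hE (ha.trans hab) hbT)).add
      ((tendsto_integral_mul_ramp hG hT.le a).sub (tendsto_integral_mul_ramp hG hT.le b)))
    have h2 := ge_of_tendsto h1 (b := 0) (by
      filter_upwards [Ioo_mem_nhdsGT (sub_pos.2 hbT)] with ε hε
      have := key a b ε hab (ha.trans hab) hbT hε
      rwa [ramp_of_le hε.1 ha, mul_zero, add_zero] at this)
    rw [hGe a ha (hab.trans hbT.le), hGe b (ha.trans hab) hbT.le, hsub a b ha hab hbT.le] at h2
    linarith
  have hprim : ContinuousOn (fun b => ∫ t in 0..b, G t) (Icc 0 T) := by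
    have := intervalIntegral.continuousOn_primitive_interval' hG (left_mem_uIcc)
    rwa [uIcc_of_le hT.le] at this
  refine ⟨?_, fun a b ha hab hbT => ?_⟩
  · have h3 : ∀ b, 0 ≤ b → b < T → E b - ∫ t in 0..b, G t ≤ E₀ := fun b hb hbT => by
      have h1 := ((tendsto_integral_rampDeriv hE hb hbT).neg.add
        ((tendsto_integral_mul_ramp hG hT.le (-2)).sub (tendsto_integral_mul_ramp hG hT.le b)))
      have h2 := ge_of_tendsto h1 (b := -E₀) (by
        filter_upwards [Ioo_mem_nhdsGT (sub_pos.2 hbT), Ioo_mem_nhdsGT (zero_lt_one)] with ε hε hε'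
        have h4 := key (-2) b ε (by linarith) hb hbT hε
        have h5 : ∫ t in 0..T, E t * rampDeriv (-2) ε t = 0 := by
          rw [intervalIntegral.integral_congr (g := fun _ => 0) fun t ht => ?_]
          · simp
          · rw [uIcc_of_le hT.le] at ht
            simp only
            rw [rampDeriv_of_ge hε.1 (by linarith [hε'.2, ht.1]), mul_zero]
        rw [ramp_of_ge hε.1 (by linarith [hε'.2]), h5] at h4
        linarith)
      have h6 : ∫ t in 0..T, G t * (Ioi (-2)).indicator (fun _ => 1) t = ∫ t in 0..T, G t := by
        refine intervalIntegral.integral_congr fun t ht => ?_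
        rw [uIcc_of_le hT.le] at ht
        rw [indicator_of_mem (by simp only [mem_Ioi]; linarith [ht.1]), mul_one]
      rw [h6, hGe b hb hbT.le, hsub 0 b le_rfl hb hbT.le] at h2
      linarith
    have := h3 0 le_rfl hT
    simpa using this
  · rcases hbT.lt_or_eq with hb | rfl
    · exact lim a b ha hab hb
    · rcases hab.lt_or_eq with h1 | rfl
      · have hadd : ∀ c ∈ Icc a b, (∫ t in 0..c, G t) - (∫ t in 0..a, G t) = ∫ t in a..c, G t :=
          fun c hc => by
            rw [← hsub a c ha hc.1 hc.2, ← hsub 0 c le_rfl (ha.trans hc.1) hc.2,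
              ← hsub 0 a le_rfl ha hab]
            ring
        have hc : ContinuousOn (fun c => (∫ t in 0..c, G t) - (∫ t in 0..a, G t) - (E c - E a))
            (Icc 0 b) := (hprim.sub continuousOn_const).sub (by fun_prop)
        have h2 : Tendsto _ (𝓝[<] b) _ := (hc b ⟨hT.le, le_rfl⟩).mono_left
          (nhdsWithin_le_of_mem (mem_of_superset (Ioo_mem_nhdsLT hT) Ioo_subset_Icc_self))
        have h3 := ge_of_tendsto h2 (b := 0) (by
          filter_upwards [Ioo_mem_nhdsLT h1] with c hc
          rw [hadd c ⟨hc.1.le, hc.2.le⟩]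
          linarith [lim a c ha hc.1.le hc.2])
        beta_reduce at h3
        rw [hadd b ⟨hab, le_rfl⟩] at h3
        linarith
      · simp
end

section
variable {f : ℝ → ℝ} {L : ℝ} (hf : ∀ a b, |f a - f b| ≤ L * |a - b|) {ν : Measure ℝ} [SFinite ν]
  {M N B R C δ k : ℝ} {w φ φ' : ℝ → ℝ} {u : ℝ → ℝ → ℝ}
include hf

theorem continuous_prodInt_level (hν : Integrable (fun z : ℝ => min 1 |z|) ν) (hL : 0 ≤ L)
    (hδ : 0 < δ) (hw : RegL1 M N B w) (hq : Cutoff R C φ') (hr : Cutoff R C φ) :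
    Continuous fun k => prodInt ν f δ k w φ' φ := by
  have hi := hq.integrable
  have hj : Integrable fun x => nonlocal ν w x * φ x :=
    hr.integrable_mul (hw.nonlocal_int hν).integrableOn
  refine continuous_of_abs_sub_le
    (L := ∫ x, (L * |φ' x| + δ⁻¹ * |nonlocal ν w x * φ x|)) fun a b => ?_
  unfold prodInt
  rw [← integral_sub (integrable_prodInt hf hν hL hδ hw hq hr)
    (integrable_prodInt hf hν hL hδ hw hq hr), ← integral_mul_const]
  refine (abs_integral_le_integral_abs).trans (integral_mono_of_nonneg
    (ae_of_all _ fun _ => abs_nonneg _)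
    (((hi.abs.const_mul _).add (hj.abs.const_mul _)).mul_const _) (ae_of_all _ fun x => ?_))
  have h1 := mul_le_mul_of_nonneg_right (abs_fluxAvg_sub_le' hf hδ a b (w x)) (abs_nonneg (φ' x))
  have h2 := mul_le_mul_of_nonneg_right (abs_sgnAvg_sub_le hδ (w x - a) (w x - b))
    (abs_nonneg (nonlocal ν w x * φ x))
  rw [← abs_mul] at h1 h2
  rw [show w x - a - (w x - b) = b - a by ring, abs_sub_comm b a] at h2
  have h3 := abs_add_le ((fluxAvg f δ a (w x) - fluxAvg f δ b (w x)) * φ' x)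
    ((sgnAvg δ (w x - a) - sgnAvg δ (w x - b)) * (nonlocal ν w x * φ x))
  simp only
  rw [show fluxAvg f δ a (w x) * φ' x + sgnAvg δ (w x - a) * nonlocal ν w x * φ x -
    (fluxAvg f δ b (w x) * φ' x + sgnAvg δ (w x - b) * nonlocal ν w x * φ x) =
    (fluxAvg f δ a (w x) - fluxAvg f δ b (w x)) * φ' x +
    (sgnAvg δ (w x - a) - sgnAvg δ (w x - b)) * (nonlocal ν w x * φ x) by ring]
  linarith

theorem Curve.measurable_production (hν : Integrable (fun z : ℝ => min 1 |z|) ν) (hL : 0 ≤ L)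
    (hu : Curve M N B u) (hq : Cutoff R C φ') (hr : Cutoff R C φ) :
    Measurable fun p : ℝ × ℝ => ∫ x, (kruzFlux f p.1 (u p.2 x) * φ' x +
        Real.sign (u p.2 x - p.1) * nonlocal ν (u p.2) x * φ x) := by
  have hs : Tendsto (fun n : ℕ => 1 / ((n : ℝ) + 1)) atTop (𝓝[>] 0) :=
    tendsto_nhdsWithin_iff.2 ⟨tendsto_one_div_add_atTop_nhds_zero_nat,
      Eventually.of_forall fun n => by simp only [mem_Ioi]; positivity⟩
  refine measurable_of_tendsto_metrizable
    (f := fun (n : ℕ) (p : ℝ × ℝ) => prodInt ν f (1 / ((n : ℝ) + 1)) p.1 (u p.2) φ' φ)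
    (fun n => ?_) (tendsto_pi_nhds.2 fun p =>
      (tendsto_prodInt hf hν hL (hu.reg p.2) hq hr).comp hs)
  have hδ : (0 : ℝ) < 1 / ((n : ℝ) + 1) := by positivity
  have hq' : TimeCutoff R C fun _ => φ' :=
    ⟨fun _ => hq, fun t ε hε => Eventually.of_forall fun s x => by simpa using hε.le⟩
  have hr' : TimeCutoff R C fun _ => φ :=
    ⟨fun _ => hr, fun t ε hε => Eventually.of_forall fun s x => by simpa using hε.le⟩
  exact measurable_uncurry_of_continuous_of_measurable
    (u := fun k t => prodInt ν f (1 / ((n : ℝ) + 1)) k (u t) φ' φ)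
    (fun t => continuous_prodInt_level hf hν hL hδ (hu.reg t) hq hr)
    (fun k => (hu.continuous_prodInt hf hν hL hδ hq' hr').measurable)

theorem RegL1.abs_production_le (hν : Integrable (fun z : ℝ => min 1 |z|) ν) (hL : 0 ≤ L)
    (hw : RegL1 M N B w) (hq : Cutoff R C φ') (hr : Cutoff R C φ) :
    |∫ x, (kruzFlux f k (w x) * φ' x + Real.sign (w x - k) * nonlocal ν w x * φ x)| ≤
      C * (L * (M + |k| + 1) * (2 * |R|) + (B + 2 * N) * ∫ z, min 1 |z| ∂ν) := by
  refine le_of_tendsto (tendsto_prodInt hf hν hL hw hq hr).abs ?_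
  filter_upwards [Ioo_mem_nhdsGT (zero_lt_one (α := ℝ))] with δ hδ
  refine (abs_prodInt_le hf hν hL hδ.1 hw hq hr).trans ?_
  have := hq.nonneg
  gcongr
  exact hδ.2.le

theorem Curve.intervalIntegrable_production (hν : Integrable (fun z : ℝ => min 1 |z|) ν)
    (hL : 0 ≤ L) (hu : Curve M N B u) (hq : Cutoff R C φ') (hr : Cutoff R C φ) (a b : ℝ) :
    IntervalIntegrable (fun t => ∫ x, (kruzFlux f k (u t x) * φ' x +
        Real.sign (u t x - k) * nonlocal ν (u t) x * φ x)) volume a b := by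
  have hm := (hu.measurable_production hf hν hL hq hr).comp (measurable_prodMk_left (x := k))
  exact (intervalIntegrable_const (c := C * (L * (M + |k| + 1) * (2 * |R|) +
    (B + 2 * N) * ∫ z, min 1 |z| ∂ν))).mono_fun hm.aestronglyMeasurable (ae_of_all _ fun t => by
      refine ((hu.reg t).abs_production_le (k := k) hf hν hL hq hr).trans (le_abs_self _))
end

theorem IsBVEntropySol.exists_curve {lam clam T : ℝ} {f u₀ : ℝ → ℝ} {v : ℝ → ℝ → ℝ}
    (h : IsBVEntropySol lam clam T f u₀ v) (hT : 0 ≤ T) :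
    ∃ M N B, Curve M N B fun t => v (projIcc 0 T hT t) := by
  obtain ⟨⟨M, hM⟩, hi, hc, ⟨B, hB⟩, -⟩ := h
  have hcont : ∀ t, Tendsto (fun s => ∫ x, |v (projIcc 0 T hT s) x - v (projIcc 0 T hT t) x|)
      (𝓝 t) (𝓝 0) := fun t => by
    refine Metric.tendsto_nhds.2 fun ε hε => ?_
    obtain ⟨d, hd, H⟩ := hc _ (projIcc 0 T hT t).2 ε hε
    have h1 : Continuous fun s => (projIcc 0 T hT s : ℝ) :=
      continuous_subtype_val.comp continuous_projIcc
    filter_upwards [Metric.tendsto_nhds.1 (h1.tendsto t) d hd] with s hs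
    rw [Real.dist_0_eq_abs, abs_of_nonneg (integral_nonneg fun x => abs_nonneg _)]
    exact H _ (projIcc 0 T hT s).2 hs
  have hreg : ∀ t, RegL1 M (∫ x, |v (projIcc 0 T hT t) x|) (max B 0) (v (projIcc 0 T hT t)) :=
    fun t => RegL1.of_eVariationOn (hM _ (projIcc 0 T hT t).2) (hi _ (projIcc 0 T hT t).2)
      (le_max_right _ _) ((hB _ (projIcc 0 T hT t).2).trans
        (ENNReal.ofReal_le_ofReal (le_max_left _ _)))
  have hN : Continuous fun t => ∫ x, |v (projIcc 0 T hT t) x| := by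
    refine continuous_of_modulus _ hcont fun t ε hε => ⟨1, Eventually.of_forall fun s => ?_⟩
    have i1 := (hi _ (projIcc 0 T hT s).2)
    have i2 := (hi _ (projIcc 0 T hT t).2)
    rw [← integral_sub i1.abs i2.abs, one_mul]
    refine (abs_integral_le_integral_abs).trans ((integral_mono (i1.abs.sub i2.abs).abs
      (i1.sub i2).abs fun x => abs_abs_sub_abs_le _ _).trans ?_)
    exact le_add_of_nonneg_left hε.le
  obtain ⟨N, hN'⟩ := (isCompact_Icc (a := 0) (b := T)).bddAbove_image hN.continuousOn
  refine ⟨M, N, max B 0, fun t => ?_, hcont⟩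
  have h1 := hN' ⟨projIcc 0 T hT t, (projIcc 0 T hT t).2, rfl⟩
  simp only [projIcc_val] at h1
  exact ⟨(hreg t).meas, (hreg t).bdd, (hreg t).int, h1, (hreg t).trans⟩

theorem IsBVEntropySol.kruzkov_inequality {lam clam T : ℝ} {f u₀ : ℝ → ℝ} {v : ℝ → ℝ → ℝ}
    (hlam : lam ∈ Ioo (0 : ℝ) 1) (hclam : 0 < clam)
    {L : ℝ} (hf : ∀ a b, |f a - f b| ≤ L * |a - b|) (hL : 0 ≤ L)
    (h : IsBVEntropySol lam clam T f u₀ v) (hT : 0 < T) {M N B : ℝ}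
    (hc : Curve M N B fun t => v (projIcc 0 T hT.le t)) {R C : ℝ} {φ : ℝ → ℝ}
    (hφ : ContDiff ℝ (⊤ : ℕ∞) φ) (hφs : HasCompactSupport φ) (hφ0 : ∀ x, 0 ≤ φ x)
    (hφc : Cutoff R C φ) (hφc' : Cutoff R C (deriv φ)) (k : ℝ) :
    ∫ x, |v 0 x - k| * φ x ≤ ∫ x, |u₀ x - k| * φ x ∧ ∀ a b, 0 ≤ a → a ≤ b → b ≤ T →
      (∫ x, |v (projIcc 0 T hT.le b) x - k| * φ x) -
        (∫ x, |v (projIcc 0 T hT.le a) x - k| * φ x) ≤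
      ∫ t in a..b, ∫ x, (kruzFlux f k (v (projIcc 0 T hT.le t) x) * deriv φ x +
        Real.sign (v (projIcc 0 T hT.le t) x - k) *
          nonlocal (levyMeasure lam clam) (v (projIcc 0 T hT.le t)) x * φ x) := by
  have hν := integrable_levyMeasure hlam hclam
  set E : ℝ → ℝ := fun t => ∫ x, |v (projIcc 0 T hT.le t) x - k| * φ x with hE
  have hEc : Continuous E := by
    refine continuous_of_modulus _ hc.cont fun t ε hε => ⟨C, Eventually.of_forall fun s => ?_⟩
    rw [hE, ← integral_sub ((hc.reg s).integrable_abs_sub_mul hφc)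
      ((hc.reg t).integrable_abs_sub_mul hφc), ← integral_const_mul]
    refine (abs_integral_le_integral_abs).trans ((integral_mono_of_nonneg
      (ae_of_all _ fun x => abs_nonneg _)
      (((hc.reg s).int.sub (hc.reg t).int).abs.const_mul C) (ae_of_all _ fun x => ?_)).trans
      (le_add_of_nonneg_left hε.le))
    simp only
    rw [← sub_mul, abs_mul, mul_comm]
    refine mul_le_mul (hφc.bdd x) ?_ (abs_nonneg _) hφc.nonneg
    refine (abs_abs_sub_abs_le _ _).trans_eq ?_
    congr 1; simp only [Pi.sub_apply]; ring
  have hproj : ∀ t ∈ Icc 0 T, (projIcc 0 T hT.le t : ℝ) = t := fun t ht => by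
    rw [projIcc_of_mem hT.le ht]
  have main := le_integral_of_test_functions (E₀ := ∫ x, |u₀ x - k| * φ x) hT hEc
    (hc.intervalIntegrable_production (k := k) hf hν hL hφc' hφc 0 T) fun θ hθ hθs hθ0 => by
      have h1 := h.2.2.2.2 k (fun x t => θ t * φ x)
        ((hθ.comp contDiff_snd).mul (hφ.comp contDiff_fst)) ?_
        fun x t => mul_nonneg (hθ0 t) (hφ0 x)
      · have hd1 : ∀ x t, deriv (fun τ => θ τ * φ x) t = deriv θ t * φ x := fun x t =>
          deriv_mul_const_field _
        have hd2 : ∀ x t, deriv (fun y => θ t * φ y) x = θ t * deriv φ x := fun x t =>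
          deriv_const_mul_field _
        simp only [entropyFunctional, hd1, hd2, fracLap, fracLap_eq_nonlocal hclam] at h1
        rw [intervalIntegral.integral_of_le hT.le, integral_Ioc_eq_integral_Ioo]
        have e0 : ∀ c (g : ℝ → ℝ), ∫ x, g x * (c * φ x) = (∫ x, g x * φ x) * c := fun c g => by
          rw [← integral_mul_const]; congr 1; ext x; ring
        rw [e0, e0] at h1
        rw [hE]
        simp only [hproj T ⟨hT.le, le_rfl⟩]
        refine h1.trans_eq ?_
        congr 2
        refine setIntegral_congr_fun measurableSet_Ioo fun t ht => ?_
        have hr := hc.reg t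
        have i1 := (hr.integrable_abs_sub_mul (k := k) hφc).mul_const (deriv θ t)
        have i2 := (hr.integrable_production (k := k) hf hν hφc' hφc).mul_const (θ t)
        rw [← integral_mul_const, ← integral_mul_const, ← integral_add i1 i2,
          hproj t ⟨ht.1.le, ht.2.le⟩]
        congr 1; ext x
        rw [kruzFlux]; ring
      · refine HasCompactSupport.of_support_subset_isCompact (hφs.isCompact.prod hθs.isCompact)
          fun q hq => ?_
        rw [Function.mem_support] at hq
        exact ⟨subset_tsupport _ (right_ne_zero_of_mul hq),
          subset_tsupport _ (left_ne_zero_of_mul hq)⟩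
  refine ⟨?_, main.2⟩
  have := main.1
  rw [hE] at this
  simpa only [hproj 0 ⟨le_rfl, hT.le⟩] using this

theorem avg_integral_swap {δ : ℝ} (hδ : 0 < δ) {X : Type*} [MeasurableSpace X]
    {μ : Measure X} [SFinite μ]
    {F : ℝ → X → ℝ} (hF : Measurable (Function.uncurry F)) {g : X → ℝ} (hg : Integrable g μ)
    (h : ∀ κ ∈ Icc (-δ) δ, ∀ x, |F κ x| ≤ g x) :
    IntervalIntegrable (fun κ => ∫ x, F κ x ∂μ) volume (-δ) δ ∧
      ∫ x, avg δ (fun κ => F κ x) ∂μ = avg δ fun κ => ∫ x, F κ x ∂μ := by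
  have hle : -δ ≤ δ := by linarith
  have hi : Integrable (Function.uncurry F) ((volume.restrict (Ioc (-δ) δ)).prod μ) := by
    refine (hg.comp_snd (volume.restrict (Ioc (-δ) δ))).mono' hF.aestronglyMeasurable ?_
    have h1 : ∀ᵐ p : ℝ × X ∂(volume.restrict (Ioc (-δ) δ)).prod μ, p.1 ∈ Ioc (-δ) δ :=
      Measure.quasiMeasurePreserving_fst.ae (ae_restrict_mem measurableSet_Ioc)
    filter_upwards [h1] with p hp
    exact h p.1 ⟨hp.1.le, hp.2⟩ p.2
  refine ⟨(intervalIntegrable_iff_integrableOn_Ioc_of_le hle).2 hi.integral_prod_left, ?_⟩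
  unfold avg
  simp_rw [intervalIntegral.integral_of_le hle]
  rw [integral_const_mul, integral_integral_swap hi]

theorem measurable_real_sign : Measurable Real.sign := monotone_sign.measurable

section
variable {f : ℝ → ℝ} {L : ℝ} (hf : ∀ a b, |f a - f b| ≤ L * |a - b|) {ν : Measure ℝ} [SFinite ν]
  {M N B R C δ k T : ℝ} {w φ φ' : ℝ → ℝ} {u : ℝ → ℝ → ℝ}

theorem RegL1.abs_sub_level_le (hw : RegL1 M N B w) (x : ℝ) {κ : ℝ} (hκ : κ ∈ Icc (-δ) δ) :
    |w x - (k + κ)| ≤ M + |k| + δ := by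
  have h1 := abs_sub (w x) (k + κ)
  have h2 := abs_add_le k κ
  have h3 : |κ| ≤ δ := abs_le.2 hκ
  have h4 := hw.bdd x
  linarith

theorem entInt_eq_avg (hδ : 0 < δ) (hw : RegL1 M N B w) (hφ : Cutoff R C φ) :
    IntervalIntegrable (fun κ => ∫ x, |w x - (k + κ)| * φ x) volume (-δ) δ ∧
      entInt δ k w φ = avg δ fun κ => ∫ x, |w x - (k + κ)| * φ x := by
  have hm := hw.meas
  have hp := hφ.meas
  have h1 := avg_integral_swap hδ (F := fun κ x => |w x - (k + κ)| * φ x) (μ := volume)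
    (by have : Measurable fun p : ℝ × ℝ => |w p.2 - (k + p.1)| * φ p.2 := by
          have : Measurable fun p : ℝ × ℝ => w p.2 - (k + p.1) := by fun_prop
          fun_prop
        exact this)
    (g := fun x => (M + |k| + δ) * |φ x|) (hφ.integrable.abs.const_mul _) fun κ hκ x => by
      rw [abs_mul, abs_abs]
      exact mul_le_mul_of_nonneg_right (hw.abs_sub_level_le x hκ) (abs_nonneg _)
  refine ⟨h1.1, h1.2 ▸ ?_⟩
  unfold entInt ent
  congr 1; ext x
  rw [mul_comm, ← avg_const_mul]
  congr 1; ext κ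
  rw [mul_comm, sub_sub]

include hf

theorem prodInt_eq_avg (hν : Integrable (fun z : ℝ => min 1 |z|) ν) (hL : 0 ≤ L) (hδ : 0 < δ)
    (hw : RegL1 M N B w) (hφ' : Cutoff R C φ') (hφ : Cutoff R C φ) :
    prodInt ν f δ k w φ' φ = avg δ fun κ => ∫ x, (kruzFlux f (k + κ) (w x) * φ' x +
      Real.sign (w x - (k + κ)) * nonlocal ν w x * φ x) := by
  have hm := hw.meas
  have hp := hφ.meas
  have hp' := hφ'.meas
  have hs := measurable_real_sign
  have hfm := (continuous_of_abs_sub_le hf).measurable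
  have hg := measurable_nonlocal (ν := ν) hw.meas
  have hi : Integrable fun x => nonlocal ν w x * φ x :=
    hφ.integrable_mul (hw.nonlocal_int hν).integrableOn
  rw [← (avg_integral_swap hδ (F := fun κ x => kruzFlux f (k + κ) (w x) * φ' x +
    Real.sign (w x - (k + κ)) * nonlocal ν w x * φ x) (μ := volume)
    (by have : Measurable fun p : ℝ × ℝ => Real.sign (w p.2 - (k + p.1)) *
              (f (w p.2) - f (k + p.1)) * φ' p.2 +
            Real.sign (w p.2 - (k + p.1)) * nonlocal ν w p.2 * φ p.2 := by
          have : Measurable fun p : ℝ × ℝ => w p.2 - (k + p.1) := by fun_prop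
          fun_prop
        exact this)
    (g := fun x => L * (M + |k| + δ) * |φ' x| + |nonlocal ν w x * φ x|)
    ((hφ'.integrable.abs.const_mul _).add hi.abs) fun κ hκ x => ?_).2]
  · unfold prodInt fluxAvg sgnAvg
    congr 1; ext x
    rw [mul_assoc, mul_comm, mul_comm (avg δ _), ← avg_const_mul, ← avg_const_mul, ← avg_add]
    · congr 1; ext κ
      rw [sub_sub]; ring
    · exact (intervalIntegrable_kruzFlux hf _ _ _ _).const_mul _
    · exact (intervalIntegrable_sign_sub _ _ _).const_mul _
  · refine (abs_add_le _ _).trans (add_le_add ?_ ?_)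
    · rw [abs_mul]
      refine mul_le_mul_of_nonneg_right ((abs_kruzFlux_le hf _ _).trans ?_) (abs_nonneg _)
      exact mul_le_mul_of_nonneg_left (hw.abs_sub_level_le x hκ) hL
    · rw [mul_assoc, abs_mul]
      exact mul_le_of_le_one_left (abs_nonneg _) (abs_sign_le_one _)

theorem Curve.entInt_sub_le_integral (hν : Integrable (fun z : ℝ => min 1 |z|) ν) (hL : 0 ≤ L)
    (hδ : 0 < δ) (hu : Curve M N B u) (hφ' : Cutoff R C φ') (hφ : Cutoff R C φ) {a b : ℝ}
    (hab : a ≤ b)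
    (h : ∀ k, (∫ x, |u b x - k| * φ x) - (∫ x, |u a x - k| * φ x) ≤
      ∫ t in a..b, ∫ x, (kruzFlux f k (u t x) * φ' x +
        Real.sign (u t x - k) * nonlocal ν (u t) x * φ x)) :
    entInt δ k (u b) φ - entInt δ k (u a) φ ≤ ∫ t in a..b, prodInt ν f δ k (u t) φ' φ := by
  have hM := (hu.reg 0).nonneg_M
  have hC := hφ.nonneg
  obtain ⟨i1, e1⟩ := entInt_eq_avg (k := k) hδ (hu.reg b) hφ
  obtain ⟨i2, e2⟩ := entInt_eq_avg (k := k) hδ (hu.reg a) hφ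
  have hmeas := hu.measurable_production hf hν hL hφ' hφ
  obtain ⟨i3, e3⟩ := avg_integral_swap hδ (μ := volume.restrict (Ioc a b))
    (F := fun κ t => ∫ x, (kruzFlux f (k + κ) (u t x) * φ' x +
        Real.sign (u t x - (k + κ)) * nonlocal ν (u t) x * φ x))
    (hmeas.comp (by fun_prop : Measurable fun p : ℝ × ℝ => (k + p.1, p.2)))
    (g := fun _ => C * (L * (M + (|k| + δ) + 1) * (2 * |R|) + (B + 2 * N) * ∫ z, min 1 |z| ∂ν))
    (integrable_const _) fun κ hκ t => by
      refine ((hu.reg t).abs_production_le (k := k + κ) hf hν hL hφ' hφ).trans ?_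
      have h1 := abs_add_le k κ
      have h2 : |κ| ≤ δ := abs_le.2 hκ
      gcongr
      linarith
  simp_rw [fun t => prodInt_eq_avg (k := k) hf hν hL hδ (hu.reg t) hφ' hφ]
  rw [intervalIntegral.integral_of_le hab, e3, e1, e2, ← avg_sub i1 i2]
  refine avg_mono hδ (i1.sub i2) i3 fun κ => ?_
  rw [← intervalIntegral.integral_of_le hab]
  exact h (k + κ)
end

theorem MeasureTheory.MeasurePreserving.integral_comp_of_aestronglyMeasurable {α β : Type*}
    [MeasurableSpace α] [MeasurableSpace β] {μ : Measure α} {ν : Measure β} {T : α → β}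
    (hT : MeasurePreserving T μ ν) {g : β → ℝ} (hg : AEStronglyMeasurable g ν) :
    ∫ x, g (T x) ∂μ = ∫ y, g y ∂ν := by
  conv_rhs => rw [← hT.map_eq]
  rw [integral_map hT.aemeasurable (by rwa [hT.map_eq])]

section PairKernel

variable {α β κ : ℝ → ℝ}

theorem integrable_snd_mul_kernel (hβ : Integrable β) (hκ : Integrable κ) :
    Integrable (fun p : ℝ × ℝ => β p.2 * κ (p.1 - p.2)) (volume.prod volume) := by
  have h := (measurePreserving_sub_prod (volume : Measure ℝ)
    (volume : Measure ℝ)).integrable_comp_of_integrable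
    (hκ.mul_prod hβ)
  refine h.congr (Eventually.of_forall fun p => ?_)
  simp [mul_comm]

theorem integral_snd_mul_kernel (hβ : Integrable β) (hκ : Integrable κ) :
    ∫ p : ℝ × ℝ, β p.2 * κ (p.1 - p.2) ∂(volume.prod volume) = (∫ y, β y) * ∫ w, κ w := by
  rw [integral_prod_symm _ (integrable_snd_mul_kernel hβ hκ)]
  simp only [integral_const_mul, integral_sub_right_eq_self κ]
  rw [integral_mul_const]

theorem integrable_fst_mul_kernel (hα : Integrable α) (hκ : Integrable κ) :
    Integrable (fun p : ℝ × ℝ => α p.1 * κ (p.1 - p.2)) (volume.prod volume) := by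
  have h := (integrable_snd_mul_kernel hα hκ.comp_neg).swap
  refine h.congr (Eventually.of_forall fun p => ?_)
  simp

theorem integral_fst_mul_kernel (hα : Integrable α) (hκ : Integrable κ) :
    ∫ p : ℝ × ℝ, α p.1 * κ (p.1 - p.2) ∂(volume.prod volume) = (∫ x, α x) * ∫ w, κ w := by
  rw [integral_prod _ (integrable_fst_mul_kernel hα hκ)]
  simp only [integral_const_mul, integral_sub_left_eq_self κ]
  rw [integral_mul_const]

theorem integrable_of_le_kernel (hα : Integrable α) (hβ : Integrable β) (hκ : Integrable κ)
    {h : ℝ × ℝ → ℝ} (hm : Measurable h)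
    (hb : ∀ x y, |h (x, y)| ≤ (α x + β y) * |κ (x - y)|) :
    Integrable h (volume.prod volume) := by
  refine ((integrable_fst_mul_kernel hα hκ.abs).add (integrable_snd_mul_kernel hβ hκ.abs)).mono'
    hm.aestronglyMeasurable (Eventually.of_forall fun p => ?_)
  have := hb p.1 p.2
  simp only [Pi.add_apply, Real.norm_eq_abs, ← add_mul]
  exact this

theorem integral_abs_le_kernel (hα : Integrable α) (hβ : Integrable β) (hκ : Integrable κ)
    {h : ℝ × ℝ → ℝ} (hm : Measurable h)
    (hb : ∀ x y, |h (x, y)| ≤ (α x + β y) * |κ (x - y)|) :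
    ∫ p, |h p| ∂(volume.prod volume) ≤ ((∫ x, α x) + ∫ y, β y) * ∫ w, |κ w| := by
  have i1 := integrable_fst_mul_kernel hα hκ.abs
  have i2 := integrable_snd_mul_kernel hβ hκ.abs
  have := integral_mono (integrable_of_le_kernel hα hβ hκ hm hb).abs (i1.add i2)
    (fun p => by
      have := hb p.1 p.2
      simp only [Pi.add_apply, ← add_mul]
      exact this)
  refine this.trans (le_of_eq ?_)
  simp only [Pi.add_apply]
  rw [integral_add i1 i2, integral_fst_mul_kernel hα hκ.abs, integral_snd_mul_kernel hβ hκ.abs,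
    add_mul]

end PairKernel

section Nonlocal

variable {ν : Measure ℝ} [SFinite ν] {M N B : ℝ} {w : ℝ → ℝ}

theorem exists_nonlocal_global_modulus (hν : Integrable (fun z : ℝ => min 1 |z|) ν) (M N B : ℝ)
    {ε : ℝ} (hε : 0 < ε) :
    ∃ K ≥ 0, ∀ w, RegL1 M N B w → ∫ x, |nonlocal ν w x| ≤ ε + K * ∫ x, |w x| := by
  by_cases hne : ∃ d, RegL1 M N B d
  swap
  · exact ⟨0, le_rfl, fun d hd => (hne ⟨d, hd⟩).elim⟩
  obtain ⟨d₀, hd₀⟩ := hne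
  have hN := hd₀.nonneg_N
  have hB := hd₀.nonneg_B
  set C := B + 2 * N with hC
  have hC0 : 0 ≤ C := by positivity
  obtain ⟨r, hr, hr'⟩ := exists_small_jumps hν (show 0 < ε / (C + 1) by positivity)
  have hfr := (measure_jump_lt_top hν hr).ne
  have hmr : MeasurableSet {z : ℝ | |z| ≤ r} := measurableSet_le measurable_norm measurable_const
  refine ⟨2 * ν.real {z : ℝ | r < |z|}, by positivity, fun w hw => ?_⟩
  obtain ⟨-, h2⟩ := hw.mul_nonlocal hν (s := fun _ => 1) (C := 1) measurable_const (by simp)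
  simp only [one_mul, abs_one] at h2
  refine h2.trans ?_
  set I := ∫ x, |w x| with hI
  have hI0 : 0 ≤ I := integral_nonneg fun _ => abs_nonneg _
  have ib1 : Integrable (fun z => C * {z : ℝ | |z| ≤ r}.indicator (fun z => min 1 |z|) z) ν :=
    (hν.indicator hmr).const_mul _
  have ib2 : Integrable (fun z => {z : ℝ | r < |z|}.indicator (fun _ => 2 * I) z) ν :=
    (integrable_indicator_iff (measurableSet_jump r)).2 (integrableOn_const hfr)
  have hbound : ∀ z, ∫ x, |w (x + z) - w x| ≤
      C * {z : ℝ | |z| ≤ r}.indicator (fun z => min 1 |z|) z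
      + {z : ℝ | r < |z|}.indicator (fun _ => 2 * I) z := by
    intro z
    have p1 : 0 ≤ C * {z : ℝ | |z| ≤ r}.indicator (fun z => min 1 |z|) z :=
      mul_nonneg hC0 (indicator_nonneg (fun _ _ => le_min zero_le_one (abs_nonneg _)) _)
    have p2 : 0 ≤ {z : ℝ | r < |z|}.indicator (fun _ => 2 * I) z :=
      indicator_nonneg (fun _ _ => by positivity) _
    rcases le_or_gt |z| r with hz | hz
    · have := hw.incr_le z
      rw [indicator_of_mem (show z ∈ {z : ℝ | |z| ≤ r} from hz)]
      linarith
    · have : ∫ x, |w (x + z) - w x| ≤ 2 * I := by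
        have i1 : Integrable fun x => |w (x + z)| := (hw.int.comp_add_right z).abs
        refine (integral_mono (hw.incr_int z).abs (i1.add hw.int.abs) fun x => abs_sub _ _).trans ?_
        simp only [Pi.add_apply]
        rw [integral_add i1 hw.int.abs, integral_add_right_eq_self fun x => |w x|]
        linarith
      rw [indicator_of_mem (show z ∈ {z : ℝ | r < |z|} from hz)]
      linarith
  have hint : Integrable (fun z => ∫ x, |w (x + z) - w x|) ν := by
    have := (hw.incr_int_prod hν (s := fun _ => 1) (C := 1) measurable_const
      (by simp)).abs.integral_prod_right
    simpa only [one_mul] using this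
  refine (integral_mono hint (ib1.add ib2) hbound).trans ?_
  simp only [Pi.add_apply]
  rw [integral_add ib1 ib2, integral_const_mul, integral_indicator (measurableSet_jump r)]
  simp only [setIntegral_const, smul_eq_mul]
  have e1 : C * ∫ z, {z : ℝ | |z| ≤ r}.indicator (fun z => min 1 |z|) z ∂ν ≤ ε := by
    have : C * (ε / (C + 1)) ≤ ε := by
      rw [mul_div_assoc', div_le_iff₀ (by positivity)]; nlinarith
    exact (mul_le_mul_of_nonneg_left hr'.le hC0).trans this
  linarith

theorem RegL1.integral_sgnAvg_mul_nonlocal_nonpos {δ : ℝ} (hδ : 0 < δ) (h : RegL1 M N B w)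
    (hν : Integrable (fun z : ℝ => min 1 |z|) ν) :
    ∫ x, sgnAvg δ (w x) * nonlocal ν w x ≤ 0 := by
  have hs : Measurable fun x => sgnAvg δ (w x) := (continuous_sgnAvg hδ).measurable.comp h.meas
  have hsb : ∀ x, |sgnAvg δ (w x)| ≤ 1 := fun x => abs_sgnAvg_le_one hδ _
  have hp := h.incr_int_prod hν hs hsb
  have e : ∀ x, ∫ z, sgnAvg δ (w x) * (w (x + z) - w x) ∂ν = sgnAvg δ (w x) * nonlocal ν w x :=
    fun x => integral_const_mul _ _
  rw [← integral_congr_ae (Eventually.of_forall e)]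
  rw [integral_integral_swap (f := fun x z => sgnAvg δ (w x) * (w (x + z) - w x)) hp]
  refine integral_nonpos fun z => ?_
  have hm : Measurable fun x => ent δ (w x) - ent δ 0 :=
    ((continuous_ent hδ).measurable.comp h.meas).sub_const _
  have hi : Integrable fun x => ent δ (w x) - ent δ 0 := by
    refine h.int.abs.mono' hm.aestronglyMeasurable (Eventually.of_forall fun x => ?_)
    simpa using abs_ent_sub_le hδ (w x) 0
  have hi' := hi.comp_add_right z
  have h1 : ∫ x, sgnAvg δ (w x) * (w (x + z) - w x) ≤
      ∫ x, ((ent δ (w (x + z)) - ent δ 0) - (ent δ (w x) - ent δ 0)) := by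
    refine integral_mono ((h.incr_int z).bdd_mul (c := 1) hs.aestronglyMeasurable
      (Eventually.of_forall hsb)) (hi'.sub hi) fun x => ?_
    have := ent_add_sgnAvg_mul_le hδ (w x) (w (x + z))
    simp only
    linarith
  rw [integral_sub hi' hi, integral_add_right_eq_self fun x => ent δ (w x) - ent δ 0,
    sub_self] at h1
  exact h1

end Nonlocal

theorem min_add_le_min_add_min {δ x y : ℝ} (hδ : 0 ≤ δ) (hx : 0 ≤ x) (hy : 0 ≤ y) :
    min δ (x + y) ≤ min δ x + min δ y := by
  rcases le_total δ x with h | h <;> rcases le_total δ y with h' | h' <;>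
    simp only [min_eq_left, min_eq_right, h, h'] <;>
    first
      | exact (min_le_left _ _).trans (by linarith)
      | exact min_le_right _ _

theorem integrable_min_abs {δ : ℝ} (hδ : 0 ≤ δ) {w : ℝ → ℝ} (hw : Measurable w)
    (h : Integrable w) : Integrable fun x => min δ |w x| :=
  h.abs.mono' (measurable_const.min hw.abs).aestronglyMeasurable (Eventually.of_forall fun x => by
    rw [Real.norm_of_nonneg (le_min hδ (abs_nonneg _))]
    exact min_le_right _ _)

/-- The entropy flux normalized to vanish on the diagonal. -/
noncomputable def diagFlux (f : ℝ → ℝ) (δ k r : ℝ) : ℝ := fluxAvg f δ k r - fluxAvg f δ k k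

section
variable {f : ℝ → ℝ} {L δ : ℝ} (hf : ∀ a b, |f a - f b| ≤ L * |a - b|) (hL : 0 ≤ L) (hδ : 0 < δ)
include hf hL hδ

theorem continuous_fluxAvg_uncurry : Continuous fun p : ℝ × ℝ => fluxAvg f δ p.1 p.2 := by
  have key : ∀ g : ℝ → ℝ, (∀ a b, |g a - g b| ≤ L * |a - b|) → LipschitzWith L.toNNReal g :=
    fun g hg => LipschitzWith.of_dist_le_mul fun a b => by
      rw [Real.dist_eq, Real.dist_eq, Real.coe_toNNReal L hL]
      exact hg a b
  exact (LipschitzWith.uncurry (f := fun k r => fluxAvg f δ k r)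
    (fun r => key _ fun k l => abs_fluxAvg_sub_le' hf hδ k l r)
    fun k => key _ fun a b => abs_fluxAvg_sub_le hf hδ k a b).continuous

theorem measurable_diagFlux {a b : ℝ → ℝ} (ha : Measurable a) (hb : Measurable b) :
    Measurable fun p : ℝ × ℝ => diagFlux f δ (b p.2) (a p.1) := by
  have h := (continuous_fluxAvg_uncurry hf hL hδ).measurable
  exact (h.comp ((hb.comp measurable_snd).prodMk (ha.comp measurable_fst))).sub
    (h.comp ((hb.comp measurable_snd).prodMk (hb.comp measurable_snd)))

omit hL in
theorem abs_diagFlux_le (k r : ℝ) : |diagFlux f δ k r| ≤ L * |r - k| :=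
  abs_fluxAvg_sub_le hf hδ k r k

theorem abs_diagFlux_sub_le (k r k' r' : ℝ) :
    |diagFlux f δ k r - diagFlux f δ k' r'| ≤ 3 * L * (|r - r'| + |k - k'|) := by
  have h1 := abs_fluxAvg_sub_le hf hδ k r r'
  have h2 := abs_fluxAvg_sub_le' hf hδ k k' r'
  have h3 := abs_fluxAvg_sub_le hf hδ k k k'
  have h4 := abs_fluxAvg_sub_le' hf hδ k k' k'
  have h5 : 0 ≤ L * |r - r'| := by positivity
  rw [diagFlux, diagFlux]
  rw [abs_le] at *
  constructor <;> linarith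

theorem abs_diagFlux_sub_swap_le (k r : ℝ) :
    |diagFlux f δ k r - diagFlux f δ r k| ≤ 4 * L * min δ |r| + 4 * L * min δ |k| := by
  have h1 : |diagFlux f δ k r - diagFlux f δ r k| ≤ 4 * L * δ := by
    have a1 := abs_fluxAvg_sub_kruzFlux_le hf hδ hL k r
    have a2 := abs_fluxAvg_sub_kruzFlux_le hf hδ hL r k
    have a3 := abs_fluxAvg_sub_kruzFlux_le hf hδ hL k k
    have a4 := abs_fluxAvg_sub_kruzFlux_le hf hδ hL r r
    rw [kruzFlux_comm f r k] at a2
    rw [show kruzFlux f k k = 0 by simp [kruzFlux]] at a3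
    rw [show kruzFlux f r r = 0 by simp [kruzFlux]] at a4
    rw [diagFlux, diagFlux]
    rw [abs_le] at *
    constructor <;> linarith
  have h2 : |diagFlux f δ k r - diagFlux f δ r k| ≤ 4 * L * (|r| + |k|) := by
    have a1 := abs_diagFlux_le hf hδ k r
    have a2 := abs_diagFlux_le hf hδ r k
    rw [abs_sub_comm k r] at a2
    have a3 := abs_sub (diagFlux f δ k r) (diagFlux f δ r k)
    have a4 := mul_le_mul_of_nonneg_left (abs_sub r k) hL
    have a5 : 0 ≤ L * (|r| + |k|) := by positivity
    linarith
  have h3 := min_add_le_min_add_min hδ.le (abs_nonneg r) (abs_nonneg k)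
  have h4 : |diagFlux f δ k r - diagFlux f δ r k| ≤ 4 * L * min δ (|r| + |k|) := by
    rcases min_choice δ (|r| + |k|) with h | h <;> rw [h] <;> assumption
  have := mul_le_mul_of_nonneg_left h3 (by positivity : 0 ≤ 4 * L)
  linarith

end

/-- The entropy paired with the kernel `ρ (x - y)`. -/
noncomputable def pairEnt (δ : ℝ) (ρ a b : ℝ → ℝ) : ℝ :=
  ∫ p : ℝ × ℝ, (ent δ (a p.1 - b p.2) - ent δ 0) * ρ (p.1 - p.2) ∂(volume.prod volume)

/-- The distance paired with the kernel `ρ (x - y)`. -/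
noncomputable def pairAbs (ρ a b : ℝ → ℝ) : ℝ :=
  ∫ p : ℝ × ℝ, |a p.1 - b p.2| * ρ (p.1 - p.2) ∂(volume.prod volume)

/-- The entropy flux paired with the kernel `κ (x - y)`. -/
noncomputable def pairFlux (f : ℝ → ℝ) (δ : ℝ) (κ a b : ℝ → ℝ) : ℝ :=
  ∫ p : ℝ × ℝ, diagFlux f δ (b p.2) (a p.1) * κ (p.1 - p.2) ∂(volume.prod volume)

/-- The nonlocal entropy production paired with the kernel `ρ (x - y)`. -/
noncomputable def pairDiff (ν : Measure ℝ) (δ : ℝ) (ρ a b : ℝ → ℝ) : ℝ :=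
  ∫ p : ℝ × ℝ, sgnAvg δ (a p.1 - b p.2) * nonlocal ν a p.1 * ρ (p.1 - p.2) ∂(volume.prod volume)

section
variable {M N B M' N' B' M₁ N₁ B₁ M₂ N₂ B₂ δ L : ℝ} {f ρ κ a b a' b' : ℝ → ℝ}

theorem integrable_pairEnt (hδ : 0 < δ) (ha : RegL1 M N B a) (hb : RegL1 M' N' B' b)
    (hρm : Measurable ρ) (hρ : Integrable ρ) :
    Integrable (fun p : ℝ × ℝ => (ent δ (a p.1 - b p.2) - ent δ 0) * ρ (p.1 - p.2))
      (volume.prod volume) := by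
  have h1 := ha.meas
  have h2 := hb.meas
  have h3 := (continuous_ent hδ).measurable
  refine integrable_of_le_kernel ha.int.abs hb.int.abs hρ (by fun_prop) fun x y => ?_
  rw [abs_mul]
  refine mul_le_mul_of_nonneg_right ?_ (abs_nonneg _)
  refine (abs_ent_sub_le hδ _ _).trans ?_
  rw [sub_zero]
  exact abs_sub _ _

theorem integrable_pairAbs (ha : RegL1 M N B a) (hb : RegL1 M' N' B' b)
    (hρm : Measurable ρ) (hρ : Integrable ρ) :
    Integrable (fun p : ℝ × ℝ => |a p.1 - b p.2| * ρ (p.1 - p.2)) (volume.prod volume) := by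
  have h1 := ha.meas
  have h2 := hb.meas
  refine integrable_of_le_kernel ha.int.abs hb.int.abs hρ (by fun_prop) fun x y => ?_
  rw [abs_mul, abs_abs]
  exact mul_le_mul_of_nonneg_right (abs_sub _ _) (abs_nonneg _)

theorem integrable_pairFlux (hf : ∀ a b, |f a - f b| ≤ L * |a - b|) (hL : 0 ≤ L) (hδ : 0 < δ)
    (ha : RegL1 M N B a) (hb : RegL1 M' N' B' b) (hκm : Measurable κ) (hκ : Integrable κ) :
    Integrable (fun p : ℝ × ℝ => diagFlux f δ (b p.2) (a p.1) * κ (p.1 - p.2))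
      (volume.prod volume) := by
  have h3 := measurable_diagFlux hf hL hδ ha.meas hb.meas
  refine integrable_of_le_kernel (ha.int.abs.const_mul L) (hb.int.abs.const_mul L) hκ
    (by fun_prop) fun x y => ?_
  rw [abs_mul, ← mul_add]
  refine mul_le_mul_of_nonneg_right ?_ (abs_nonneg _)
  exact (abs_diagFlux_le hf hδ _ _).trans (mul_le_mul_of_nonneg_left (abs_sub _ _) hL)

theorem integrable_pairDiff {ν : Measure ℝ} [SFinite ν]
    (hν : Integrable (fun z : ℝ => min 1 |z|) ν) (hδ : 0 < δ)
    (ha : RegL1 M N B a) (hb : RegL1 M' N' B' b) (hρm : Measurable ρ) (hρ : Integrable ρ) :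
    Integrable (fun p : ℝ × ℝ => sgnAvg δ (a p.1 - b p.2) * nonlocal ν a p.1 * ρ (p.1 - p.2))
      (volume.prod volume) := by
  have h1 := ha.meas
  have h2 := hb.meas
  have h3 := (continuous_sgnAvg hδ).measurable
  have h4 := measurable_nonlocal (ν := ν) h1
  refine integrable_of_le_kernel (ha.nonlocal_int hν).abs (integrable_zero ℝ ℝ volume) hρ
    (by fun_prop) fun x y => ?_
  rw [abs_mul, abs_mul, Pi.zero_apply, add_zero]
  refine mul_le_mul_of_nonneg_right ?_ (abs_nonneg _)
  exact mul_le_of_le_one_left (abs_nonneg _) (abs_sgnAvg_le_one hδ _)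

theorem abs_pairEnt_sub_le (hδ : 0 < δ) (ha : RegL1 M N B a) (hb : RegL1 M' N' B' b)
    (ha' : RegL1 M₁ N₁ B₁ a') (hb' : RegL1 M₂ N₂ B₂ b') (hρm : Measurable ρ) (hρ : Integrable ρ) :
    |pairEnt δ ρ a b - pairEnt δ ρ a' b'| ≤
      ((∫ x, |a x - a' x|) + ∫ x, |b x - b' x|) * ∫ w, |ρ w| := by
  have h1 := ha.meas
  have h2 := hb.meas
  have h1' := ha'.meas
  have h2' := hb'.meas
  have h3 := (continuous_ent hδ).measurable
  rw [pairEnt, pairEnt, ← integral_sub (integrable_pairEnt hδ ha hb hρm hρ)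
    (integrable_pairEnt hδ ha' hb' hρm hρ)]
  refine abs_integral_le_integral_abs.trans ?_
  refine integral_abs_le_kernel (ha.int.sub ha'.int).abs (hb.int.sub hb'.int).abs hρ
    (by fun_prop) fun x y => ?_
  rw [← sub_mul, abs_mul]
  refine mul_le_mul_of_nonneg_right ?_ (abs_nonneg _)
  rw [sub_sub_sub_cancel_right]
  refine (abs_ent_sub_le hδ _ _).trans ?_
  rw [show a x - b y - (a' x - b' y) = a x - a' x - (b y - b' y) by ring]
  exact abs_sub _ _

theorem abs_pairFlux_sub_le (hf : ∀ a b, |f a - f b| ≤ L * |a - b|) (hL : 0 ≤ L) (hδ : 0 < δ)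
    (ha : RegL1 M N B a) (hb : RegL1 M' N' B' b) (ha' : RegL1 M₁ N₁ B₁ a')
    (hb' : RegL1 M₂ N₂ B₂ b') (hκm : Measurable κ) (hκ : Integrable κ) :
    |pairFlux f δ κ a b - pairFlux f δ κ a' b'| ≤
      (3 * L * ∫ w, |κ w|) * ((∫ x, |a x - a' x|) + ∫ x, |b x - b' x|) := by
  have h3 := measurable_diagFlux hf hL hδ ha.meas hb.meas
  have h3' := measurable_diagFlux hf hL hδ ha'.meas hb'.meas
  rw [pairFlux, pairFlux, ← integral_sub (integrable_pairFlux hf hL hδ ha hb hκm hκ)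
    (integrable_pairFlux hf hL hδ ha' hb' hκm hκ)]
  refine abs_integral_le_integral_abs.trans ?_
  refine (integral_abs_le_kernel ((ha.int.sub ha'.int).abs.const_mul (3 * L))
    ((hb.int.sub hb'.int).abs.const_mul (3 * L)) hκ (by fun_prop) fun x y => ?_).trans (le_of_eq ?_)
  · rw [← sub_mul, abs_mul, ← mul_add]
    exact mul_le_mul_of_nonneg_right (abs_diagFlux_sub_le hf hL hδ _ _ _ _) (abs_nonneg _)
  · rw [integral_const_mul, integral_const_mul]
    simp only [Pi.sub_apply]
    ring

theorem exists_pairDiff_modulus {ν : Measure ℝ} [SFinite ν]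
    (hν : Integrable (fun z : ℝ => min 1 |z|) ν) (hδ : 0 < δ) (hρm : Measurable ρ)
    (hρ : Integrable ρ) (M N B : ℝ) {ε : ℝ} (hε : 0 < ε) :
    ∃ K ≥ 0, ∀ a b a' b', RegL1 M N B a → RegL1 M N B b → RegL1 M N B a' → RegL1 M N B b' →
      |pairDiff ν δ ρ a b - pairDiff ν δ ρ a' b'| ≤
        ε + K * ((∫ x, |a x - a' x|) + ∫ x, |b x - b' x|) := by
  set I := ∫ w, |ρ w| with hI
  have hI0 : 0 ≤ I := integral_nonneg fun _ => abs_nonneg _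
  obtain ⟨K₁, hK₁, h₁⟩ := exists_mul_nonlocal_modulus hν M N B (C₀ := 2 * I) (by positivity)
    (half_pos hε)
  obtain ⟨K₂, hK₂, h₂⟩ := exists_nonlocal_global_modulus hν (M + M) (N + N) (B + B)
    (show 0 < ε / 2 / (I + 1) by positivity)
  refine ⟨K₁ * (δ⁻¹ * I) + K₂ * I, by positivity, fun a b a' b' ha hb ha' hb' => ?_⟩
  have m1 := ha.meas
  have m2 := hb.meas
  have m1' := ha'.meas
  have m2' := hb'.meas
  have m3 := (continuous_sgnAvg hδ).measurable
  have m4 := measurable_nonlocal (ν := ν) m1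
  have m4' := measurable_nonlocal (ν := ν) m1'
  set D := ∫ x, |a x - a' x| with hD
  set E := ∫ x, |b x - b' x| with hE
  have hE0 : 0 ≤ E := integral_nonneg fun _ => abs_nonneg _
  have hD0 : 0 ≤ D := integral_nonneg fun _ => abs_nonneg _
  set h : ℝ × ℝ → ℝ := fun p =>
    (sgnAvg δ (a p.1 - b p.2) - sgnAvg δ (a' p.1 - b' p.2)) * ρ (p.1 - p.2) with hh
  have hhm : Measurable h := by fun_prop
  have hhb : ∀ x y, |h (x, y)| ≤ (δ⁻¹ * |a x - a' x| + δ⁻¹ * |b y - b' y|) * |ρ (x - y)| := by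
    intro x y
    rw [hh, abs_mul, ← mul_add]
    refine mul_le_mul_of_nonneg_right ((abs_sgnAvg_sub_le hδ _ _).trans ?_) (abs_nonneg _)
    refine mul_le_mul_of_nonneg_left ?_ (by positivity)
    rw [show a x - b y - (a' x - b' y) = a x - a' x - (b y - b' y) by ring]
    exact abs_sub _ _
  have iD := (ha.int.sub ha'.int).abs.const_mul δ⁻¹
  have iE := (hb.int.sub hb'.int).abs.const_mul δ⁻¹
  have hhi := integrable_of_le_kernel iD iE hρ hhm hhb
  have hhI : ∫ p, |h p| ∂(volume.prod volume) ≤ δ⁻¹ * I * (D + E) := by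
    refine (integral_abs_le_kernel iD iE hρ hhm hhb).trans (le_of_eq ?_)
    rw [integral_const_mul, integral_const_mul]
    simp only [Pi.sub_apply]
    ring
  set s : ℝ → ℝ := fun x => ∫ y, |h (x, y)| with hs
  have hsm : Measurable s :=
    (hhm.norm.stronglyMeasurable.integral_prod_right' (ν := volume)).measurable
  have hs0 : ∀ x, 0 ≤ s x := fun x => integral_nonneg fun _ => abs_nonneg _
  have hsb : ∀ x, |s x| ≤ 2 * I := by
    intro x
    rw [abs_of_nonneg (hs0 x)]
    have i1 := (hρ.abs.comp_sub_left x).const_mul 2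
    refine (integral_mono_of_nonneg (Eventually.of_forall fun y => abs_nonneg _) i1
      (Eventually.of_forall fun y => ?_)).trans (le_of_eq ?_)
    · simp only [hh, abs_mul]
      refine mul_le_mul_of_nonneg_right ((abs_sub _ _).trans ?_) (abs_nonneg _)
      linarith [abs_sgnAvg_le_one hδ (a x - b y), abs_sgnAvg_le_one hδ (a' x - b' y)]
    · rw [integral_const_mul, integral_sub_left_eq_self fun w => |ρ w|]
  have hsi : Integrable s := hhi.abs.integral_prod_left
  have hsI : ∫ x, |s x| ≤ δ⁻¹ * I * (D + E) := by
    simp only [abs_of_nonneg (hs0 _)]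
    rw [hs, ← integral_prod (fun p => |h p|) hhi.abs]
    exact hhI
  have i2 : Integrable (fun p : ℝ × ℝ => |h p| * |nonlocal ν a p.1|) (volume.prod volume) := by
    refine integrable_of_le_kernel ((ha.nonlocal_int hν).abs.const_mul 2)
      (integrable_zero ℝ ℝ volume) hρ (by fun_prop) fun x y => ?_
    rw [abs_mul, abs_abs, abs_abs, hh, abs_mul, Pi.zero_apply, add_zero]
    have : |sgnAvg δ (a x - b y) - sgnAvg δ (a' x - b' y)| ≤ 2 := (abs_sub _ _).trans (by
      linarith [abs_sgnAvg_le_one hδ (a x - b y), abs_sgnAvg_le_one hδ (a' x - b' y)])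
    calc _ ≤ 2 * |ρ (x - y)| * |nonlocal ν a x| := by gcongr
      _ = _ := by ring
  have b1 : ∫ p : ℝ × ℝ, |h p| * |nonlocal ν a p.1| ∂(volume.prod volume) ≤
      ε / 2 + K₁ * (δ⁻¹ * I * (D + E)) := by
    rw [integral_prod _ i2]
    simp only [integral_mul_const]
    have := h₁ a ha s hsm hsb hsi
    simp only [abs_mul, abs_of_nonneg (hs0 _)] at this hsI
    exact this.trans (by gcongr)
  have i3 : Integrable (fun p : ℝ × ℝ => |nonlocal ν a p.1 - nonlocal ν a' p.1| * |ρ (p.1 - p.2)|)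
      (volume.prod volume) :=
    integrable_fst_mul_kernel ((ha.nonlocal_int hν).sub (ha'.nonlocal_int hν)).abs hρ.abs
  have b2 : ∫ p : ℝ × ℝ, |nonlocal ν a p.1 - nonlocal ν a' p.1| * |ρ (p.1 - p.2)|
      ∂(volume.prod volume) ≤ ε / 2 + K₂ * I * (D + E) := by
    have e1 := integral_fst_mul_kernel ((ha.nonlocal_int hν).sub (ha'.nonlocal_int hν)).abs hρ.abs
    simp only [Pi.sub_apply] at e1
    rw [e1, ← hI, ← integral_congr_ae ((ha.nonlocal_sub ha' hν).mono fun x hx => congrArg abs hx)]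
    have := h₂ _ (ha.sub ha')
    have h3 : ε / 2 / (I + 1) * I ≤ ε / 2 := by
      rw [div_mul_eq_mul_div, div_le_iff₀ (by positivity)]
      have := mul_nonneg hε.le hI0
      linarith
    have h4 := mul_le_mul_of_nonneg_right this hI0
    have h5 : 0 ≤ K₂ * I * E := by positivity
    rw [← hD] at h4
    linarith
  rw [pairDiff, pairDiff, ← integral_sub (integrable_pairDiff hν hδ ha hb hρm hρ)
    (integrable_pairDiff hν hδ ha' hb' hρm hρ)]
  refine abs_integral_le_integral_abs.trans ?_
  refine (integral_mono_of_nonneg (Eventually.of_forall fun p => abs_nonneg _) (i2.add i3)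
    (Eventually.of_forall fun p => ?_)).trans ?_
  · simp only [Pi.add_apply, hh, ← abs_mul]
    rw [show sgnAvg δ (a p.1 - b p.2) * nonlocal ν a p.1 * ρ (p.1 - p.2)
      - sgnAvg δ (a' p.1 - b' p.2) * nonlocal ν a' p.1 * ρ (p.1 - p.2)
      = (sgnAvg δ (a p.1 - b p.2) - sgnAvg δ (a' p.1 - b' p.2)) * ρ (p.1 - p.2) * nonlocal ν a p.1
      + sgnAvg δ (a' p.1 - b' p.2) *
        ((nonlocal ν a p.1 - nonlocal ν a' p.1) * ρ (p.1 - p.2)) by ring]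
    refine (abs_add_le _ _).trans (add_le_add le_rfl ?_)
    rw [abs_mul (sgnAvg _ _)]
    exact mul_le_of_le_one_left (abs_nonneg _) (abs_sgnAvg_le_one hδ _)
  · simp only [Pi.add_apply]
    rw [integral_add i2 i3]
    linarith

end

theorem abs_ent_sub_ent_zero_sub_abs_le {δ : ℝ} (hδ : 0 < δ) (r s : ℝ) :
    |ent δ (r - s) - ent δ 0 - (|r - s|)| ≤ 2 * min δ |r| + 2 * min δ |s| := by
  have h1 : |ent δ (r - s) - ent δ 0 - (|r - s|)| ≤ 2 * δ := by
    have a1 := abs_ent_sub_abs_le hδ (r - s)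
    have a2 := abs_ent_sub_abs_le hδ 0
    rw [abs_zero, sub_zero] at a2
    rw [abs_le] at *
    constructor <;> linarith
  have h2 : |ent δ (r - s) - ent δ 0 - (|r - s|)| ≤ 2 * (|r| + |s|) := by
    have a1 := abs_ent_sub_le hδ (r - s) 0
    have a2 := abs_sub (ent δ (r - s) - ent δ 0) (|r - s|)
    have a3 := abs_sub r s
    rw [sub_zero] at a1
    rw [abs_abs] at a2
    linarith
  have h3 := min_add_le_min_add_min hδ.le (abs_nonneg r) (abs_nonneg s)
  have h4 : |ent δ (r - s) - ent δ 0 - (|r - s|)| ≤ 2 * min δ (|r| + |s|) := by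
    rcases min_choice δ (|r| + |s|) with h | h <;> rw [h] <;> assumption
  linarith

theorem integral_prod_shear {g : ℝ × ℝ → ℝ} (hg : Integrable g (volume.prod volume)) :
    ∫ p, g p ∂(volume.prod volume) = ∫ w, ∫ y, g (w + y, y) := by
  have hT := measurePreserving_add_prod (volume : Measure ℝ) (volume : Measure ℝ)
  rw [← hT.integral_comp_of_aestronglyMeasurable hg.aestronglyMeasurable]
  exact integral_prod _ (hT.integrable_comp_of_integrable hg)

theorem integrable_shear {g : ℝ × ℝ → ℝ} (hg : Integrable g (volume.prod volume)) :
    Integrable fun w => ∫ y, g (w + y, y) :=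
  ((measurePreserving_add_prod (volume : Measure ℝ)
    (volume : Measure ℝ)).integrable_comp_of_integrable hg).integral_prod_left

theorem RegL1.comp_add_left {M N B : ℝ} {a : ℝ → ℝ} (h : RegL1 M N B a) (s : ℝ) :
    RegL1 M N B fun y => a (s + y) where
  meas := h.meas.comp (measurable_const_add s)
  bdd _ := h.bdd _
  int := h.int.comp_add_left s
  norm := by rw [integral_add_left_eq_self fun y => |a y|]; exact h.norm
  trans z := by
    have := integral_add_left_eq_self (μ := volume) (fun y => |a (y + z) - a y|) s
    simp only [add_assoc] at this ⊢
    rw [this]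
    exact h.trans z

theorem nonlocal_comp_add_left (ν : Measure ℝ) (a : ℝ → ℝ) (s y : ℝ) :
    nonlocal ν (fun y => a (s + y)) y = nonlocal ν a (s + y) := by
  simp only [nonlocal, add_assoc]

section
variable {M N B M' N' B' δ L r : ℝ} {f ρ κ a b : ℝ → ℝ}

theorem pairEnt_comm (δ : ℝ) (hρe : ∀ x, ρ (-x) = ρ x) (a b : ℝ → ℝ) :
    pairEnt δ ρ b a = pairEnt δ ρ a b := by
  rw [pairEnt, pairEnt, ← integral_prod_swap]
  congr 1; ext p
  simp only [Prod.fst_swap, Prod.snd_swap]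
  rw [← neg_sub (a p.1), ent_neg, ← neg_sub p.1, hρe]

theorem pairFlux_add_le (hf : ∀ a b, |f a - f b| ≤ L * |a - b|) (hL : 0 ≤ L) (hδ : 0 < δ)
    (ha : RegL1 M N B a) (hb : RegL1 M' N' B' b) (hκm : Measurable κ) (hκ : Integrable κ)
    (hκo : ∀ x, κ (-x) = -κ x) :
    pairFlux f δ κ a b + pairFlux f δ κ b a ≤
      (4 * L * ∫ w, |κ w|) * ((∫ x, min δ |a x|) + ∫ x, min δ |b x|) := by
  have i1 := integrable_pairFlux hf hL hδ ha hb hκm hκ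
  have i2 := (integrable_pairFlux hf hL hδ hb ha hκm hκ).swap
  simp only [Function.comp_def] at i2
  have m1 := measurable_diagFlux hf hL hδ ha.meas hb.meas
  have m2 : Measurable fun p : ℝ × ℝ => diagFlux f δ (a p.1) (b p.2) :=
    (measurable_diagFlux hf hL hδ hb.meas ha.meas).comp measurable_swap
  rw [pairFlux, pairFlux, ← integral_prod_swap (fun p : ℝ × ℝ => diagFlux f δ (a p.2) (b p.1) * _),
    ← integral_add i1 i2]
  refine (le_abs_self _).trans (abs_integral_le_integral_abs.trans ?_)
  simp only [Prod.fst_swap, Prod.snd_swap]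
  have e : ∀ p : ℝ × ℝ, κ (p.2 - p.1) = -κ (p.1 - p.2) := fun p => by rw [← hκo, neg_sub]
  simp only [e]
  refine (integral_abs_le_kernel ((integrable_min_abs hδ.le ha.meas ha.int).const_mul (4 * L))
    ((integrable_min_abs hδ.le hb.meas hb.int).const_mul (4 * L)) hκ
    (by fun_prop) fun x y => ?_).trans (le_of_eq ?_)
  · rw [mul_neg, ← sub_eq_add_neg, ← sub_mul, abs_mul]
    exact mul_le_mul_of_nonneg_right (abs_diagFlux_sub_swap_le hf hL hδ _ _) (abs_nonneg _)
  · rw [integral_const_mul, integral_const_mul]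
    ring

theorem pairDiff_add_nonpos {ν : Measure ℝ} [SFinite ν]
    (hν : Integrable (fun z : ℝ => min 1 |z|) ν) (hδ : 0 < δ)
    (ha : RegL1 M N B a) (hb : RegL1 M' N' B' b) (hρm : Measurable ρ) (hρ : Integrable ρ)
    (hρ0 : ∀ x, 0 ≤ ρ x) (hρe : ∀ x, ρ (-x) = ρ x) :
    pairDiff ν δ ρ a b + pairDiff ν δ ρ b a ≤ 0 := by
  have i1 := integrable_pairDiff hν hδ ha hb hρm hρ
  have i2 := (integrable_pairDiff hν hδ hb ha hρm hρ).swap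
  simp only [Function.comp_def] at i2
  rw [pairDiff, pairDiff, ← integral_prod_swap (fun p : ℝ × ℝ => sgnAvg δ (b p.1 - a p.2) * _ * _),
    ← integral_add i1 i2]
  refine (integral_prod_shear (i1.add i2)).trans_le ?_
  refine integral_nonpos fun w => ?_
  have h := (ha.comp_add_left w).sub hb
  have key := h.integral_sgnAvg_mul_nonlocal_nonpos hδ hν
  have e : ∫ y, sgnAvg δ (a (w + y) - b y) * nonlocal ν (fun x => a (w + x) - b x) y * ρ w ≤ 0 := by
    rw [integral_mul_const]
    exact mul_nonpos_of_nonpos_of_nonneg key (hρ0 w)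
  refine le_of_eq_of_le (integral_congr_ae ?_) e
  filter_upwards [(ha.comp_add_left w).nonlocal_sub hb hν] with y hy
  rw [hy, nonlocal_comp_add_left]
  simp only [Pi.add_apply, Prod.fst_swap, Prod.snd_swap]
  rw [← neg_sub (a (w + y)), sgnAvg_neg, ← neg_sub (w + y) y, hρe, add_sub_cancel_right]
  ring

theorem abs_pairEnt_sub_pairAbs_le (hδ : 0 < δ) (ha : RegL1 M N B a) (hb : RegL1 M' N' B' b)
    (hρm : Measurable ρ) (hρ : Integrable ρ) :
    |pairEnt δ ρ a b - pairAbs ρ a b| ≤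
      (2 * ∫ w, |ρ w|) * ((∫ x, min δ |a x|) + ∫ x, min δ |b x|) := by
  have h1 := ha.meas
  have h2 := hb.meas
  have h3 := (continuous_ent hδ).measurable
  rw [pairEnt, pairAbs, ← integral_sub (integrable_pairEnt hδ ha hb hρm hρ)
    (integrable_pairAbs ha hb hρm hρ)]
  refine abs_integral_le_integral_abs.trans ?_
  refine (integral_abs_le_kernel ((integrable_min_abs hδ.le ha.meas ha.int).const_mul 2)
    ((integrable_min_abs hδ.le hb.meas hb.int).const_mul 2) hρ
    (by fun_prop) fun x y => ?_).trans (le_of_eq ?_)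
  · rw [← sub_mul, abs_mul]
    refine mul_le_mul_of_nonneg_right ?_ (abs_nonneg _)
    exact abs_ent_sub_ent_zero_sub_abs_le hδ _ _
  · rw [integral_const_mul, integral_const_mul]
    ring

theorem abs_pairAbs_sub_le (ha : RegL1 M N B a) (hb : RegL1 M' N' B' b)
    (hρm : Measurable ρ) (hρ : Integrable ρ) (hρ0 : ∀ x, 0 ≤ ρ x) (hρ1 : ∫ x, ρ x = 1)
    (hρr : ∀ x, r < |x| → ρ x = 0) :
    |pairAbs ρ a b - (∫ x, |a x - b x|)| ≤ B * r := by
  have i := integrable_pairAbs ha hb hρm hρ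
  have i' := integrable_shear i
  have iρ : Integrable fun w => (∫ x, |a x - b x|) * ρ w := hρ.const_mul _
  rw [pairAbs, integral_prod_shear i]
  simp only [add_sub_cancel_right, integral_mul_const] at i' ⊢
  have e : ∫ w, (∫ x, |a x - b x|) * ρ w = ∫ x, |a x - b x| := by
    rw [integral_const_mul, hρ1, mul_one]
  rw [← e, ← integral_sub i' iρ]
  refine abs_integral_le_integral_abs.trans ?_
  have e2 : ∫ w, B * r * ρ w = B * r := by rw [integral_const_mul, hρ1, mul_one]
  rw [← e2]
  refine integral_mono (i'.sub iρ).abs (hρ.const_mul _) fun w => ?_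
  simp only [← sub_mul, abs_mul, abs_of_nonneg (hρ0 w)]
  rcases lt_or_ge r |w| with hw | hw
  · rw [hρr w hw, mul_zero, mul_zero]
  refine mul_le_mul_of_nonneg_right ?_ (hρ0 w)
  have j1 : Integrable fun y => |a (w + y) - b y| := ((ha.int.comp_add_left w).sub hb.int).abs
  have j2 : Integrable fun y => |a y - b y| := (ha.int.sub hb.int).abs
  rw [← integral_sub j1 j2]
  refine (abs_integral_le_integral_abs.trans ?_).trans
    ((ha.trans w).trans (mul_le_mul_of_nonneg_left hw ha.nonneg_B))
  refine integral_mono (j1.sub j2).abs (ha.incr_int w).abs fun y => ?_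
  refine (abs_abs_sub_abs_le _ _).trans (le_of_eq ?_)
  rw [add_comm w y]; congr 1; ring

end

theorem Cutoff.comp_sub_right {R C : ℝ} {p : ℝ → ℝ} (hp : Cutoff R C p) (y : ℝ) :
    Cutoff (R + |y|) C fun x => p (x - y) where
  meas := hp.meas.comp (measurable_sub_const y)
  bdd _ := hp.bdd _
  supp x hx := hp.supp _ fun h => hx ⟨by linarith [h.1, neg_abs_le y],
    by linarith [h.2, le_abs_self y]⟩

/-- A nonnegative even kernel of mass one supported in `[-r, r]` with derivative `κ`. -/
structure Mollifier (r C : ℝ) (ρ κ : ℝ → ℝ) : Prop where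
  cut : Cutoff r C ρ
  cut' : Cutoff r C κ
  nonneg : ∀ x, 0 ≤ ρ x
  even : ∀ x, ρ (-x) = ρ x
  odd : ∀ x, κ (-x) = -κ x
  integral_eq : ∫ x, ρ x = 1

theorem exists_mollifier {r : ℝ} (hr : 0 < r) :
    ∃ ρ : ℝ → ℝ, ContDiff ℝ (⊤ : ℕ∞) ρ ∧ HasCompactSupport ρ ∧
      ∃ C, Mollifier r C ρ (deriv ρ) := by
  let φ : ContDiffBump (0 : ℝ) := ⟨r / 2, r, half_pos hr, half_lt_self hr⟩
  set ρ := φ.normed volume with hρ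
  have hs : HasCompactSupport ρ := φ.hasCompactSupport_normed
  have hd : ContDiff ℝ (⊤ : ℕ∞) ρ := φ.contDiff_normed
  have hd' : Continuous (deriv ρ) := hd.continuous_deriv (by simp)
  obtain ⟨C₁, h₁⟩ := hd.continuous.bounded_above_of_compact_support hs
  obtain ⟨C₂, h₂⟩ := hd'.bounded_above_of_compact_support hs.deriv
  have ht : tsupport ρ = Icc (-r) r := by
    rw [hρ, φ.tsupport_normed_eq, Real.closedBall_eq_Icc, zero_sub, zero_add]
  have heven : ∀ x, ρ (-x) = ρ x := fun x => φ.normed_neg x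
  refine ⟨ρ, hd, hs, max C₁ C₂, ⟨hd.continuous.measurable, fun x => (h₁ x).trans (le_max_left _ _),
    fun x hx => ?_⟩, ⟨hd'.measurable, fun x => (h₂ x).trans (le_max_right _ _), fun x hx => ?_⟩,
    fun x => φ.nonneg_normed x, heven, fun x => ?_, φ.integral_normed⟩
  · exact image_eq_zero_of_notMem_tsupport (by rwa [ht])
  · refine image_eq_zero_of_notMem_tsupport fun h => hx ?_
    rw [← ht]
    exact tsupport_deriv_subset h
  · have := deriv_comp_neg ρ x
    simp only [heven] at this
    linarith

namespace Mollifier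
variable {r C : ℝ} {ρ κ : ℝ → ℝ}

theorem integral_deriv_eq (h : Mollifier r C ρ κ) : ∫ x, κ x = 0 := by
  have := integral_neg_eq_self κ volume
  simp only [h.odd, integral_neg] at this
  linarith

end Mollifier

section
variable {M N B M' N' B' δ L r C : ℝ} {f ρ κ a b : ℝ → ℝ} {ν : Measure ℝ} [SFinite ν]

theorem pairEnt_eq_integral_entInt (hδ : 0 < δ) (ha : RegL1 M N B a) (hb : RegL1 M' N' B' b)
    (h : Mollifier r C ρ κ) :
    Integrable (fun y => entInt δ (b y) a (fun x => ρ (x - y)) - ent δ 0) ∧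
    pairEnt δ ρ a b = ∫ y, (entInt δ (b y) a (fun x => ρ (x - y)) - ent δ 0) := by
  have i := integrable_pairEnt hδ ha hb h.cut.meas h.cut.integrable
  have e : ∀ y, ∫ x, (ent δ (a x - b y) - ent δ 0) * ρ (x - y) =
      entInt δ (b y) a (fun x => ρ (x - y)) - ent δ 0 := fun y => by
    have c := h.cut.comp_sub_right y
    simp only [sub_mul]
    rw [integral_sub (integrable_ent_mul hδ ha c) (c.integrable.const_mul _), integral_const_mul,
      integral_sub_right_eq_self ρ, h.integral_eq, mul_one, entInt]
  have i' := i.integral_prod_right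
  rw [pairEnt, integral_prod_symm _ i]
  simp only [e] at i' ⊢
  exact ⟨i', trivial⟩

theorem pairProd_eq_integral_prodInt (hf : ∀ a b, |f a - f b| ≤ L * |a - b|) (hL : 0 ≤ L)
    (hν : Integrable (fun z : ℝ => min 1 |z|) ν)
    (hδ : 0 < δ) (ha : RegL1 M N B a) (hb : RegL1 M' N' B' b) (h : Mollifier r C ρ κ) :
    Measurable (fun y => prodInt ν f δ (b y) a (fun x => κ (x - y)) (fun x => ρ (x - y))) ∧
    Integrable (fun y => prodInt ν f δ (b y) a (fun x => κ (x - y)) (fun x => ρ (x - y))) ∧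
    pairFlux f δ κ a b + pairDiff ν δ ρ a b =
      ∫ y, prodInt ν f δ (b y) a (fun x => κ (x - y)) (fun x => ρ (x - y)) ∧
    ∫ y, |prodInt ν f δ (b y) a (fun x => κ (x - y)) (fun x => ρ (x - y))| ≤
      L * (N + N') * (∫ w, |κ w|) + (B + 2 * N) * (∫ z, min 1 |z| ∂ν) * ∫ w, |ρ w| := by
  have i1 := integrable_pairFlux hf hL hδ ha hb h.cut'.meas h.cut'.integrable
  have i2 := integrable_pairDiff hν hδ ha hb h.cut.meas h.cut.integrable
  have m0 := ha.meas
  have m0' := hb.meas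
  have m1 := measurable_diagFlux hf hL hδ ha.meas hb.meas
  have m2 := (continuous_sgnAvg hδ).measurable
  have m3 := measurable_nonlocal (ν := ν) ha.meas
  have m4 := h.cut.meas
  have m5 := h.cut'.meas
  set Ψ : ℝ × ℝ → ℝ := fun p => diagFlux f δ (b p.2) (a p.1) * κ (p.1 - p.2) +
    sgnAvg δ (a p.1 - b p.2) * nonlocal ν a p.1 * ρ (p.1 - p.2) with hΨ
  have hΨm : Measurable Ψ := by fun_prop
  have i : Integrable Ψ (volume.prod volume) := i1.add i2
  have e : ∀ y, ∫ x, Ψ (x, y) =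
      prodInt ν f δ (b y) a (fun x => κ (x - y)) (fun x => ρ (x - y)) := fun y => by
    have c := h.cut.comp_sub_right y
    have c' := h.cut'.comp_sub_right y
    have := integral_sub (integrable_prodInt (k := b y) hf hν hL hδ ha c' c)
      (c'.integrable.const_mul (fluxAvg f δ (b y) (b y)))
    rw [integral_const_mul, integral_sub_right_eq_self κ, h.integral_deriv_eq, mul_zero,
      sub_zero] at this
    rw [prodInt, ← this]
    congr 1; ext x
    simp only [hΨ, diagFlux]
    ring
  have i' := i.integral_prod_right
  have m' : Measurable fun y => ∫ x, Ψ (x, y) :=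
    (hΨm.stronglyMeasurable.integral_prod_left' (μ := volume)).measurable
  have hb1 : ∫ y, |∫ x, Ψ (x, y)| ≤
      L * (N + N') * (∫ w, |κ w|) + (B + 2 * N) * (∫ z, min 1 |z| ∂ν) * ∫ w, |ρ w| := by
    refine (integral_mono i'.abs i.abs.integral_prod_right
      fun y => abs_integral_le_integral_abs).trans ?_
    rw [← integral_prod_symm (fun p => |Ψ p|) i.abs]
    refine (integral_mono i.abs (i1.abs.add i2.abs) fun p => abs_add_le _ _).trans ?_
    simp only [Pi.add_apply]
    rw [integral_add i1.abs i2.abs]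
    refine add_le_add ?_ ?_
    · refine (integral_abs_le_kernel (ha.int.abs.const_mul L) (hb.int.abs.const_mul L)
        h.cut'.integrable (by fun_prop) fun x y => ?_).trans ?_
      · rw [abs_mul, ← mul_add]
        refine mul_le_mul_of_nonneg_right ?_ (abs_nonneg _)
        exact (abs_diagFlux_le hf hδ _ _).trans (mul_le_mul_of_nonneg_left (abs_sub _ _) hL)
      · rw [integral_const_mul, integral_const_mul, ← mul_add]
        have h1 := ha.norm
        have h2 := hb.norm
        have h3 : 0 ≤ ∫ w, |κ w| := integral_nonneg fun _ => abs_nonneg _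
        gcongr
    · refine (integral_abs_le_kernel (ha.nonlocal_int hν).abs (integrable_zero ℝ ℝ volume)
        h.cut.integrable (by fun_prop) fun x y => ?_).trans ?_
      · rw [abs_mul, abs_mul, Pi.zero_apply, add_zero]
        refine mul_le_mul_of_nonneg_right ?_ (abs_nonneg _)
        exact mul_le_of_le_one_left (abs_nonneg _) (abs_sgnAvg_le_one hδ _)
      · have h1 := ha.nonlocal_norm hν
        have h3 : 0 ≤ ∫ w, |ρ w| := integral_nonneg fun _ => abs_nonneg _
        simp only [Pi.zero_apply, integral_zero, add_zero]
        gcongr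
  refine ⟨?_, ?_, ?_, ?_⟩
  · simpa only [e] using m'
  · simpa only [e] using i'
  · rw [pairFlux, pairDiff, ← integral_add i1 i2]
    refine (integral_prod_symm _ i).trans ?_
    simp only [e]
  · simpa only [e] using hb1

theorem Curve.pairEnt_sub_le_integral (hf : ∀ a b, |f a - f b| ≤ L * |a - b|) (hL : 0 ≤ L)
    (hν : Integrable (fun z : ℝ => min 1 |z|) ν) (hδ : 0 < δ) {u : ℝ → ℝ → ℝ}
    (hu : Curve M N B u) (hb : RegL1 M' N' B' b) (hρ : Mollifier r C ρ κ) {s t : ℝ} (hst : s ≤ t)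
    (h : ∀ y k, entInt δ k (u t) (fun x => ρ (x - y)) - entInt δ k (u s) (fun x => ρ (x - y)) ≤
      ∫ σ in s..t, prodInt ν f δ k (u σ) (fun x => κ (x - y)) (fun x => ρ (x - y))) :
    pairEnt δ ρ (u t) b - pairEnt δ ρ (u s) b ≤
      ∫ σ in s..t, (pairFlux f δ κ (u σ) b + pairDiff ν δ ρ (u σ) b) := by
  obtain ⟨i1, e1⟩ := pairEnt_eq_integral_entInt hδ (hu.reg t) hb hρ
  obtain ⟨i2, e2⟩ := pairEnt_eq_integral_entInt hδ (hu.reg s) hb hρ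
  set J : ℝ → ℝ → ℝ := fun σ y =>
    prodInt ν f δ (b y) (u σ) (fun x => κ (x - y)) (fun x => ρ (x - y)) with hJ
  have H := fun σ => pairProd_eq_integral_prodInt hf hL hν hδ (hu.reg σ) hb hρ
  have hJm : Measurable (Function.uncurry J) := by
    refine measurable_uncurry_of_continuous_of_measurable (fun y => ?_) fun σ => (H σ).1
    have c := hρ.cut.comp_sub_right y
    have c' := hρ.cut'.comp_sub_right y
    exact hu.continuous_prodInt hf hν hL hδ
      ⟨fun _ => c', fun t ε hε => Eventually.of_forall fun s x => by simpa using hε.le⟩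
      ⟨fun _ => c, fun t ε hε => Eventually.of_forall fun s x => by simpa using hε.le⟩
  have hJi : Integrable (Function.uncurry J) ((volume.restrict (Ioc s t)).prod volume) := by
    refine (integrable_prod_iff hJm.aestronglyMeasurable).2
      ⟨Eventually.of_forall fun σ => (H σ).2.1, ?_⟩
    refine Integrable.of_bound (C := L * (N + N') * (∫ w, |κ w|) +
      (B + 2 * N) * (∫ z, min 1 |z| ∂ν) * ∫ w, |ρ w|)
      (hJm.norm.stronglyMeasurable.integral_prod_right' (ν := volume)).aestronglyMeasurable
      (Eventually.of_forall fun σ => ?_)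
    rw [Real.norm_of_nonneg (integral_nonneg fun _ => norm_nonneg _)]
    exact (H σ).2.2.2
  rw [e1, e2, ← integral_sub i1 i2, intervalIntegral.integral_of_le hst]
  simp only [(H _).2.2.1]
  rw [integral_integral_swap (f := J) hJi]
  refine integral_mono (i1.sub i2) hJi.integral_prod_right fun y => ?_
  have := h y (b y)
  rw [intervalIntegral.integral_of_le hst] at this
  simp only [sub_sub_sub_cancel_right]
  exact this

end

theorem abs_integral_min_abs_sub_le {δ : ℝ} (hδ : 0 ≤ δ) {M N B M' N' B' : ℝ} {a b : ℝ → ℝ}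
    (ha : RegL1 M N B a) (hb : RegL1 M' N' B' b) :
    |(∫ x, min δ |a x|) - (∫ x, min δ |b x|)| ≤ ∫ x, |a x - b x| := by
  have i1 := integrable_min_abs hδ ha.meas ha.int
  have i2 := integrable_min_abs hδ hb.meas hb.int
  rw [← integral_sub i1 i2]
  refine abs_integral_le_integral_abs.trans
    (integral_mono (i1.sub i2).abs (ha.int.sub hb.int).abs fun x => ?_)
  refine (abs_min_sub_min_le_max _ _ _ _).trans ?_
  rw [sub_self, abs_zero]
  exact max_le (abs_nonneg _) (abs_abs_sub_abs_le _ _)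

theorem tendsto_integral_min_abs {M N B : ℝ} {a : ℝ → ℝ} (ha : RegL1 M N B a) :
    Tendsto (fun n : ℕ => ∫ x, min (1 / ((n : ℝ) + 1)) |a x|) atTop (𝓝 0) := by
  have h := tendsto_integral_of_dominated_convergence (μ := volume)
    (F := fun (n : ℕ) x => min (1 / ((n : ℝ) + 1)) |a x|) (f := fun _ => (0 : ℝ)) (fun x => |a x|)
    (fun n => (measurable_const.min ha.meas.abs).aestronglyMeasurable) ha.int.abs
    (fun n => Eventually.of_forall fun x => by
      rw [Real.norm_of_nonneg (le_min (by positivity) (abs_nonneg _))]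
      exact min_le_right _ _)
    (Eventually.of_forall fun x => by
      have := (tendsto_one_div_add_atTop_nhds_zero_nat (𝕜 := ℝ)).min
        (tendsto_const_nhds (x := |a x|))
      rwa [min_eq_left (abs_nonneg _)] at this)
  simpa using h

section
variable {M N B M' N' B' δ L r C : ℝ} {f ρ κ a b : ℝ → ℝ} {ν : Measure ℝ} [SFinite ν]
  {u v : ℝ → ℝ → ℝ}

theorem exists_pairProd_modulus (hf : ∀ a b, |f a - f b| ≤ L * |a - b|) (hL : 0 ≤ L)
    (hν : Integrable (fun z : ℝ => min 1 |z|) ν) (hδ : 0 < δ) (hρ : Mollifier r C ρ κ)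
    (M N B : ℝ) {ε : ℝ} (hε : 0 < ε) :
    ∃ K ≥ 0, ∀ a b a' b', RegL1 M N B a → RegL1 M N B b → RegL1 M N B a' → RegL1 M N B b' →
      |(pairFlux f δ κ a b + pairDiff ν δ ρ a b) - (pairFlux f δ κ a' b' + pairDiff ν δ ρ a' b')| ≤
        ε + K * ((∫ x, |a x - a' x|) + ∫ x, |b x - b' x|) := by
  obtain ⟨K, hK, h⟩ := exists_pairDiff_modulus hν hδ hρ.cut.meas hρ.cut.integrable M N B hε
  have hI : 0 ≤ ∫ w, |κ w| := integral_nonneg fun _ => abs_nonneg _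
  refine ⟨3 * L * (∫ w, |κ w|) + K, by positivity, fun a b a' b' ha hb ha' hb' => ?_⟩
  have h1 := h a b a' b' ha hb ha' hb'
  have h2 := abs_pairFlux_sub_le hf hL hδ ha hb ha' hb' hρ.cut'.meas hρ.cut'.integrable
  rw [add_sub_add_comm]
  refine (abs_add_le _ _).trans ?_
  linarith

theorem Curve.continuous_pairProd (hf : ∀ a b, |f a - f b| ≤ L * |a - b|) (hL : 0 ≤ L)
    (hν : Integrable (fun z : ℝ => min 1 |z|) ν) (hδ : 0 < δ) (hρ : Mollifier r C ρ κ)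
    (hu : Curve M N B u) (hb : RegL1 M N B b) :
    Continuous fun σ => pairFlux f δ κ (u σ) b + pairDiff ν δ ρ (u σ) b := by
  refine continuous_of_modulus _ hu.cont fun t ε hε => ?_
  obtain ⟨K, hK, h⟩ := exists_pairProd_modulus hf hL hν hδ hρ M N B hε
  refine ⟨K, Eventually.of_forall fun s => ?_⟩
  have := h _ _ _ _ (hu.reg s) hb (hu.reg t) hb
  simpa using this

theorem Curve.pairEnt_sub_le (hf : ∀ a b, |f a - f b| ≤ L * |a - b|) (hL : 0 ≤ L)
    (hν : Integrable (fun z : ℝ => min 1 |z|) ν) (hδ : 0 < δ) (hρ : Mollifier r C ρ κ)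
    (hu : Curve M N B u) (hv : Curve M N B v) {T : ℝ} (hT : 0 ≤ T)
    (hu' : ∀ y k s t, 0 ≤ s → s ≤ t → t ≤ T →
      entInt δ k (u t) (fun x => ρ (x - y)) - entInt δ k (u s) (fun x => ρ (x - y)) ≤
        ∫ σ in s..t, prodInt ν f δ k (u σ) (fun x => κ (x - y)) (fun x => ρ (x - y)))
    (hv' : ∀ y k s t, 0 ≤ s → s ≤ t → t ≤ T →
      entInt δ k (v t) (fun x => ρ (x - y)) - entInt δ k (v s) (fun x => ρ (x - y)) ≤
        ∫ σ in s..t, prodInt ν f δ k (v σ) (fun x => κ (x - y)) (fun x => ρ (x - y))) :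
    pairEnt δ ρ (u T) (v T) - pairEnt δ ρ (u 0) (v 0) ≤
      ∫ t in 0..T, (4 * L * ∫ w, |κ w|) * ((∫ x, min δ |u t x|) + ∫ x, min δ |v t x|) := by
  have hcont : ∀ {w : ℝ → ℝ → ℝ}, Curve M N B w → Continuous fun t => ∫ x, min δ |w t x| :=
    fun {w} hw => continuous_of_modulus _ hw.cont fun t ε hε => ⟨1, Eventually.of_forall fun s => by
      have := abs_integral_min_abs_sub_le hδ.le (hw.reg s) (hw.reg t)
      linarith⟩
  have hF : Continuous fun t => pairEnt δ ρ (u t) (v t) := by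
    refine continuous_of_modulus (fun t s => (∫ x, |u s x - u t x|) + ∫ x, |v s x - v t x|)
      (fun t => by simpa using (hu.cont t).add (hv.cont t))
      fun t ε hε => ⟨∫ w, |ρ w|, Eventually.of_forall fun s => ?_⟩
    have := abs_pairEnt_sub_le hδ (hu.reg s) (hv.reg s) (hu.reg t) (hv.reg t) hρ.cut.meas
      hρ.cut.integrable
    linarith
  refine sub_le_integral_of_dini hT hF.continuousOn
    (((hcont hu).add (hcont hv)).const_mul _) fun t ht ε hε => ?_
  obtain ⟨K, hK, hmod⟩ := exists_pairProd_modulus hf hL hν hδ hρ M N B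
    (show 0 < ε / 4 by positivity)
  have hnear : ∀ᶠ s in 𝓝 t, (∫ x, |u s x - u t x|) < ε / (8 * (K + 1)) ∧
      (∫ x, |v s x - v t x|) < ε / (8 * (K + 1)) :=
    ((hu.cont t).eventually (gt_mem_nhds (by positivity))).and
      ((hv.cont t).eventually (gt_mem_nhds (by positivity)))
  obtain ⟨d, hd, hball⟩ := Metric.eventually_nhds_iff.1 hnear
  have hsmall : ∀ x y : ℝ, x < ε / (8 * (K + 1)) → y < ε / (8 * (K + 1)) →
      K * (x + y) ≤ ε / 4 := fun x y hx hy => by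
    have h1 : K * (x + y) ≤ K * (ε / (4 * (K + 1))) := by
      refine mul_le_mul_of_nonneg_left ?_ hK
      have : ε / (4 * (K + 1)) = ε / (8 * (K + 1)) + ε / (8 * (K + 1)) := by
        field_simp; norm_num
      linarith
    refine h1.trans ?_
    rw [mul_div_assoc', div_le_div_iff₀ (by positivity) (by positivity)]
    have := mul_nonneg hK hε.le
    linarith
  filter_upwards [Ioo_mem_nhdsGT (show t < min T (t + d) from lt_min ht.2 (by linarith))] with s hs
  have hts : t < s := hs.1
  have hsT : s ≤ T := (hs.2.trans_le (min_le_left _ _)).le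
  have hsd : s < t + d := hs.2.trans_le (min_le_right _ _)
  have hσ : ∀ σ ∈ Icc t s, dist σ t < d := fun σ hσ => by
    rw [Real.dist_eq, abs_of_nonneg (by linarith [hσ.1])]
    linarith [hσ.2]
  have key : ∀ {w : ℝ → ℝ → ℝ} {b : ℝ → ℝ}, Curve M N B w → RegL1 M N B b →
      ∀ {D : ℝ}, (∀ σ ∈ Icc t s, pairFlux f δ κ (w σ) b + pairDiff ν δ ρ (w σ) b ≤ D) →
      ∫ σ in t..s, (pairFlux f δ κ (w σ) b + pairDiff ν δ ρ (w σ) b) ≤ (s - t) * D :=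
    fun {w b} hw hb {D} hD => by
      have := intervalIntegral.integral_mono_on (μ := volume) hts.le
        ((hw.continuous_pairProd hf hL hν hδ hρ hb).intervalIntegrable t s)
        (intervalIntegrable_const (c := D)) hD
      rwa [intervalIntegral.integral_const, smul_eq_mul] at this
  have k1 := (hu.pairEnt_sub_le_integral hf hL hν hδ (hv.reg s) hρ hts.le
    fun y k => hu' y k t s ht.1 hts.le hsT).trans (key hu (hv.reg s)
      (D := pairFlux f δ κ (u t) (v t) + pairDiff ν δ ρ (u t) (v t) + ε / 2) fun σ hσ' => by
        have h1 := hmod _ _ _ _ (hu.reg σ) (hv.reg s) (hu.reg t) (hv.reg t)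
        have h2 := hsmall _ _ (hball (hσ σ hσ')).1 (hball (hσ s ⟨hts.le, le_rfl⟩)).2
        linarith [(abs_le.1 h1).2])
  have k2 := (hv.pairEnt_sub_le_integral hf hL hν hδ (hu.reg t) hρ hts.le
    fun y k => hv' y k t s ht.1 hts.le hsT).trans (key hv (hu.reg t)
      (D := pairFlux f δ κ (v t) (u t) + pairDiff ν δ ρ (v t) (u t) + ε / 2) fun σ hσ' => by
        have h1 := hmod _ _ _ _ (hv.reg σ) (hu.reg t) (hv.reg t) (hu.reg t)
        have h2 := hsmall _ _ (hball (hσ σ hσ')).2 (hball (hσ t ⟨le_rfl, hts.le⟩)).1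
        linarith [(abs_le.1 h1).2])
  rw [pairEnt_comm δ hρ.even, pairEnt_comm δ hρ.even (u t) (v t)] at k2
  have s1 := pairFlux_add_le hf hL hδ (hu.reg t) (hv.reg t) hρ.cut'.meas hρ.cut'.integrable hρ.odd
  have s2 := pairDiff_add_nonpos hν hδ (hu.reg t) (hv.reg t) hρ.cut.meas hρ.cut.integrable
    hρ.nonneg hρ.even
  have s3 := mul_le_mul_of_nonneg_left (add_le_add s1 s2) (sub_nonneg.2 hts.le)
  linarith

theorem Curve.pairAbs_le (hf : ∀ a b, |f a - f b| ≤ L * |a - b|) (hL : 0 ≤ L)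
    (hν : Integrable (fun z : ℝ => min 1 |z|) ν) (hρ : Mollifier r C ρ κ)
    (hu : Curve M N B u) (hv : Curve M N B v) {T : ℝ} (hT : 0 ≤ T)
    (hu' : ∀ δ > 0, ∀ y k s t, 0 ≤ s → s ≤ t → t ≤ T →
      entInt δ k (u t) (fun x => ρ (x - y)) - entInt δ k (u s) (fun x => ρ (x - y)) ≤
        ∫ σ in s..t, prodInt ν f δ k (u σ) (fun x => κ (x - y)) (fun x => ρ (x - y)))
    (hv' : ∀ δ > 0, ∀ y k s t, 0 ≤ s → s ≤ t → t ≤ T →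
      entInt δ k (v t) (fun x => ρ (x - y)) - entInt δ k (v s) (fun x => ρ (x - y)) ≤
        ∫ σ in s..t, prodInt ν f δ k (v σ) (fun x => κ (x - y)) (fun x => ρ (x - y))) :
    pairAbs ρ (u T) (v T) ≤ pairAbs ρ (u 0) (v 0) := by
  set δ : ℕ → ℝ := fun n => 1 / ((n : ℝ) + 1) with hδ
  have hδ0 : ∀ n, 0 < δ n := fun n => by positivity
  set m : ℕ → ℝ → ℝ := fun n t => (∫ x, min (δ n) |u t x|) + ∫ x, min (δ n) |v t x| with hm
  have hm0 : ∀ t, Tendsto (fun n => m n t) atTop (𝓝 0) := fun t => by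
    have := (tendsto_integral_min_abs (hu.reg t)).add (tendsto_integral_min_abs (hv.reg t))
    rw [add_zero] at this
    exact this
  have hle : ∀ {w : ℝ → ℝ → ℝ}, Curve M N B w → ∀ n t, ∫ x, min (δ n) |w t x| ≤ N :=
    fun {w} hw n t => (integral_mono (integrable_min_abs (hδ0 n).le (hw.reg t).meas (hw.reg t).int)
      (hw.reg t).int.abs fun x => min_le_right _ _).trans (hw.reg t).norm
  have hpos : ∀ (w : ℝ → ℝ → ℝ) n t, 0 ≤ ∫ x, min (δ n) |w t x| :=
    fun w n t => integral_nonneg fun x => le_min (hδ0 n).le (abs_nonneg _)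
  have hmc : ∀ n, Continuous (m n) := fun n => by
    have hcont : ∀ {w : ℝ → ℝ → ℝ}, Curve M N B w → Continuous fun t => ∫ x, min (δ n) |w t x| :=
      fun {w} hw => continuous_of_modulus _ hw.cont fun t ε hε =>
        ⟨1, Eventually.of_forall fun s => by
          have := abs_integral_min_abs_sub_le (hδ0 n).le (hw.reg s) (hw.reg t)
          linarith⟩
    exact (hcont hu).add (hcont hv)
  have hint : Tendsto (fun n => ∫ t in 0..T, (4 * L * ∫ w, |κ w|) * m n t) atTop (𝓝 0) := by
    have := intervalIntegral.tendsto_integral_filter_of_dominated_convergence (μ := volume)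
      (a := 0) (b := T) (F := m) (f := fun _ => 0) (l := atTop) (fun _ => N + N)
      (Eventually.of_forall fun n => (hmc n).aestronglyMeasurable)
      (Eventually.of_forall fun n => Eventually.of_forall fun t _ => by
        rw [Real.norm_of_nonneg (add_nonneg (hpos u n t) (hpos v n t))]
        exact add_le_add (hle hu n t) (hle hv n t))
      intervalIntegrable_const (Eventually.of_forall fun t _ => hm0 t)
    simp only [intervalIntegral.integral_const_mul]
    simpa using this.const_mul (4 * L * ∫ w, |κ w|)
  have hlim : Tendsto (fun n => (∫ t in 0..T, (4 * L * ∫ w, |κ w|) * m n t) +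
      (2 * ∫ w, |ρ w|) * m n T + (2 * ∫ w, |ρ w|) * m n 0 + pairAbs ρ (u 0) (v 0)) atTop
      (𝓝 (pairAbs ρ (u 0) (v 0))) := by
    simpa using ((hint.add ((hm0 T).const_mul (2 * ∫ w, |ρ w|))).add
      ((hm0 0).const_mul (2 * ∫ w, |ρ w|))).add_const (pairAbs ρ (u 0) (v 0))
  refine ge_of_tendsto hlim (Eventually.of_forall fun n => ?_)
  have h1 := hu.pairEnt_sub_le hf hL hν (hδ0 n) hρ hv hT (hu' _ (hδ0 n)) (hv' _ (hδ0 n))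
  have h2 := abs_le.1 (abs_pairEnt_sub_pairAbs_le (hδ0 n) (hu.reg T) (hv.reg T) hρ.cut.meas
    hρ.cut.integrable)
  have h3 := abs_le.1 (abs_pairEnt_sub_pairAbs_le (hδ0 n) (hu.reg 0) (hv.reg 0) hρ.cut.meas
    hρ.cut.integrable)
  simp only [hm]
  linarith [h2.1, h3.2]

end

theorem exists_cutoff_of_contDiff {φ : ℝ → ℝ} (hφ : ContDiff ℝ (⊤ : ℕ∞) φ)
    (hφs : HasCompactSupport φ) : ∃ R C, Cutoff R C φ ∧ Cutoff R C (deriv φ) := by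
  have hd : Continuous (deriv φ) := hφ.continuous_deriv (by simp)
  obtain ⟨C₁, h₁⟩ := hφ.continuous.bounded_above_of_compact_support hφs
  obtain ⟨C₂, h₂⟩ := hd.bounded_above_of_compact_support hφs.deriv
  obtain ⟨R, hR⟩ := hφs.isCompact.isBounded.subset_closedBall 0
  rw [Real.closedBall_eq_Icc, zero_sub, zero_add] at hR
  exact ⟨R, max C₁ C₂, ⟨hφ.continuous.measurable, fun x => (h₁ x).trans (le_max_left _ _),
    fun x hx => by_contra fun h => hx (hR (subset_tsupport _ h))⟩,
    ⟨hd.measurable, fun x => (h₂ x).trans (le_max_right _ _),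
    fun x hx => by_contra fun h => hx (hR (support_deriv_subset h))⟩⟩

theorem integral_smul_eq_of_nonneg {a b : ℝ → ℝ} (ha : LocallyIntegrable a)
    (hb : LocallyIntegrable b)
    (h : ∀ φ : ℝ → ℝ, ContDiff ℝ (⊤ : ℕ∞) φ → HasCompactSupport φ → (∀ x, 0 ≤ φ x) →
      ∫ x, φ x • a x = ∫ x, φ x • b x) {g : ℝ → ℝ} (hg : ContDiff ℝ (⊤ : ℕ∞) g)
    (hgs : HasCompactSupport g) : ∫ x, g x • a x = ∫ x, g x • b x := by
  obtain ⟨R, C, hR, -⟩ := exists_cutoff_of_contDiff hg hgs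
  let χ : ContDiffBump (0 : ℝ) := ⟨|R| + 1, |R| + 2, by positivity, by linarith⟩
  have hχ : ContDiff ℝ (⊤ : ℕ∞) χ := χ.contDiff
  have hmul : ∀ x, g x * χ x = g x := fun x => by
    by_cases hx : x ∈ Icc (-R) R
    · rw [χ.one_of_mem_closedBall, mul_one]
      rw [mem_closedBall_zero_iff, Real.norm_eq_abs]
      exact (abs_le.2 hx).trans ((le_abs_self R).trans (lt_add_one |R|).le)
    · rw [hR.supp x hx, zero_mul]
  have c : ∀ s : ℝ, ContDiff ℝ (⊤ : ℕ∞) fun x => (g x + s * χ x) ^ 2 := fun s =>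
    (hg.add (contDiff_const.mul hχ)).pow 2
  have cs : ∀ s : ℝ, HasCompactSupport fun x => (g x + s * χ x) ^ 2 := fun s => by
    have h1 : HasCompactSupport fun x => g x + s * χ x :=
      hgs.add (χ.hasCompactSupport.mul_left (f := fun _ => s))
    exact h1.comp_left (g := fun y : ℝ => y ^ 2) (by norm_num)
  have split : ∀ w : ℝ → ℝ, LocallyIntegrable w → ∫ x, g x • w x =
      4⁻¹ * ((∫ x, (g x + 1 * χ x) ^ 2 • w x) - ∫ x, (g x + -1 * χ x) ^ 2 • w x) :=
    fun w hw => by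
      have i : ∀ s : ℝ, Integrable fun x => (g x + s * χ x) ^ 2 • w x := fun s =>
        hw.integrable_smul_left_of_hasCompactSupport (c s).continuous (cs s)
      rw [← integral_sub (i 1) (i (-1)), ← integral_const_mul]
      refine integral_congr_ae (Eventually.of_forall fun x => ?_)
      simp only [smul_eq_mul]
      linear_combination (-w x) * hmul x
  rw [split a ha, split b hb, h _ (c 1) (cs 1) fun x => sq_nonneg _,
    h _ (c (-1)) (cs (-1)) fun x => sq_nonneg _]

theorem integral_abs_sub_mul_of_le {M : ℝ} {w φ : ℝ → ℝ} (hw : ∀ x, |w x| ≤ M)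
    (hφ : Integrable φ) (hwφ : Integrable fun x => φ x • w x) :
    (∫ x, |w x - M| * φ x = M * (∫ x, φ x) - ∫ x, φ x • w x) ∧
      ∫ x, |w x - -M| * φ x = M * (∫ x, φ x) + ∫ x, φ x • w x := by
  rw [← integral_const_mul, ← integral_sub (hφ.const_mul M) hwφ,
    ← integral_add (hφ.const_mul M) hwφ]
  constructor <;> refine integral_congr_ae (Eventually.of_forall fun x => ?_) <;>
    simp only [smul_eq_mul]
  · rw [abs_of_nonpos (by linarith [(abs_le.1 (hw x)).2])]; ring
  · rw [abs_of_nonneg (by linarith [(abs_le.1 (hw x)).1])]; ring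

theorem IsBVEntropySol.initial_eq {lam clam T : ℝ} {f u₀ : ℝ → ℝ} {v : ℝ → ℝ → ℝ}
    (hlam : lam ∈ Ioo (0 : ℝ) 1) (hclam : 0 < clam)
    {L : ℝ} (hf : ∀ a b, |f a - f b| ≤ L * |a - b|) (hL : 0 ≤ L)
    (h : IsBVEntropySol lam clam T f u₀ v) (hT : 0 < T) (hu₀ : Integrable u₀) {M₀ : ℝ}
    (hM₀ : ∀ x, |u₀ x| ≤ M₀) : ∀ᵐ x, v 0 x = u₀ x := by
  obtain ⟨M, N, B, hc⟩ := h.exists_curve hT.le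
  have hr : RegL1 M N B (v 0) := by simpa using hc.reg 0
  refine ae_eq_of_integral_contDiff_smul_eq hr.int.locallyIntegrable hu₀.locallyIntegrable
    fun g hg hgs => integral_smul_eq_of_nonneg hr.int.locallyIntegrable hu₀.locallyIntegrable
      (fun φ hφ hφs hφ0 => ?_) hg hgs
  obtain ⟨R, C, c, c'⟩ := exists_cutoff_of_contDiff hφ hφs
  have key := fun k => (h.kruzkov_inequality hlam hclam hf hL hT hc hφ hφs hφ0 c c' k).1
  have i1 : Integrable fun x => φ x • v 0 x :=
    hr.int.locallyIntegrable.integrable_smul_left_of_hasCompactSupport hφ.continuous hφs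
  have i2 : Integrable fun x => φ x • u₀ x :=
    hu₀.locallyIntegrable.integrable_smul_left_of_hasCompactSupport hφ.continuous hφs
  have e1 := integral_abs_sub_mul_of_le (M := max M M₀)
    (fun x => (hr.bdd x).trans (le_max_left _ _)) c.integrable i1
  have e2 := integral_abs_sub_mul_of_le (M := max M M₀)
    (fun x => (hM₀ x).trans (le_max_right _ _)) c.integrable i2
  have k1 := key (max M M₀)
  have k2 := key (-max M M₀)
  rw [e1.1, e2.1] at k1
  rw [e1.2, e2.2] at k2
  exact le_antisymm (by linarith) (by linarith)

theorem RegL1.mono_const {M N B M' N' B' : ℝ} {w : ℝ → ℝ} (h : RegL1 M N B w) (hM : M ≤ M')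
    (hN : N ≤ N') (hB : B ≤ B') : RegL1 M' N' B' w :=
  ⟨h.meas, fun x => (h.bdd x).trans hM, h.int, h.norm.trans hN,
    fun z => (h.trans z).trans (mul_le_mul_of_nonneg_right hB (abs_nonneg z))⟩

theorem Curve.mono_const {M N B M' N' B' : ℝ} {u : ℝ → ℝ → ℝ} (h : Curve M N B u) (hM : M ≤ M')
    (hN : N ≤ N') (hB : B ≤ B') : Curve M' N' B' u :=
  ⟨fun t => (h.reg t).mono_const hM hN hB, h.cont⟩

theorem IsBVEntropySol.entInt_translate_sub_le {lam clam T : ℝ} {f u₀ : ℝ → ℝ} {v : ℝ → ℝ → ℝ}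
    (hlam : lam ∈ Ioo (0 : ℝ) 1) (hclam : 0 < clam)
    {L : ℝ} (hf : ∀ a b, |f a - f b| ≤ L * |a - b|) (hL : 0 ≤ L)
    (h : IsBVEntropySol lam clam T f u₀ v) (hT : 0 < T) {M N B : ℝ}
    (hc : Curve M N B fun t => v (projIcc 0 T hT.le t)) {r C : ℝ} {ρ : ℝ → ℝ}
    (hρ : ContDiff ℝ (⊤ : ℕ∞) ρ) (hρs : HasCompactSupport ρ) (hm : Mollifier r C ρ (deriv ρ))
    {δ : ℝ} (hδ : 0 < δ) (y k s t : ℝ) (hs : 0 ≤ s) (hst : s ≤ t) (ht : t ≤ T) :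
    entInt δ k (v (projIcc 0 T hT.le t)) (fun x => ρ (x - y)) -
        entInt δ k (v (projIcc 0 T hT.le s)) (fun x => ρ (x - y)) ≤
      ∫ σ in s..t, prodInt (levyMeasure lam clam) f δ k (v (projIcc 0 T hT.le σ))
        (fun x => deriv ρ (x - y)) (fun x => ρ (x - y)) := by
  have hd : deriv (fun x => ρ (x - y)) = fun x => deriv ρ (x - y) :=
    funext fun x => deriv_comp_sub_const ..
  have c' : Cutoff (r + |y|) C fun x => deriv ρ (x - y) := hm.cut'.comp_sub_right y
  have hs' : HasCompactSupport fun x => ρ (x - y) :=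
    hρs.comp_homeomorph (Homeomorph.subRight y)
  refine hc.entInt_sub_le_integral hf (integrable_levyMeasure hlam hclam) hL hδ c'
    (hm.cut.comp_sub_right y) hst fun k => ?_
  have := (h.kruzkov_inequality hlam hclam hf hL hT hc (hρ.comp (contDiff_id.sub contDiff_const))
    hs' (fun x => hm.nonneg _) (hm.cut.comp_sub_right y) (hd ▸ c') k).2 s t hs hst ht
  simp only [Function.comp_def, id] at this
  rwa [hd] at this

theorem IsBVEntropySol.integral_abs_sub_eq_zero {lam clam T : ℝ} {f u₀ : ℝ → ℝ}
    {u v : ℝ → ℝ → ℝ} (hlam : lam ∈ Ioo (0 : ℝ) 1) (hclam : 0 < clam)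
    {L : ℝ} (hf : ∀ a b, |f a - f b| ≤ L * |a - b|) (hL : 0 ≤ L) (hT : 0 < T)
    (hu₀ : Integrable u₀) {M₀ : ℝ} (hM₀ : ∀ x, |u₀ x| ≤ M₀)
    (hu : IsBVEntropySol lam clam T f u₀ u) (hv : IsBVEntropySol lam clam T f u₀ v) {t : ℝ}
    (ht : t ∈ Icc 0 T) : ∫ x, |u t x - v t x| = 0 := by
  obtain ⟨M, N, B, cu⟩ := hu.exists_curve hT.le
  obtain ⟨M', N', B', cv⟩ := hv.exists_curve hT.le
  replace cu := cu.mono_const (le_max_left M M') (le_max_left N N') (le_max_left B B')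
  replace cv := cv.mono_const (le_max_right M M') (le_max_right N N') (le_max_right B B')
  generalize max M M' = M, max N N' = N, max B B' = B at cu cv
  have p0 : (projIcc 0 T hT.le 0 : ℝ) = 0 := by rw [projIcc_left]
  have pt : (projIcc 0 T hT.le t : ℝ) = t := by rw [projIcc_of_mem hT.le ht]
  have ru := cu.reg t
  have rv := cv.reg t
  have ru0 := cu.reg 0
  have rv0 := cv.reg 0
  simp only [p0, pt] at ru rv ru0 rv0
  have hzero : ∫ x, |u 0 x - v 0 x| = 0 := by
    refine integral_eq_zero_of_ae ?_
    filter_upwards [hu.initial_eq hlam hclam hf hL hT hu₀ hM₀,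
      hv.initial_eq hlam hclam hf hL hT hu₀ hM₀] with x h1 h2
    rw [h1, h2, sub_self, abs_zero, Pi.zero_apply]
  have key : ∀ r > 0, ∫ x, |u t x - v t x| ≤ 2 * B * r := fun r hr => by
    obtain ⟨ρ, hρ, hρs, C, hm⟩ := exists_mollifier hr
    have h1 := cu.pairAbs_le hf hL (integrable_levyMeasure hlam hclam) hm cv ht.1
      (fun δ hδ y k a b ha hab hb => hu.entInt_translate_sub_le hlam hclam hf hL hT cu hρ hρs hm hδ
        y k a b ha hab (hb.trans ht.2))
      (fun δ hδ y k a b ha hab hb => hv.entInt_translate_sub_le hlam hclam hf hL hT cv hρ hρs hm hδ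
        y k a b ha hab (hb.trans ht.2))
    simp only [p0, pt] at h1
    have hsupp : ∀ x, r < |x| → ρ x = 0 := fun x hx =>
      hm.cut.supp x fun h => hx.not_ge (abs_le.2 h)
    have h2 := abs_le.1 (abs_pairAbs_sub_le ru rv hm.cut.meas hm.cut.integrable hm.nonneg
      hm.integral_eq hsupp)
    have h3 := abs_le.1 (abs_pairAbs_sub_le ru0 rv0 hm.cut.meas hm.cut.integrable hm.nonneg
      hm.integral_eq hsupp)
    linarith [h2.1, h3.2]
  refine le_antisymm ?_ (integral_nonneg fun x => abs_nonneg _)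
  have hlim : Tendsto (fun r : ℝ => 2 * B * r) (𝓝[>] 0) (𝓝 (2 * B * 0)) :=
    ((continuous_const.mul continuous_id).tendsto 0).mono_left nhdsWithin_le_nhds
  rw [mul_zero] at hlim
  exact ge_of_tendsto hlim (eventually_mem_nhdsWithin.mono fun r hr => key r hr)

/-- Corollary 4.5 (well-posedness): for `u₀ ∈ L¹(ℝ) ∩ BV(ℝ)` there exists a BV entropy
solution of `∂_t u + ∂_x f(u) = g_λ[u]`, and it is unique: any two BV entropy solutions
with the same initial datum coincide in `L¹(ℝ)` for every `t ∈ [0,T]`. -/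
theorem stmt_18 (lam clam : ℝ) (hlam : lam ∈ Set.Ioo (0 : ℝ) 1) (hclam : 0 < clam)
    (f : ℝ → ℝ) (Lf : ℝ≥0) (hf : LipschitzWith Lf f)
    (T : ℝ) (hT : 0 < T)
    (u₀ : ℝ → ℝ) (hu₀ : Integrable u₀) (hu₀bv : BoundedVariationOn u₀ Set.univ) :
    (∃ u : ℝ → ℝ → ℝ, IsBVEntropySol lam clam T f u₀ u) ∧
    ∀ u v : ℝ → ℝ → ℝ, IsBVEntropySol lam clam T f u₀ u →
      IsBVEntropySol lam clam T f u₀ v →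
      ∀ t ∈ Set.Icc (0 : ℝ) T, (∫ x : ℝ, |u t x - v t x|) = 0 := by
  have hf' : ∀ a b, |f a - f b| ≤ Lf * |a - b| := fun a b => by
    have := hf.dist_le_mul a b
    rwa [Real.dist_eq, Real.dist_eq] at this
  have hM : ∀ x, |u₀ x| ≤ |u₀ 0| + (eVariationOn u₀ univ).toReal := fun x => by
    have h1 := hu₀bv.dist_le (mem_univ x) (mem_univ (0 : ℝ))
    rw [Real.dist_eq] at h1
    have h2 := abs_sub_abs_le_abs_sub (u₀ x) (u₀ 0)
    linarith
  exact ⟨exists_isBVEntropySol hlam hclam hf' Lf.coe_nonneg hT hu₀ hu₀bv, fun u v hu hv t ht =>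
    IsBVEntropySol.integral_abs_sub_eq_zero hlam hclam hf' Lf.coe_nonneg hT hu₀ hM hu hv ht⟩
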